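/- Let n ≥ 1 and 1 ≤ k ≤ n+1. Let Ψ be a nonzero vector in (ℂ²)^⊗(2n+1) satisfying H_{2n+1}Ψ = E₀Ψ, where H_{2n+1} is the periodic XXZ Hamiltonian at Δ = −1/2 and E₀ is the smallest eigenvalue of H_{2n+1}, and satisfying SᶻΨ = +(1/2)Ψ. Then the emptiness formation probabilities E(k) are nonzero and E(k−1)/E(k) = [(2k−2)!·(2k−1)!·(2n+k)!·(n−k+1)!] / [(k−1)!·(3k−2)!·(2n−k+1)!·(n+k)!]. -/

import Mathlib

noncomputable section

/-- Spin configurations of a chain of length `N`; `true` = spin up `↑`. -/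
abbrev Cfg (N : ℕ) := Fin N → Bool

/-- Pauli matrix `σ^x` in the basis `(↑,↓)`. -/
def sigmaX : Matrix Bool Bool ℂ := Matrix.of fun b c => if b = c then 0 else 1

/-- Pauli matrix `σ^y` in the basis `(↑,↓)`. -/
def sigmaY : Matrix Bool Bool ℂ :=
  Matrix.of fun b c => if b = c then 0 else if b then -Complex.I else Complex.I

/-- Pauli matrix `σ^z` in the basis `(↑,↓)`. -/
def sigmaZ : Matrix Bool Bool ℂ :=
  Matrix.of fun b c => if b = c then (if b then 1 else -1) else 0

/-- `σ⁺ = σ^x + i σ^y`. -/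
def sigmaP : Matrix Bool Bool ℂ := sigmaX + Complex.I • sigmaY

/-- `σ⁻ = σ^x − i σ^y`. -/
def sigmaM : Matrix Bool Bool ℂ := sigmaX - Complex.I • sigmaY

/-- A one-site operator `A` acting on the `i`-th tensor factor of `(ℂ²)^{⊗N}`. -/
def localOp (N : ℕ) (i : Fin N) (A : Matrix Bool Bool ℂ) : Matrix (Cfg N) (Cfg N) ℂ :=
  Matrix.of fun f g =>
    A (f i) (g i) * ∏ j ∈ Finset.univ.erase i, (if f j = g j then (1 : ℂ) else 0)

/-- The cyclic successor `i+1` of a site index (mod `N`). -/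
def cyc (N : ℕ) (i : Fin N) : Fin N :=
  ⟨(i.val + 1) % N, Nat.mod_lt _ (by have := i.isLt; omega)⟩

/-- Periodic XXZ Hamiltonian at `Δ = −1/2`:
`H_N = −(1/2)·Σ_{i=1}^{N} (σ^x_i σ^x_{i+1} + σ^y_i σ^y_{i+1} − (1/2) σ^z_i σ^z_{i+1})`,
site indices mod `N`. -/
def Hper (N : ℕ) : Matrix (Cfg N) (Cfg N) ℂ :=
  (-(1/2) : ℂ) • ∑ i : Fin N,
    (localOp N i sigmaX * localOp N (cyc N i) sigmaX
      + localOp N i sigmaY * localOp N (cyc N i) sigmaY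
      - (1/2 : ℂ) • (localOp N i sigmaZ * localOp N (cyc N i) sigmaZ))

/-- Total spin `Sᶻ = (1/2)·Σ_i σ^z_i`. -/
def Sz (N : ℕ) : Matrix (Cfg N) (Cfg N) ℂ := (1/2 : ℂ) • ∑ i : Fin N, localOp N i sigmaZ

/-- Projector onto spin up at site `i`: `p_i⁺ = (1 + σ^z_i)/2`. -/
def pUp (N : ℕ) (i : Fin N) : Matrix (Cfg N) (Cfg N) ℂ := (1/2 : ℂ) • (1 + localOp N i sigmaZ)

/-- The product `Π_{i=1}^{k} p_i⁺` of projectors onto spin up at the first `k` sites. -/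
def projProd (N k : ℕ) : Matrix (Cfg N) (Cfg N) ℂ :=
  (((List.finRange N).filter fun i : Fin N => decide (i.val < k)).map (pUp N)).prod

/-- Standard Hermitian inner product on `(ℂ²)^{⊗N}`. -/
def hermInner {N : ℕ} (v w : Cfg N → ℂ) : ℂ := ∑ f, (starRingEnd ℂ) (v f) * w f

/-- Emptiness formation probability `E(k) = ⟨Ψ, Π_{i=1}^k p_i⁺ Ψ⟩ / ⟨Ψ, Ψ⟩`. -/
def EFP {N : ℕ} (Ψ : Cfg N → ℂ) (k : ℕ) : ℂ :=
  hermInner Ψ ((projProd N k).mulVec Ψ) / hermInner Ψ Ψ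

namespace XXZ
open MvPolynomial

/-- Polynomials in the inhomogeneity parameters. -/
abbrev R := MvPolynomial ℕ ℂ

/-- The transposition of the sites `i` and `i + 1`. -/
abbrev sw (i : ℕ) : Equiv.Perm ℕ := Equiv.swap i (i + 1)

lemma eval_rename_perm (σ : ℕ → ℕ) (x : ℕ → ℂ) (f : R) :
    eval x (rename σ f) = eval (x ∘ σ) f := by
  rw [eval_rename]

lemma dvd_rename_sub (i : ℕ) (f : R) :
    (X (i + 1) - X i : R) ∣ rename (sw i) f - f := by
  induction f using MvPolynomial.induction_on with
  | C a => simp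
  | add p r hp hr =>
    have : rename (sw i) (p + r) - (p + r) = (rename (sw i) p - p) + (rename (sw i) r - r) := by
      rw [map_add]; ring
    rw [this]; exact dvd_add hp hr
  | mul_X p j hp =>
    have : rename (sw i) (p * X j) - p * X j
        = (rename (sw i) p - p) * X (sw i j) + p * (X (sw i j) - X j) := by
      rw [map_mul, rename_X]; ring
    rw [this]
    refine dvd_add (Dvd.dvd.mul_right hp _) (Dvd.dvd.mul_left ?_ _)
    by_cases h1 : j = i
    · subst h1; simp
    by_cases h2 : j = i + 1
    · subst h2; simp only [sw, Equiv.swap_apply_right]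
      rw [← neg_sub]; exact Dvd.intro (-1) (by ring)
    · rw [sw, Equiv.swap_apply_of_ne_of_ne h1 h2]; simp

/-- Divided difference operator. -/
def dd (i : ℕ) (f : R) : R := (dvd_rename_sub i f).choose

lemma dd_spec (i : ℕ) (f : R) : (X (i + 1) - X i) * dd i f = rename (sw i) f - f :=
  (dvd_rename_sub i f).choose_spec.symm

/-- Demazure–Lusztig operator with parameters `q`, `p`. -/
def TT (q p : ℂ) (i : ℕ) (f : R) : R := (C q * X i - C p * X (i + 1)) * dd i f - C q * f

lemma TT_spec (q p : ℂ) (i : ℕ) (f : R) :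
    (X (i + 1) - X i) * TT q p i f
      = (C q * X i - C p * X (i + 1)) * rename (sw i) f - (C q - C p) * X (i + 1) * f := by
  have := dd_spec i f
  unfold TT
  linear_combination (C q * X i - C p * X (i + 1)) * this

lemma TT_eval (q p : ℂ) (i : ℕ) (f : R) (x : ℕ → ℂ) :
    (x (i + 1) - x i) * eval x (TT q p i f)
      = (q * x i - p * x (i + 1)) * eval (x ∘ sw i) f - (q - p) * x (i + 1) * eval x f := by
  have := congrArg (eval x) (TT_spec q p i f)
  simpa [eval_rename] using this

lemma eq_of_eval_of_ne {f g D : R} (hD : D ≠ 0)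
    (h : ∀ x : ℕ → ℂ, eval x D ≠ 0 → eval x f = eval x g) : f = g := by
  have : (f - g) * D = 0 := by
    apply MvPolynomial.funext
    intro x
    by_cases hx : eval x D = 0
    · simp [hx]
    · simp [h x hx]
  rcases mul_eq_zero.mp this with h | h
  · exact sub_eq_zero.mp h
  · exact absurd h hD

lemma X_sub_X_ne {i j : ℕ} (h : i ≠ j) : (X i - X j : R) ≠ 0 := by
  intro h0
  exact h (MvPolynomial.X_injective (sub_eq_zero.mp h0))

/-- Symmetry of a polynomial under exchanging the sites `i`, `i + 1` carrying equal spins. -/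
def Par (q p : ℂ) (i : ℕ) (f : R) : Prop :=
  ∀ x : ℕ → ℂ, (q * x i - p * x (i + 1)) * eval (x ∘ sw i) f
    = (q * x (i + 1) - p * x i) * eval x f

lemma sw_comm {i j : ℕ} (h : i + 2 ≤ j ∨ j + 2 ≤ i) (x : ℕ → ℂ) :
    (x ∘ sw i) ∘ sw j = (x ∘ sw j) ∘ sw i := by
  have : (sw i) * (sw j) = sw j * sw i := by
    apply Equiv.Perm.Disjoint.commute
    rw [Equiv.Perm.disjoint_iff_eq_or_eq]
    intro a
    simp only [sw, Equiv.swap_apply_def]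
    grind
  funext a
  exact congrArg x (congrFun (congrArg DFunLike.coe this) a)

lemma comp_sw_left (i : ℕ) {α : Type*} (x : ℕ → α) : (x ∘ sw i) i = x (i + 1) := by simp [sw]
lemma comp_sw_right (i : ℕ) {α : Type*} (x : ℕ → α) : (x ∘ sw i) (i + 1) = x i := by simp [sw]
lemma comp_sw_of_ne {i j : ℕ} {α : Type*} (x : ℕ → α) (h1 : j ≠ i) (h2 : j ≠ i + 1) :
    (x ∘ sw i) j = x j := by
  simp [sw, Equiv.swap_apply_of_ne_of_ne h1 h2]
lemma comp_sw_sw (i : ℕ) {α : Type*} (x : ℕ → α) : (x ∘ sw i) ∘ sw i = x := by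
  funext a; simp [sw]

lemma TT_comm (q p : ℂ) {i j : ℕ} (h : i + 2 ≤ j ∨ j + 2 ≤ i) (f : R) :
    TT q p i (TT q p j f) = TT q p j (TT q p i f) := by
  apply eq_of_eval_of_ne (D := (X (i + 1) - X i) * (X (j + 1) - X j))
    (mul_ne_zero (X_sub_X_ne (by omega)) (X_sub_X_ne (by omega)))
  intro x hx
  have h1 := TT_eval q p i (TT q p j f) x
  have h2 := TT_eval q p j (TT q p i f) x
  have h3 := TT_eval q p j f x
  have h4 := TT_eval q p j f (x ∘ sw i)
  have h5 := TT_eval q p i f x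
  have h6 := TT_eval q p i f (x ∘ sw j)
  rw [comp_sw_of_ne x (by omega) (by omega), comp_sw_of_ne x (by omega) (by omega)] at h4 h6
  rw [sw_comm h] at h4
  simp only [map_mul, map_sub, eval_X] at hx
  apply mul_left_cancel₀ hx
  linear_combination (x (j+1) - x j) * h1 - (x (i+1) - x i) * h2
    + (q * x i - p * x (i+1)) * h4 - (q - p) * x (i+1) * h3
    - (q * x j - p * x (j+1)) * h6 + (q - p) * x (j+1) * h5

lemma Par.TT_far {q p : ℂ} {i j : ℕ} (h : i + 2 ≤ j ∨ j + 2 ≤ i) {f : R} (hf : Par q p i f) :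
    Par q p i (TT q p j f) := by
  intro x
  have key : (C q * X i - C p * X (i + 1)) * rename (sw i) (TT q p j f)
      = (C q * X (i + 1) - C p * X i) * TT q p j f := by
    apply eq_of_eval_of_ne (D := (X (j + 1) - X j)) (X_sub_X_ne (by omega))
    intro x hx
    have h1 := TT_eval q p j f x
    have h2 := TT_eval q p j f (x ∘ sw i)
    rw [comp_sw_of_ne x (by omega) (by omega), comp_sw_of_ne x (by omega) (by omega),
      sw_comm h] at h2
    have h3 := hf x
    have h4 := hf (x ∘ sw j)
    rw [comp_sw_of_ne x (by omega) (by omega), comp_sw_of_ne x (by omega) (by omega)] at h4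
    simp only [map_sub, eval_X] at hx
    simp only [map_mul, map_sub, eval_X, eval_C, eval_rename]
    apply mul_left_cancel₀ hx
    linear_combination (q * x i - p * x (i+1)) * h2 - (q * x (i+1) - p * x i) * h1
      + (q * x j - p * x (j+1)) * h4 - (q - p) * x (j+1) * h3
  simpa [eval_rename] using congrArg (eval x) key

lemma sw_braid (i : ℕ) (x : ℕ → ℂ) :
    ((x ∘ sw i) ∘ sw (i+1)) ∘ sw i = ((x ∘ sw (i+1)) ∘ sw i) ∘ sw (i+1) := by
  funext a
  simp only [Function.comp, sw, Equiv.swap_apply_def]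
  grind

lemma Par.braid_up {q p : ℂ} {i : ℕ} {f : R} (hf : Par q p (i + 1) f) :
    Par q p i (TT q p (i + 1) (TT q p i f)) := by
  intro x
  have key : (C q * X i - C p * X (i + 1)) * rename (sw i) (TT q p (i + 1) (TT q p i f))
      = (C q * X (i + 1) - C p * X i) * (TT q p (i + 1) (TT q p i f)) := by
    apply eq_of_eval_of_ne (D := (X (i + 1) - X i) * (X (i + 2) - X (i + 1)) * (X (i + 2) - X i))
      (mul_ne_zero (mul_ne_zero (X_sub_X_ne (by omega)) (X_sub_X_ne (by omega)))
        (X_sub_X_ne (by omega)))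
    intro x hx
    simp only [map_mul, map_sub, eval_X] at hx
    simp only [map_mul, map_sub, eval_X, eval_C, eval_rename]
    have h1 := TT_eval q p (i+1) (TT q p i f) x
    have h2 := TT_eval q p (i+1) (TT q p i f) (x ∘ sw i)
    have g1 := TT_eval q p i f x
    have g2 := TT_eval q p i f (x ∘ sw (i+1))
    have g3 := TT_eval q p i f (x ∘ sw i)
    have g4 := TT_eval q p i f ((x ∘ sw i) ∘ sw (i+1))
    have r1 := hf x
    have r2 := hf (x ∘ sw i)
    have r3 := hf ((x ∘ sw (i+1)) ∘ sw i)
    rw [← sw_braid] at r3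
    rw [comp_sw_sw] at g3
    simp only [add_assoc, Nat.reduceAdd] at *
    have e1 : (x ∘ sw i) i = x (i+1) := comp_sw_left i x
    have e2 : (x ∘ sw i) (i+1) = x i := comp_sw_right i x
    have e3 : (x ∘ sw i) (i+2) = x (i+2) := comp_sw_of_ne x (by omega) (by omega)
    have e4 : (x ∘ sw (i+1)) i = x i := comp_sw_of_ne x (by omega) (by omega)
    have e5 : (x ∘ sw (i+1)) (i+1) = x (i+2) := comp_sw_left (i+1) x
    have e6 : (x ∘ sw (i+1)) (i+2) = x (i+1) := comp_sw_right (i+1) x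
    have e7 : ((x ∘ sw i) ∘ sw (i+1)) i = x (i+1) := by
      rw [comp_sw_of_ne _ (by omega) (by omega), e1]
    have e8 : ((x ∘ sw i) ∘ sw (i+1)) (i+1) = x (i+2) := by
      rw [comp_sw_left (i+1) (x ∘ sw i)]; exact e3
    have e9 : ((x ∘ sw (i+1)) ∘ sw i) (i+1) = x i := by
      rw [comp_sw_right i (x ∘ sw (i+1))]; exact e4
    have e10 : ((x ∘ sw (i+1)) ∘ sw i) (i+2) = x (i+1) := by
      rw [comp_sw_of_ne _ (by omega) (by omega)]; exact e6
    rw [e2, e3] at h2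
    rw [e4, e5] at g2
    rw [e1, e2] at g3
    rw [e7, e8] at g4
    rw [e2, e3] at r2
    rw [e9, e10] at r3
    apply mul_left_cancel₀ hx
    set a := x i
    set b := x (i+1)
    set c := x (i+2)
    linear_combination (b - a) * (c - b) * (q * a - p * b) * h2
      + (b - a) * (q * a - p * b) * (q * a - p * c) * g4
      + (c - b) * (q * a - p * b) * (q - p) * c * g3
      - (b - a) * (c - a) * (q * b - p * a) * h1
      - (b - a) * (q * b - p * a) * (q * b - p * c) * g2
      + (c - a) * (q * b - p * a) * (q - p) * c * g1
      + (b - a) * (q * a - p * c) * (q * b - p * c) * r3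
      - (b - a) * (q * a - p * b) * (q - p) * c * r2
      + (b - a) * (q * b - p * a) * (q - p) * c * r1
  simpa [eval_rename] using congrArg (eval x) key

lemma Par.braid_down {q p : ℂ} {i : ℕ} {f : R} (hf : Par q p i f) :
    Par q p (i + 1) (TT q p i (TT q p (i + 1) f)) := by
  intro x
  have key : (C q * X (i + 1) - C p * X (i + 2)) * rename (sw (i + 1)) (TT q p i (TT q p (i + 1) f))
      = (C q * X (i + 2) - C p * X (i + 1)) * (TT q p i (TT q p (i + 1) f)) := by
    apply eq_of_eval_of_ne (D := (X (i + 1) - X i) * (X (i + 2) - X (i + 1)) * (X (i + 2) - X i))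
      (mul_ne_zero (mul_ne_zero (X_sub_X_ne (by omega)) (X_sub_X_ne (by omega)))
        (X_sub_X_ne (by omega)))
    intro x hx
    simp only [map_mul, map_sub, eval_X] at hx
    simp only [map_mul, map_sub, eval_X, eval_C, eval_rename]
    have h1 := TT_eval q p i (TT q p (i+1) f) x
    have h2 := TT_eval q p i (TT q p (i+1) f) (x ∘ sw (i+1))
    have g1 := TT_eval q p (i+1) f x
    have g2 := TT_eval q p (i+1) f (x ∘ sw i)
    have g3 := TT_eval q p (i+1) f (x ∘ sw (i+1))
    have g4 := TT_eval q p (i+1) f ((x ∘ sw (i+1)) ∘ sw i)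
    have r1 := hf x
    have r2 := hf (x ∘ sw (i+1))
    have r3 := hf ((x ∘ sw i) ∘ sw (i+1))
    rw [sw_braid] at r3
    rw [comp_sw_sw] at g3
    simp only [add_assoc, Nat.reduceAdd] at *
    have e1 : (x ∘ sw i) i = x (i+1) := comp_sw_left i x
    have e2 : (x ∘ sw i) (i+1) = x i := comp_sw_right i x
    have e3 : (x ∘ sw i) (i+2) = x (i+2) := comp_sw_of_ne x (by omega) (by omega)
    have e4 : (x ∘ sw (i+1)) i = x i := comp_sw_of_ne x (by omega) (by omega)
    have e5 : (x ∘ sw (i+1)) (i+1) = x (i+2) := comp_sw_left (i+1) x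
    have e6 : (x ∘ sw (i+1)) (i+2) = x (i+1) := comp_sw_right (i+1) x
    have e7 : ((x ∘ sw i) ∘ sw (i+1)) i = x (i+1) := by
      rw [comp_sw_of_ne _ (by omega) (by omega), e1]
    have e8 : ((x ∘ sw i) ∘ sw (i+1)) (i+1) = x (i+2) := by
      rw [comp_sw_left (i+1) (x ∘ sw i)]; exact e3
    have e9 : ((x ∘ sw (i+1)) ∘ sw i) (i+1) = x i := by
      rw [comp_sw_right i (x ∘ sw (i+1))]; exact e4
    have e10 : ((x ∘ sw (i+1)) ∘ sw i) (i+2) = x (i+1) := by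
      rw [comp_sw_of_ne _ (by omega) (by omega)]; exact e6
    rw [e4, e5] at h2 r2
    rw [e2, e3] at g2
    rw [e5, e6] at g3
    rw [e9, e10] at g4
    rw [e7, e8] at r3
    apply mul_left_cancel₀ hx
    set a := x i
    set b := x (i+1)
    set c := x (i+2)
    linear_combination (b - a) * (c - b) * (q * b - p * c) * h2
      + (c - b) * (q * b - p * c) * (q * a - p * c) * g4
      + (b - a) * (q * b - p * c) * (q - p) * c * g3
      - (c - b) * (c - a) * (q * c - p * b) * h1
      - (c - b) * (q * c - p * b) * (q * a - p * b) * g2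
      + (c - a) * (q * c - p * b) * (q - p) * b * g1
      + (c - b) * (q * a - p * c) * (q * a - p * b) * r3
      - (c - b) * (q * b - p * c) * (q - p) * b * r2
      + (c - b) * (q * c - p * b) * (q - p) * c * r1
  simpa [eval_rename] using congrArg (eval x) key

section Psi

variable (q p : ℂ) (N : ℕ)

/-- The ordered pairs of sites. -/
def prs : Finset (ℕ × ℕ) := (Finset.range N ×ˢ Finset.range N).filter fun e => e.1 < e.2

/-- The component on the configuration with all up spins to the left. -/
def P0 (μ : ℕ → Bool) : R :=
  ∏ e ∈ prs N, if μ e.1 = μ e.2 then C q * X e.1 - C p * X e.2 else 1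

/-- `μ` has a down spin at `i` followed by an up spin. -/
def Desc (μ : ℕ → Bool) (i : ℕ) : Prop := i + 1 < N ∧ μ i = false ∧ μ (i + 1) = true

open Classical in
/-- Components of the polynomial solution, by recursion on a fuel parameter. -/
def psiAux : ℕ → (ℕ → Bool) → R
  | 0, μ => P0 q p N μ
  | m + 1, μ => if h : ∃ i, Desc N μ i then
      TT q p h.choose (psiAux m (μ ∘ sw h.choose)) else P0 q p N μ

/-- The sum of the positions of the up spins. -/
def ms (μ : ℕ → Bool) : ℕ := ∑ i ∈ Finset.range N, if μ i then i else 0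

/-- Components of the polynomial solution of the exchange relations. -/
def psi (μ : ℕ → Bool) : R := psiAux q p N (ms N μ) μ

variable {q p N}

lemma ms_desc {μ : ℕ → Bool} {i : ℕ} (h : Desc N μ i) : ms N μ = ms N (μ ∘ sw i) + 1 := by
  obtain ⟨h1, h2, h3⟩ := h
  unfold ms
  have hs : ∀ ν : ℕ → Bool, (∑ j ∈ Finset.range N, if ν j then j else 0)
      = (if ν i then i else 0) + ((if ν (i+1) then i + 1 else 0)
        + ∑ j ∈ ((Finset.range N).erase i).erase (i+1), if ν j then j else 0) := by
    intro ν
    rw [← Finset.add_sum_erase (Finset.range N) _ (Finset.mem_range.mpr (by omega : i < N)),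
      ← Finset.add_sum_erase ((Finset.range N).erase i) _
        (a := i + 1) (by simp; omega)]
  rw [hs μ, hs (μ ∘ sw i), comp_sw_left, comp_sw_right, h2, h3]
  have : ∑ j ∈ ((Finset.range N).erase i).erase (i+1), (if μ j then j else 0)
      = ∑ j ∈ ((Finset.range N).erase i).erase (i+1), (if (μ ∘ sw i) j then j else 0) := by
    apply Finset.sum_congr rfl
    intro j hj
    simp only [Finset.mem_erase] at hj
    rw [comp_sw_of_ne μ hj.2.1 hj.1]
  rw [this]; simp; omega

lemma psi_of_not {μ : ℕ → Bool} (h : ¬ ∃ i, Desc N μ i) : psi q p N μ = P0 q p N μ := by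
  unfold psi
  cases ms N μ with
  | zero => rfl
  | succ m => simp only [psiAux]; rw [dif_neg h]

lemma psi_exists {μ : ℕ → Bool} (h : ∃ i, Desc N μ i) :
    ∃ i, Desc N μ i ∧ psi q p N μ = TT q p i (psi q p N (μ ∘ sw i)) := by
  refine ⟨h.choose, h.choose_spec, ?_⟩
  conv_lhs => unfold psi
  rw [ms_desc h.choose_spec]
  simp only [psiAux]
  rw [dif_pos h]; rfl

lemma desc_sw {μ : ℕ → Bool} {i j : ℕ} (hj : Desc N μ j) (h : i + 2 ≤ j ∨ j + 2 ≤ i) :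
    Desc N (μ ∘ sw i) j := by
  obtain ⟨h1, h2, h3⟩ := hj
  refine ⟨h1, ?_, ?_⟩
  · rw [comp_sw_of_ne _ (by omega) (by omega)]; exact h2
  · rw [comp_sw_of_ne _ (by omega) (by omega)]; exact h3

lemma sw_comm' {i j : ℕ} (h : i + 2 ≤ j ∨ j + 2 ≤ i) {α : Type*} (x : ℕ → α) :
    (x ∘ sw i) ∘ sw j = (x ∘ sw j) ∘ sw i := by
  funext a
  simp only [Function.comp, sw, Equiv.swap_apply_def]
  grind

lemma psi_desc {μ : ℕ → Bool} {j : ℕ} (hj : Desc N μ j) :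
    psi q p N μ = TT q p j (psi q p N (μ ∘ sw j)) := by
  induction hm : ms N μ using Nat.strong_induction_on generalizing μ j with
  | _ m ih =>
    obtain ⟨i, hi, he⟩ := psi_exists (q := q) (p := p) ⟨j, hj⟩
    by_cases hij : i = j
    · rw [← hij]; exact he
    have far : i + 2 ≤ j ∨ j + 2 ≤ i := by
      have h1 := hi.2; have h2 := hj.2
      by_contra hc
      have : j = i + 1 ∨ i = j + 1 := by omega
      rcases this with rfl | rfl
      · simp_all
      · simp_all
    have m1 := ms_desc hi
    have m2 := ms_desc hj
    rw [he, ih (ms N (μ ∘ sw i)) (by omega) (desc_sw hj far) rfl,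
      ih (ms N (μ ∘ sw j)) (by omega) (desc_sw hi far.symm) rfl, TT_comm q p far, sw_comm' far]

lemma mem_prs {e : ℕ × ℕ} : e ∈ prs N ↔ e.1 < e.2 ∧ e.2 < N := by
  simp only [prs, Finset.mem_filter, Finset.mem_product, Finset.mem_range]; omega

lemma P0_eval (μ : ℕ → Bool) (x : ℕ → ℂ) : eval x (P0 q p N μ)
    = ∏ e ∈ prs N, if μ e.1 = μ e.2 then q * x e.1 - p * x e.2 else 1 := by
  rw [P0, map_prod]
  apply Finset.prod_congr rfl
  intro e _
  split_ifs <;> simp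

lemma comp_sw_of_eq {μ : ℕ → Bool} {i : ℕ} (h : μ i = μ (i + 1)) : μ ∘ sw i = μ := by
  funext a
  simp only [Function.comp, sw, Equiv.swap_apply_def]
  grind

lemma P0_par {μ : ℕ → Bool} {i : ℕ} (hi : i + 1 < N) (h : μ i = μ (i + 1)) :
    Par q p i (P0 q p N μ) := by
  intro x
  have hmem : (i, i+1) ∈ prs N := mem_prs.mpr ⟨by simp, hi⟩
  rw [P0_eval, P0_eval, ← Finset.mul_prod_erase _ _ hmem, ← Finset.mul_prod_erase _ _ hmem]
  simp only [comp_sw_left, comp_sw_right, if_pos h]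
  have : ∏ e ∈ (prs N).erase (i, i+1),
        (if μ e.1 = μ e.2 then q * (x ∘ sw i) e.1 - p * (x ∘ sw i) e.2 else 1)
      = ∏ e ∈ (prs N).erase (i, i+1), (if μ e.1 = μ e.2 then q * x e.1 - p * x e.2 else 1) := by
    have hμ : ∀ a, μ (sw i a) = μ a := fun a => congrFun (comp_sw_of_eq h) a
    have hm : ∀ e ∈ (prs N).erase (i, i+1), (sw i e.1, sw i e.2) ∈ (prs N).erase (i, i+1) := by
      rintro ⟨a, b⟩ he
      simp only [Finset.mem_erase, mem_prs, ne_eq, Prod.mk.injEq] at he ⊢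
      simp only [sw, Equiv.swap_apply_def]
      grind
    apply Finset.prod_nbij' (fun e => (sw i e.1, sw i e.2)) (fun e => (sw i e.1, sw i e.2)) hm hm
    · intro e _; simp [sw]
    · intro e _; simp [sw]
    · intro e _
      simp only [Function.comp, hμ]
  rw [this]; ring

lemma psi_par {μ : ℕ → Bool} {i : ℕ} (hi : i + 1 < N) (h : μ i = μ (i + 1)) :
    Par q p i (psi q p N μ) := by
  induction hm : ms N μ using Nat.strong_induction_on generalizing μ i with
  | _ m ih =>
    by_cases hd : ∃ j, Desc N μ j
    swap
    · rw [psi_of_not hd]; exact P0_par hi h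
    obtain ⟨j, hj⟩ := hd
    have mj := ms_desc hj
    by_cases far : i + 2 ≤ j ∨ j + 2 ≤ i
    · rw [psi_desc hj]
      apply Par.TT_far far
      apply ih _ (by omega) hi _ rfl
      rw [comp_sw_of_ne _ (by omega) (by omega), comp_sw_of_ne _ (by omega) (by omega)]
      exact h
    have hj1 := hj.1
    have hj2 := hj.2.1
    have hj3 := hj.2.2
    have : j = i + 1 ∨ i = j + 1 ∨ i = j := by omega
    rcases this with rfl | rfl | rfl
    · have h2 : Desc N (μ ∘ sw (i+1)) i := by
        refine ⟨hi, ?_, ?_⟩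
        · rw [comp_sw_of_ne _ (by omega) (by omega)]; rw [h]; exact hj2
        · rw [comp_sw_left (i+1)]; exact hj3
      have m2 := ms_desc h2
      rw [psi_desc hj, psi_desc h2]
      apply Par.braid_up
      refine ih _ (by omega) hj1 ?_ rfl
      rw [comp_sw_right, comp_sw_of_ne _ (by omega) (by omega),
        comp_sw_of_ne _ (by omega) (by omega), comp_sw_right, h]
    · have h2 : Desc N (μ ∘ sw j) (j+1) := by
        refine ⟨hi, ?_, ?_⟩
        · rw [comp_sw_right]; exact hj2
        · rw [comp_sw_of_ne _ (by omega) (by omega), ← h]; exact hj3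
      have m2 := ms_desc h2
      rw [psi_desc hj, psi_desc h2]
      apply Par.braid_down
      refine ih _ (by omega) hj1 ?_ rfl
      rw [comp_sw_of_ne _ (by omega) (by omega), comp_sw_left, comp_sw_left,
        comp_sw_of_ne _ (by omega) (by omega), ← h]
    · rw [hj2, hj3] at h; exact absurd h (by simp)

/-- Pointwise exchange relation. -/
lemma psi_exch {μ : ℕ → Bool} {i : ℕ} (h : Desc N μ i) (x : ℕ → ℂ) :
    (x (i + 1) - x i) * eval x (psi q p N μ)
      = (q * x i - p * x (i + 1)) * eval (x ∘ sw i) (psi q p N (μ ∘ sw i))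
        - (q - p) * x (i + 1) * eval x (psi q p N (μ ∘ sw i)) := by
  conv_lhs => rw [psi_desc h]
  exact TT_eval ..

end Psi
end XXZ

namespace XXZ
open MvPolynomial

/-- Restriction of `f` to the line through `x` in the direction of the `i`-th variable. -/
def uni (f : R) (i : ℕ) (x : ℕ → ℂ) : Polynomial ℂ :=
  aeval (Function.update (fun j => Polynomial.C (x j)) i Polynomial.X) f

lemma uni_eval (f : R) (i : ℕ) (x : ℕ → ℂ) (t : ℂ) :
    (uni f i x).eval t = eval (Function.update x i t) f := by
  unfold uni
  induction f using MvPolynomial.induction_on with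
  | C a => simp
  | add p r hp hr => simp [hp, hr]
  | mul_X p j hp =>
    simp only [map_mul, Polynomial.eval_mul, hp, aeval_X, eval_X]
    by_cases h : j = i
    · subst h; simp
    · simp [h]

@[simp] lemma uni_sub (f g : R) (i x) : uni (f - g) i x = uni f i x - uni g i x := map_sub _ _ _
lemma uni_X_self (i x) : uni (X i) i x = Polynomial.X := by
  simp [uni]
lemma uni_X_ne {i j : ℕ} (h : j ≠ i) (x) : uni (X j) i x = Polynomial.C (x j) := by
  simp [uni, h]
lemma uni_sum {ι : Type*} (s : Finset ι) (f : ι → R) (i x) :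
    uni (∑ a ∈ s, f a) i x = ∑ a ∈ s, uni (f a) i x := map_sum (aeval _) _ _

lemma natDegree_uni_le (f : R) (i : ℕ) (x : ℕ → ℂ) : (uni f i x).natDegree ≤ degreeOf i f := by
  conv_lhs => rw [f.as_sum]
  rw [uni_sum]
  apply Polynomial.natDegree_sum_le_of_forall_le
  intro m hm
  have h1 : m i ≤ degreeOf i f := (degreeOf_le_iff.mp le_rfl) m hm
  refine le_trans ?_ h1
  rw [uni, aeval_monomial, Finsupp.prod]
  refine (Polynomial.natDegree_C_mul_le _ _).trans ?_
  refine (Polynomial.natDegree_prod_le _ _).trans ?_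
  by_cases hi : i ∈ m.support
  · rw [← Finset.add_sum_erase _ _ hi]
    have : ∑ j ∈ m.support.erase i, (Function.update (fun j => Polynomial.C (x j)) i Polynomial.X j ^ m j).natDegree = 0 := by
      apply Finset.sum_eq_zero
      intro j hj
      rw [Function.update_of_ne (Finset.ne_of_mem_erase hj), ← Polynomial.C_pow, Polynomial.natDegree_C]
    rw [this, add_zero, Function.update_self, Polynomial.natDegree_X_pow]
  · rw [Finset.sum_eq_zero]
    · exact Nat.zero_le _
    intro j hj
    have : j ≠ i := fun h => hi (h ▸ hj)
    rw [Function.update_of_ne this, ← Polynomial.C_pow, Polynomial.natDegree_C]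

lemma degreeOf_X_sub_X {i : ℕ} : degreeOf i (X (i+1) - X i : R) = 1
    ∧ degreeOf (i+1) (X (i+1) - X i : R) = 1 := by
  constructor
  · apply le_antisymm
    · refine (degreeOf_sub_le _ _ _).trans ?_
      simp [degreeOf_X]
    · by_contra h
      have h0 : degreeOf i (X (i+1) - X i : R) = 0 := by omega
      have := natDegree_uni_le (X (i+1) - X i : R) i 0
      rw [h0, uni_sub, uni_X_self, uni_X_ne (by omega), Polynomial.natDegree_sub] at this
      simp at this
  · apply le_antisymm
    · refine (degreeOf_sub_le _ _ _).trans ?_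
      simp [degreeOf_X]
    · by_contra h
      have h0 : degreeOf (i+1) (X (i+1) - X i : R) = 0 := by omega
      have := natDegree_uni_le (X (i+1) - X i : R) (i+1) 0
      rw [h0, uni_sub, uni_X_self, uni_X_ne (by omega)] at this
      simp at this

lemma degreeOf_lin (q p : ℂ) (i j k : ℕ) : degreeOf k (C q * X i - C p * X j : R)
    ≤ if k = i ∨ k = j then 1 else 0 := by
  refine (degreeOf_sub_le _ _ _).trans (max_le ?_ ?_)
  · refine (degreeOf_C_mul_le _ _ _).trans ?_
    rw [degreeOf_X]; split_ifs <;> simp_all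
  · refine (degreeOf_C_mul_le _ _ _).trans ?_
    rw [degreeOf_X]; split_ifs <;> simp_all

lemma degreeOf_sw (i j : ℕ) (f : R) : degreeOf (sw i j) (rename (sw i) f) = degreeOf j f :=
  degreeOf_rename_of_injective (sw i).injective j

lemma degreeOf_sw_left (i : ℕ) (f : R) : degreeOf i (rename (sw i) f) = degreeOf (i+1) f := by
  conv_lhs => rw [show i = sw i (i+1) by simp [sw]]
  simp only [sw, Equiv.swap_apply_right]
  exact degreeOf_sw i (i+1) f ▸ by simp [sw]

lemma degreeOf_sw_right (i : ℕ) (f : R) : degreeOf (i+1) (rename (sw i) f) = degreeOf i f := by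
  have := degreeOf_sw i i f
  simpa [sw] using this

lemma degreeOf_sw_ne {i j : ℕ} (h1 : j ≠ i) (h2 : j ≠ i + 1) (f : R) :
    degreeOf j (rename (sw i) f) = degreeOf j f := by
  have := degreeOf_sw i j f
  rwa [sw, Equiv.swap_apply_of_ne_of_ne h1 h2] at this

lemma degreeOf_TT_rhs (q p : ℂ) (i j : ℕ) (f : R) (c d : ℕ)
    (h1 : degreeOf j (rename (sw i) f) + (if j = i ∨ j = i + 1 then 1 else 0) ≤ c)
    (h2 : degreeOf j f + (if j = i + 1 then 1 else 0) ≤ c) (hd : d ≤ degreeOf j (X (i+1) - X i : R)) :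
    TT q p i f = 0 ∨ degreeOf j (TT q p i f) + d ≤ c := by
  by_cases h0 : TT q p i f = 0
  · exact Or.inl h0
  right
  have h := congrArg (degreeOf j) (TT_spec q p i f)
  rw [degreeOf_mul_eq (X_sub_X_ne (by omega)) h0] at h
  have h3 : degreeOf j ((C q * X i - C p * X (i + 1)) * rename (sw i) f
      - (C q - C p) * X (i + 1) * f) ≤ c := by
    refine (degreeOf_sub_le _ _ _).trans (max_le ?_ ?_)
    · refine (degreeOf_mul_le _ _ _).trans ?_
      have := degreeOf_lin q p i (i+1) j
      omega
    · refine (degreeOf_mul_le _ _ _).trans ?_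
      have : degreeOf j ((C q - C p) * X (i+1) : R) ≤ if j = i + 1 then 1 else 0 := by
        rw [← C_sub]
        refine (degreeOf_C_mul_le _ _ _).trans ?_
        rw [degreeOf_X]
      omega
  omega

lemma degreeOf_TT_left (q p : ℂ) {i b : ℕ} {f : R} (ha : degreeOf i f ≤ b + 1)
    (hb : degreeOf (i+1) f ≤ b) : degreeOf i (TT q p i f) ≤ b := by
  rcases degreeOf_TT_rhs q p i i f (b+1) 1 (by rw [degreeOf_sw_left]; simpa) (by simpa)
    (le_of_eq degreeOf_X_sub_X.1.symm) with h | h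
  · rw [h]; simp
  · omega

lemma degreeOf_TT_right (q p : ℂ) {i b : ℕ} {f : R} (ha : degreeOf i f ≤ b + 1)
    (hb : degreeOf (i+1) f ≤ b) : degreeOf (i+1) (TT q p i f) ≤ b + 1 := by
  rcases degreeOf_TT_rhs q p i (i+1) f (b+2) 1 (by rw [degreeOf_sw_right]; simpa)
    (by simp; omega) (le_of_eq degreeOf_X_sub_X.2.symm) with h | h
  · rw [h]; simp
  · omega

lemma degreeOf_TT_ne (q p : ℂ) {i j : ℕ} (h1 : j ≠ i) (h2 : j ≠ i + 1) (f : R) :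
    degreeOf j (TT q p i f) ≤ degreeOf j f := by
  rcases degreeOf_TT_rhs q p i j f (degreeOf j f) 0 (by rw [degreeOf_sw_ne h1 h2]; simp [h1, h2])
    (by simp [h2]) (by omega) with h | h
  · rw [h]; simp
  · omega

/-- `μ` has `a` up spins among the first `N` sites. -/
def Sec (N a : ℕ) (μ : ℕ → Bool) : Prop := ((Finset.range N).filter fun i => μ i = true).card = a

lemma Sec.sw {N a i : ℕ} {μ : ℕ → Bool} (h : Sec N a μ) (hi : i + 1 < N) : Sec N a (μ ∘ sw i) := by
  rw [← h]
  apply Finset.card_nbij' (fun j => XXZ.sw i j) (fun j => XXZ.sw i j)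
  · intro j hj
    simp only [Finset.coe_filter, Finset.mem_range, Set.mem_ofPred_eq, Function.comp] at hj ⊢
    refine ⟨?_, hj.2⟩
    have := hj.1
    simp only [XXZ.sw, Equiv.swap_apply_def]; split_ifs <;> omega
  · intro j hj
    simp only [Finset.coe_filter, Finset.mem_range, Set.mem_ofPred_eq, Function.comp] at hj ⊢
    refine ⟨?_, by simpa [XXZ.sw] using hj.2⟩
    have := hj.1
    simp only [XXZ.sw, Equiv.swap_apply_def]; split_ifs <;> omega
  · intro j _; simp [XXZ.sw]
  · intro j _; simp [XXZ.sw]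

lemma Sec.compl {N a : ℕ} {μ : ℕ → Bool} (h : Sec N a μ) :
    ((Finset.range N).filter fun i => μ i = false).card = N - a := by
  have h1 := Finset.card_filter_add_card_filter_not (s := Finset.range N) (fun i => μ i = true)
  simp only [Bool.not_eq_true, Finset.card_range] at h1
  rw [Sec] at h
  omega

lemma degreeOf_P0 (q p : ℂ) (N : ℕ) (μ : ℕ → Bool) (i : ℕ) (hi : i < N) :
    degreeOf i (P0 q p N μ) ≤ ((Finset.range N).filter fun j => μ j = μ i).card - 1 := by
  unfold P0
  refine (degreeOf_prod_le _ _ _).trans ?_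
  have h1 : ∀ e ∈ prs N, degreeOf i (if μ e.1 = μ e.2 then C q * X e.1 - C p * X e.2 else 1 : R)
      ≤ if (μ e.1 = μ e.2 ∧ (i = e.1 ∨ i = e.2)) then 1 else 0 := by
    intro e _
    by_cases h : μ e.1 = μ e.2
    · simp only [h, true_and, if_true]; exact degreeOf_lin q p e.1 e.2 i
    · simp [h]
  refine (Finset.sum_le_sum h1).trans ?_
  rw [← Finset.card_filter]
  have hi' : i ∈ (Finset.range N).filter fun j => μ j = μ i := by simp [hi]
  rw [← Finset.card_erase_of_mem hi']
  apply Finset.card_le_card_of_injOn (fun e => if e.1 = i then e.2 else e.1)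
  · rintro ⟨a, b⟩ he
    simp only [Finset.coe_filter, mem_prs, Set.mem_ofPred_eq, Finset.coe_erase, Set.mem_sdiff, Finset.mem_range, Set.mem_singleton_iff] at he ⊢
    grind
  · rintro ⟨a, b⟩ he ⟨c, d⟩ he' h
    simp only [Finset.coe_filter, mem_prs, Set.mem_ofPred_eq] at he he' h
    rw [Prod.mk.injEq]
    grind

lemma degreeOf_psi (q p : ℂ) {n : ℕ} {μ : ℕ → Bool} (h : Sec (2*n+1) (n+1) μ) {j : ℕ}
    (hj : j < 2*n+1) : degreeOf j (psi q p (2*n+1) μ) ≤ if μ j then n else n - 1 := by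
  induction hm : ms (2*n+1) μ using Nat.strong_induction_on generalizing μ j with
  | _ m ih =>
    by_cases hd : ∃ j, Desc (2*n+1) μ j
    swap
    · rw [psi_of_not hd]
      refine (degreeOf_P0 q p _ μ j hj).trans ?_
      have h2 := h.compl
      rw [Sec] at h
      cases hμ : μ j
      · simp [h2]; omega
      · simp [h]
    obtain ⟨i, hi⟩ := hd
    have h2 := h.compl
    have hn : 1 ≤ n := by
      have : 0 < ((Finset.range (2*n+1)).filter fun i => μ i = false).card :=
        Finset.card_pos.mpr ⟨i, by have := hi.1; simp [hi.2.1]; omega⟩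
      omega
    have mi := ms_desc hi
    have hi1 := hi.1
    rw [psi_desc hi]
    have A := fun {j : ℕ} (hj : j < 2*n+1) => ih _ (by omega) (h.sw hi.1) (j := j) hj rfl
    by_cases h1 : j = i
    · subst h1
      rw [hi.2.1]
      have A1 := A (j := j) (by omega)
      have A2 := A (j := j+1) (by omega)
      rw [comp_sw_left, hi.2.2] at A1
      rw [comp_sw_right, hi.2.1] at A2
      simp only [Bool.false_eq_true, if_true, if_false] at A1 A2 ⊢
      exact degreeOf_TT_left q p (by omega) A2
    by_cases h3 : j = i + 1
    · subst h3
      rw [hi.2.2]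
      have A1 := A (j := i) (by omega)
      have A2 := A (j := i+1) (by omega)
      rw [comp_sw_left, hi.2.2] at A1
      rw [comp_sw_right, hi.2.1] at A2
      simp only [Bool.false_eq_true, if_true, if_false] at A1 A2 ⊢
      exact (degreeOf_TT_right q p (by omega) A2).trans (by omega)
    · refine (degreeOf_TT_ne q p h1 h3 _).trans ?_
      have := A hj
      rwa [comp_sw_of_ne _ h1 h3] at this

end XXZ

namespace XXZ
open MvPolynomial

/-- `q` and `p` are the two primitive cube roots of unity. -/
structure Om (q p : ℂ) : Prop where
  sum : q + p = -1
  mul : q * p = 1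

namespace Om
variable {q p : ℂ}

lemma symm (h : Om q p) : Om p q := ⟨by rw [add_comm]; exact h.sum, by rw [mul_comm]; exact h.mul⟩
lemma sq (h : Om q p) : q ^ 2 = p := by linear_combination q * h.sum - h.mul - h.sum
lemma sq' (h : Om q p) : p ^ 2 = q := h.symm.sq
lemma cube (h : Om q p) : q ^ 3 = 1 := by linear_combination q * h.sq + h.mul
lemma cube' (h : Om q p) : p ^ 3 = 1 := h.symm.cube
lemma ne_zero (h : Om q p) : q ≠ 0 := by intro h0; have := h.mul; simp [h0] at this
lemma ne_zero' (h : Om q p) : p ≠ 0 := h.symm.ne_zero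
lemma ne_one (h : Om q p) : q ≠ 1 := by
  intro h0
  have h1 := h.mul
  have h2 := h.sum
  rw [h0, one_mul] at h1
  rw [h0, h1] at h2
  norm_num at h2
lemma ne_one' (h : Om q p) : p ≠ 1 := h.symm.ne_one
lemma ne (h : Om q p) : q ≠ p := by
  intro h0
  have := h.sq
  rw [← h0] at this
  have h1 : q * (q - 1) = 0 := by linear_combination this
  rcases mul_eq_zero.mp h1 with h2 | h2
  · exact h.ne_zero h2
  · exact h.ne_one (sub_eq_zero.mp h2)
lemma lin_eq_zero_iff (h : Om q p) (a b : ℂ) : q * a - p * b = 0 ↔ b = p * a := by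
  constructor
  · intro h1; linear_combination (-q) * h1 + a * h.sq - b * h.mul
  · intro h1; rw [h1]; linear_combination (-a) * h.sq'
end Om

variable {q p : ℂ} {N : ℕ}

lemma psi_par_wheel (h : Om q p) {μ : ℕ → Bool} {i : ℕ} (hi : i + 1 < N) (hμ : μ i = μ (i+1))
    {x : ℕ → ℂ} (hx : x (i+1) = p * x i) (h0 : x i ≠ 0) : eval x (psi q p N μ) = 0 := by
  have h1 := psi_par (q := q) (p := p) hi hμ x
  rw [(h.lin_eq_zero_iff _ _).mpr hx, zero_mul, eq_comm, mul_eq_zero, hx] at h1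
  rcases h1 with h1 | h1
  · exfalso
    have : (1 - p) * x i = 0 := by linear_combination h1 - x i * h.mul
    rcases mul_eq_zero.mp this with h2 | h2
    · exact h.ne_one' (sub_eq_zero.mp h2).symm
    · exact h0 h2
  · exact h1

lemma psi_exch_wheel (h : Om q p) {μ : ℕ → Bool} {i : ℕ} (hi : Desc N μ i)
    {x : ℕ → ℂ} (hx : x (i+1) = p * x i) (h0 : x i ≠ 0) :
    eval x (psi q p N μ) = - q * eval x (psi q p N (μ ∘ sw i)) := by
  have h1 := psi_exch (q := q) (p := p) hi x
  rw [(h.lin_eq_zero_iff _ _).mpr hx, zero_mul, hx] at h1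
  have h2 : (p - 1) * x i ≠ 0 := mul_ne_zero (sub_ne_zero.mpr h.ne_one') h0
  apply mul_left_cancel₀ h2
  linear_combination h1 + x i * (eval x (psi q p N (μ ∘ sw i))) * h.sq'

/-- Vanishing of all components propagates along transpositions. -/
lemma vanish_move (h : Om q p) {i : ℕ} (hi : i + 1 < N) {x : ℕ → ℂ}
    (hv : ∀ μ, eval (x ∘ sw i) (psi q p N μ) = 0) (h1 : x i ≠ x (i+1)) (h2 : x i ≠ p * x (i+1))
    (μ : ℕ → Bool) : eval x (psi q p N μ) = 0 := by
  have hq : q * x (i+1) - p * x i ≠ 0 := fun h0 => h2 ((h.lin_eq_zero_iff _ _).mp h0)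
  have hs : x (i+1) - x i ≠ 0 := sub_ne_zero.mpr h1.symm
  have hup : ∀ μ, Desc N μ i → eval x (psi q p N (μ ∘ sw i)) = 0 := by
    intro μ hd
    have h3 := psi_exch (q := q) (p := p) hd (x ∘ sw i)
    rw [comp_sw_sw, hv, hv, comp_sw_left, comp_sw_right, mul_zero, mul_zero, sub_zero, eq_comm,
      mul_eq_zero] at h3
    exact h3.resolve_left hq
  have hdn : ∀ μ, Desc N μ i → eval x (psi q p N μ) = 0 := by
    intro μ hd
    have h3 := psi_exch (q := q) (p := p) hd x
    rw [hv, hup μ hd, mul_zero, mul_zero, sub_zero, mul_eq_zero] at h3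
    exact h3.resolve_left hs
  by_cases hμ : μ i = μ (i+1)
  · have h3 := psi_par (q := q) (p := p) hi hμ x
    rw [hv, mul_zero, eq_comm, mul_eq_zero] at h3
    exact h3.resolve_left hq
  · cases h4 : μ i
    · exact hdn μ ⟨hi, h4, by rw [h4] at hμ; simpa using hμ⟩
    · have := hup (μ ∘ sw i) ⟨hi, by rw [comp_sw_left]; rw [h4] at hμ; simpa using hμ,
        by rw [comp_sw_right]; exact h4⟩
      rwa [comp_sw_sw] at this

lemma ne_of_cube {a b c : ℂ} (hc : c ^ 3 = 1) (hab : a ^ 3 ≠ b ^ 3) : a ≠ c * b := by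
  intro h0; apply hab; rw [h0, mul_pow, hc, one_mul]

lemma ne_of_cube' {a b : ℂ} (hab : a ^ 3 ≠ b ^ 3) : a ≠ b := by
  intro h0; apply hab; rw [h0]

/-- The wheel condition. -/
lemma wheel (h : Om q p) {i j l : ℕ} (hij : i < j) (hjl : j < l) (hl : l < N) {x : ℕ → ℂ}
    (h1 : x j = p * x i) (h2 : x l = p * x j) (h0 : x i ≠ 0)
    (hg : ∀ a b, a < N → b < N → a ≠ b → (a ≠ i ∧ a ≠ j ∧ a ≠ l) → x a ^ 3 ≠ x b ^ 3)
    (μ : ℕ → Bool) : eval x (psi q p N μ) = 0 := by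
  have h0j : x j ≠ 0 := by rw [h1]; exact mul_ne_zero h.ne_zero' h0
  induction hd : l - i using Nat.strong_induction_on generalizing i j l x μ with
  | _ d ih =>
    by_cases ha : j = i + 1
    · by_cases hb : l = j + 1
      · subst hb
        subst ha
        by_cases e1 : μ i = μ (i+1)
        · exact psi_par_wheel h (by omega) e1 h1 h0
        by_cases e2 : μ (i+1) = μ (i+1+1)
        · exact psi_par_wheel h (by omega) e2 h2 h0j
        cases h4 : μ i
        · have h5 : μ (i+1) = true := by rw [h4] at e1; simpa using e1
          have h6 : μ (i+1+1) = false := by rw [h5] at e2; simpa using e2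
          rw [psi_exch_wheel h ⟨by omega, h4, h5⟩ h1 h0]
          rw [psi_par_wheel h (i := i+1) (by omega) _ h2 h0j, mul_zero]
          rw [comp_sw_right, comp_sw_of_ne _ (by omega) (by omega), h4, h6]
        · have h5 : μ (i+1) = false := by rw [h4] at e1; simpa using e1
          have h6 : μ (i+1+1) = true := by rw [h5] at e2; simpa using e2
          rw [psi_exch_wheel h ⟨by omega, h5, h6⟩ h2 h0j]
          rw [psi_par_wheel h (i := i) (by omega) _ h1 h0, mul_zero]
          rw [comp_sw_left, comp_sw_of_ne _ (by omega) (by omega), h4, h6]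
      · obtain ⟨l, rfl⟩ : ∃ l', l = l' + 1 := ⟨l - 1, by omega⟩
        have g := hg l (l+1) (by omega) hl (by omega) (by omega)
        refine vanish_move h (i := l) hl ?_ (ne_of_cube' g) (ne_of_cube h.cube' g) μ
        intro μ
        have e1 : (x ∘ sw l) i = x i := comp_sw_of_ne _ (by omega) (by omega)
        have e2 : (x ∘ sw l) j = x j := comp_sw_of_ne _ (by omega) (by omega)
        have e3 : (x ∘ sw l) l = x (l+1) := comp_sw_left _ _
        refine ih (l - i) (by omega) hij (by omega : j < l) (by omega) (x := x ∘ sw l)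
          (by rw [e1, e2]; exact h1) (by rw [e3, e2]; exact h2) (by rw [e1]; exact h0) ?_ μ
          (by rw [e2]; exact h0j) rfl
        intro a b haN hbN hab hane
        apply hg
        · simp only [sw, Equiv.swap_apply_def]; split_ifs <;> omega
        · simp only [sw, Equiv.swap_apply_def]; split_ifs <;> omega
        · exact fun h => hab ((sw l).injective h)
        · simp only [sw, Equiv.swap_apply_def]; split_ifs <;> omega
    · obtain ⟨j, rfl⟩ : ∃ l', j = l' + 1 := ⟨j - 1, by omega⟩
      by_cases hb : l = j + 1 + 1
      · -- move `i` to the right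
        have g := hg (i+1) i (by omega) (by omega) (by omega) (by omega)
        refine vanish_move h (i := i) (by omega) ?_ (ne_of_cube' (Ne.symm g))
          (ne_of_cube h.cube' (Ne.symm g)) μ
        intro μ
        have e1 : (x ∘ sw i) (i+1) = x i := comp_sw_right _ _
        have e2 : (x ∘ sw i) (j+1) = x (j+1) := comp_sw_of_ne _ (by omega) (by omega)
        have e3 : (x ∘ sw i) l = x l := comp_sw_of_ne _ (by omega) (by omega)
        refine ih (l - (i+1)) (by omega) (by omega : i + 1 < j + 1) hjl hl (x := x ∘ sw i)
          (by rw [e1, e2]; exact h1) (by rw [e3, e2]; exact h2) (by rw [e1]; exact h0) ?_ μ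
          (by rw [e2]; exact h0j) rfl
        intro a b haN hbN hab hane
        apply hg
        · simp only [sw, Equiv.swap_apply_def]; split_ifs <;> omega
        · simp only [sw, Equiv.swap_apply_def]; split_ifs <;> omega
        · exact fun h => hab ((sw i).injective h)
        · simp only [sw, Equiv.swap_apply_def]; split_ifs <;> omega
      · obtain ⟨l, rfl⟩ : ∃ l', l = l' + 1 := ⟨l - 1, by omega⟩
        have g := hg l (l+1) (by omega) hl (by omega) (by omega)
        refine vanish_move h (i := l) hl ?_ (ne_of_cube' g) (ne_of_cube h.cube' g) μ
        intro μ
        have e1 : (x ∘ sw l) i = x i := comp_sw_of_ne _ (by omega) (by omega)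
        have e2 : (x ∘ sw l) (j+1) = x (j+1) := comp_sw_of_ne _ (by omega) (by omega)
        have e3 : (x ∘ sw l) l = x (l+1) := comp_sw_left _ _
        refine ih (l - i) (by omega) hij (by omega : j+1 < l) (by omega) (x := x ∘ sw l)
          (by rw [e1, e2]; exact h1) (by rw [e3, e2]; exact h2) (by rw [e1]; exact h0) ?_ μ
          (by rw [e2]; exact h0j) rfl
        intro a b haN hbN hab hane
        apply hg
        · simp only [sw, Equiv.swap_apply_def]; split_ifs <;> omega
        · simp only [sw, Equiv.swap_apply_def]; split_ifs <;> omega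
        · exact fun h => hab ((sw l).injective h)
        · simp only [sw, Equiv.swap_apply_def]; split_ifs <;> omega

/-- Vanishing inside a block of equal spins. -/
lemma block_vanish (h : Om q p) {a b : ℕ} (hab : a < b) (hb : b < N) {μ : ℕ → Bool}
    (hμ : ∀ c, a ≤ c → c ≤ b → μ c = μ a) {x : ℕ → ℂ} (hx : x b = p * x a) (h0 : x a ≠ 0)
    (hg : ∀ c, a < c → c < b → x c ≠ p * x b) : eval x (psi q p N μ) = 0 := by
  induction b, hab using Nat.le_induction generalizing x with
  | base => exact psi_par_wheel h hb (hμ (a+1) (by omega) le_rfl).symm hx h0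
  | succ b hab ih =>
    have hab' : a < b := hab
    have h1 := psi_par (q := q) (p := p) (N := N) (μ := μ) (i := b) hb
      (by rw [hμ b (by omega) (by omega), hμ (b+1) (by omega) le_rfl]) x
    have e1 : (x ∘ sw b) a = x a := comp_sw_of_ne _ (by omega) (by omega)
    rw [ih (by omega) (fun c h1 h2 => hμ c h1 (by omega)) (by rw [comp_sw_left, e1]; exact hx)
      (by rw [e1]; exact h0) ?_, mul_zero, eq_comm, mul_eq_zero] at h1
    · exact h1.resolve_left fun h0 => hg b hab' (by omega) ((h.lin_eq_zero_iff _ _).mp h0)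
    · intro c h1 h2
      rw [comp_sw_left, comp_sw_of_ne _ (by omega) (by omega)]
      exact hg c h1 (by omega)

end XXZ

namespace XXZ
open MvPolynomial

/-- Generic parameters. -/
def Gen (N : ℕ) (x : ℕ → ℂ) : Prop :=
  (∀ a < N, x a ≠ 0) ∧ ∀ a b, a < N → b < N → a ≠ b → x a ^ 3 ≠ x b ^ 3

lemma X_cube_sub_ne {a b : ℕ} (h : a ≠ b) : (X a ^ 3 - X b ^ 3 : R) ≠ 0 := by
  intro h0
  have := congrArg (eval (Function.update (0 : ℕ → ℂ) a 1)) h0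
  simp [h.symm] at this

lemma eq_of_gen (N : ℕ) {f g : R} (h : ∀ x, Gen N x → eval x f = eval x g) : f = g := by
  apply eq_of_eval_of_ne (D := (∏ a ∈ Finset.range N, X a) * ∏ e ∈ prs N, (X e.1 ^ 3 - X e.2 ^ 3))
  · apply mul_ne_zero
    · exact Finset.prod_ne_zero_iff.mpr fun a _ => X_ne_zero a
    · refine Finset.prod_ne_zero_iff.mpr fun e he => X_cube_sub_ne (mem_prs.mp he).1.ne
  · intro x hx
    rw [map_mul, map_prod, map_prod, mul_ne_zero_iff, Finset.prod_ne_zero_iff,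
      Finset.prod_ne_zero_iff] at hx
    apply h
    refine ⟨fun a ha => by simpa using hx.1 a (Finset.mem_range.mpr ha), ?_⟩
    intro a b ha hb hab
    rcases lt_or_gt_of_ne hab with h1 | h1
    · have := hx.2 (a, b) (mem_prs.mpr ⟨h1, hb⟩)
      simpa [sub_eq_zero] using this
    · have := hx.2 (b, a) (mem_prs.mpr ⟨h1, ha⟩)
      rw [map_sub, map_pow, map_pow, eval_X, eval_X, sub_ne_zero] at this
      exact this.symm

lemma poly_zero_of_roots {P : Polynomial ℂ} (S : Finset ℕ) (r : ℕ → ℂ)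
    (hr : ∀ a ∈ S, ∀ b ∈ S, r a = r b → a = b) (h : ∀ a ∈ S, P.eval (r a) = 0)
    (hd : P.natDegree < S.card) : P = 0 := by
  classical
  apply Polynomial.eq_zero_of_natDegree_lt_card_of_eval_eq_zero' P (S.image r)
  · intro i hi
    obtain ⟨a, ha, rfl⟩ := Finset.mem_image.mp hi
    exact h a ha
  · rwa [Finset.card_image_of_injOn]
    intro a ha b hb
    exact hr a ha b hb

variable {q p : ℂ} {N : ℕ}

lemma P0_desc {μ : ℕ → Bool} {i : ℕ} (h : Desc N μ i) :
    P0 q p N μ = rename (sw i) (P0 q p N (μ ∘ sw i)) := by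
  apply MvPolynomial.funext
  intro x
  rw [eval_rename, P0_eval, P0_eval]
  have hmem : (i, i+1) ∈ prs N := mem_prs.mpr ⟨by simp, h.1⟩
  rw [← Finset.mul_prod_erase _ _ hmem, ← Finset.mul_prod_erase _ _ hmem]
  simp only [comp_sw_left, comp_sw_right, h.2.1, h.2.2, Bool.true_eq_false, Bool.false_eq_true,
    if_false, one_mul]
  have hm : ∀ e ∈ (prs N).erase (i, i+1), (sw i e.1, sw i e.2) ∈ (prs N).erase (i, i+1) := by
    rintro ⟨a, b⟩ he
    have := h.1
    simp only [Finset.mem_erase, mem_prs, ne_eq, Prod.mk.injEq] at he ⊢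
    simp only [sw, Equiv.swap_apply_def]
    grind
  apply Finset.prod_nbij' (fun e => (sw i e.1, sw i e.2)) (fun e => (sw i e.1, sw i e.2)) hm hm
  · intro e _; simp [sw]
  · intro e _; simp [sw]
  · intro e _
    simp [Function.comp, sw]

/-- The cyclic shift of `M + 1` sites. -/
def rho (M : ℕ) : Equiv.Perm ℕ where
  toFun j := if j = 0 then M else if j ≤ M then j - 1 else j
  invFun j := if j = M then 0 else if j ≤ M then j + 1 else j
  left_inv j := by grind
  right_inv j := by
    by_cases h : j = M
    · simp [h]
    · by_cases h2 : j ≤ M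
      · have : j + 1 ≤ M := by omega
        simp [h, h2, this]
      · have h3 : j ≠ 0 := by omega
        simp [h, h2, h3]

lemma rho_zero (M : ℕ) : rho M 0 = M := by simp [rho]
lemma rho_succ {M j : ℕ} (h : j < M) : rho M (j + 1) = j := by simp [rho]; omega
lemma P0_eval_last (μ : ℕ → Bool) (x : ℕ → ℂ) (M : ℕ) : eval x (P0 q p (M+1) μ)
    = (∏ e ∈ prs M, if μ e.1 = μ e.2 then q * x e.1 - p * x e.2 else 1)
      * ∏ a ∈ Finset.range M, if μ a = μ M then q * x a - p * x M else 1 := by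
  rw [P0_eval]
  have : prs (M+1) = prs M ∪ (Finset.range M).image fun a => (a, M) := by
    ext ⟨a, b⟩
    simp only [mem_prs, Finset.mem_union, Finset.mem_image, Finset.mem_range, Prod.mk.injEq]
    grind
  rw [this, Finset.prod_union, Finset.prod_image]
  · intro a _ b _ hab; simpa using hab
  · rw [Finset.disjoint_left]
    rintro ⟨a, b⟩ h1 h2
    simp only [mem_prs, Finset.mem_image, Finset.mem_range, Prod.mk.injEq] at h1 h2
    grind

lemma P0_eval_rho (μ : ℕ → Bool) (x : ℕ → ℂ) (M : ℕ) : eval (x ∘ rho M) (P0 q p (M+1) (μ ∘ rho M))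
    = (∏ e ∈ prs M, if μ e.1 = μ e.2 then q * x e.1 - p * x e.2 else 1)
      * ∏ a ∈ Finset.range M, if μ a = μ M then q * x M - p * x a else 1 := by
  rw [P0_eval]
  have : prs (M+1) = ((prs M).image fun e => (e.1 + 1, e.2 + 1))
      ∪ (Finset.range M).image fun a => (0, a + 1) := by
    ext ⟨a, b⟩
    simp only [mem_prs, Finset.mem_union, Finset.mem_image, Finset.mem_range, Prod.mk.injEq]
    constructor
    · intro h
      by_cases h0 : a = 0
      · right; exact ⟨b - 1, by omega, by omega, by omega⟩
      · left; exact ⟨(a - 1, b - 1), by grind, by grind, by grind⟩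
    · grind
  rw [this, Finset.prod_union, Finset.prod_image, Finset.prod_image]
  · congr 1
    · apply Finset.prod_congr rfl
      rintro ⟨a, b⟩ he
      rw [mem_prs] at he
      simp only [Function.comp] at he ⊢
      rw [rho_succ (by omega), rho_succ (by omega)]
    · apply Finset.prod_congr rfl
      intro a ha
      rw [Finset.mem_range] at ha
      simp only [Function.comp]
      rw [rho_succ (by omega), rho_zero]
      simp only [eq_comm]
  · intro a _ b _ hab; simpa using hab
  · rintro ⟨a, b⟩ _ ⟨c, d⟩ _ hab; simpa using hab
  · rw [Finset.disjoint_left]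
    rintro ⟨a, b⟩ h1 h2
    simp only [Finset.mem_image, Finset.mem_range, Prod.mk.injEq] at h1 h2
    grind

/-- The value at a vanishing last parameter. -/
lemma psi_zero_move {n m : ℕ} (hm : m ≤ n) {μ : ℕ → Bool} (h1 : ∀ i < n, μ i = true)
    (h2 : μ (n + m) = true) (h3 : ∀ i, n ≤ i → i < 2*n+1 → i ≠ n + m → μ i = false)
    {y : ℕ → ℂ} (hy : y (n+m) = 0) (hy' : ∀ i, i < 2*n+1 → i ≠ n+m → y i ≠ 0) :
    eval y (psi q p (2*n+1) μ) = (-q) ^ m * eval y (P0 q p (2*n+1) μ) := by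
  induction m generalizing μ y with
  | zero =>
    rw [psi_of_not]
    · simp
    · rintro ⟨i, hi, h4, h5⟩
      by_cases hin : i < n
      · rw [h1 i hin] at h4; simp at h4
      · rw [h3 (i+1) (by omega) (by omega) (by omega)] at h5; simp at h5
  | succ m ih =>
    have hd : Desc (2*n+1) μ (n+m) := ⟨by omega, h3 _ (by omega) (by omega) (by omega), h2⟩
    have e := psi_exch (q := q) (p := p) hd y
    have hy1 : y (n+m+1) = 0 := hy
    have hy2 := hy' (n+m) (by omega) (by omega)
    rw [hy1, ih (μ := μ ∘ sw (n+m)) (y := y ∘ sw (n+m)) (by omega)] at e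
    · rw [P0_desc hd, eval_rename]
      apply mul_left_cancel₀ hy2
      rw [pow_succ]
      linear_combination -e
    · intro i hi; rw [comp_sw_of_ne _ (by omega) (by omega)]; exact h1 i hi
    · rw [comp_sw_left]; exact h2
    · intro i hi1 hi2 hi3
      by_cases h : i = n + m + 1
      · rw [h, comp_sw_right]; exact h3 _ (by omega) (by omega) (by omega)
      · rw [comp_sw_of_ne _ (by omega) (by omega)]; exact h3 _ (by omega) (by omega) (by omega)
    · rw [comp_sw_left]; exact hy1
    · intro i hi hi1
      by_cases h : i = n + m + 1
      · rw [h, comp_sw_right]; exact hy2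
      · rw [comp_sw_of_ne _ (by omega) (by omega)]; exact hy' _ (by omega) (by omega)

lemma gen_update {N : ℕ} {x : ℕ → ℂ} (hx : Gen N x) {c : ℂ} (hc : c ^ 3 = 1) {i j : ℕ} (hj : j < N) : ∀ a b, a < N → b < N → a ≠ b → (a ≠ i ∧ a ≠ j) →
      (Function.update x i (c * x j)) a ^ 3 ≠ (Function.update x i (c * x j)) b ^ 3 := by
  intro a b ha hb hab hai
  rw [Function.update_of_ne hai.1]
  by_cases h : b = i
  · rw [h, Function.update_self, mul_pow, hc, one_mul]; exact hx.2 a j ha hj hai.2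
  · rw [Function.update_of_ne h]; exact hx.2 a b ha hb hab

/-- The polynomial vanishes when the last (up) parameter is bound to an up spin on the left. -/
lemma psi_up_root (h : Om q p) {n : ℕ} (hn : 1 ≤ n) {μ : ℕ → Bool} (hS : Sec (2*n+1) (n+1) μ)
    (h3 : ∀ i, n ≤ i → i < 2*n → μ i = false)
    {x : ℕ → ℂ} (hx : Gen (2*n+1) x) {i : ℕ} (hi : i < n) :
    eval (Function.update x (2*n) (q * x i)) (psi q p (2*n+1) μ) = 0 := by
  set y := Function.update x (2*n) (q * x i) with hy
  have hyg := gen_update hx h.cube (i := 2*n) (j := i) (by omega)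
  rw [← hy] at hyg
  have hyi : y i = x i := by rw [hy, Function.update_of_ne (by omega)]
  have hyl : y (2*n) = q * x i := by rw [hy, Function.update_self]
  have hne : ∀ a < 2*n, y a = x a := fun a ha => by rw [hy, Function.update_of_ne (by omega)]
  -- vary the down parameter at `2 * n - 1`
  have key : uni (psi q p (2*n+1) μ) (2*n-1) y = 0 := by
    apply poly_zero_of_roots (insert i (Finset.Ico n (2*n-1))) (fun a => p * x a)
    · intro a ha b hb hab
      by_contra hne
      simp only [Finset.mem_insert, Finset.mem_Ico] at ha hb
      refine hx.2 a b (by omega) (by omega) hne ?_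
      rw [mul_left_cancel₀ h.ne_zero' hab]
    · intro a ha
      rw [uni_eval]
      set z := Function.update y (2*n-1) (p * x a) with hz
      have hzl : z (2*n-1) = p * x a := by rw [hz, Function.update_self]
      have hzn : ∀ b, b ≠ 2*n-1 → z b = y b := fun b hb => by rw [hz, Function.update_of_ne hb]
      rw [Finset.mem_insert] at ha
      rcases ha with rfl | ha
      · refine wheel h (i := a) (j := 2*n-1) (l := 2*n) (by omega) (by omega) (by omega) ?_ ?_ ?_ ?_ μ
        · rw [hzl, hzn a (by omega), hyi]
        · rw [hzl, hzn _ (by omega), hyl, ← h.sq']; ring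
        · rw [hzn a (by omega), hyi]; exact hx.1 a (by omega)
        · intro c d hc hd hcd hcn
          rw [hzn c hcn.2.1]
          by_cases hd' : d = 2*n-1
          · rw [hd', hzl, mul_pow, h.cube', one_mul, hne c (by omega)]
            exact hx.2 c a (by omega) (by omega) hcn.1
          · rw [hzn d hd']; exact hyg c d hc hd hcd ⟨hcn.2.2, hcn.1⟩
      · rw [Finset.mem_Ico] at ha
        refine block_vanish h (a := a) (b := 2*n-1) (by omega) (by omega) ?_ ?_ ?_ ?_
        · intro c hc1 hc2; rw [h3 c (by omega) (by omega), h3 a (by omega) (by omega)]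
        · rw [hzl, hzn a (by omega), hne a (by omega)]
        · rw [hzn a (by omega), hne a (by omega)]; exact hx.1 a (by omega)
        · intro c hc1 hc2
          rw [hzl, hzn c (by omega), hne c (by omega), ← mul_assoc]
          apply ne_of_cube
          · rw [mul_pow, h.cube', one_mul]
          · exact hx.2 c a (by omega) (by omega) (by omega)
    · rw [Finset.card_insert_of_notMem (by simp; omega), Nat.card_Ico]
      have h4 := degreeOf_psi q p hS (j := 2*n-1) (by omega)
      rw [h3 (2*n-1) (by omega) (by omega)] at h4
      have := natDegree_uni_le (psi q p (2*n+1) μ) (2*n-1) y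
      simp only [Bool.false_eq_true, if_false] at h4
      omega
  have := uni_eval (psi q p (2*n+1) μ) (2*n-1) y (y (2*n-1))
  rw [key, Function.update_eq_self] at this
  simpa using this.symm

lemma rot_base_up (h : Om q p) {n : ℕ} (hn : 1 ≤ n) {μ : ℕ → Bool} (hS : Sec (2*n+1) (n+1) μ)
    (h1 : ∀ i < n, μ i = true)
    (h2 : μ (2*n) = true) (h3 : ∀ i, n ≤ i → i < 2*n → μ i = false)
    {x : ℕ → ℂ} (hx : Gen (2*n+1) x) :
    eval x (psi q p (2*n+1) μ) = eval (x ∘ rho (2*n)) (P0 q p (2*n+1) (μ ∘ rho (2*n))) := by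
  set A := (∏ e ∈ prs (2*n), if μ e.1 = μ e.2 then q * x e.1 - p * x e.2 else 1) with hA
  have hAx : ∀ t, (∏ e ∈ prs (2*n), if μ e.1 = μ e.2 then
      q * (Function.update x (2*n) t) e.1 - p * (Function.update x (2*n) t) e.2 else 1) = A := by
    intro t
    apply Finset.prod_congr rfl
    intro e he
    rw [mem_prs] at he
    rw [Function.update_of_ne (by omega), Function.update_of_ne (by omega)]
  have hfil : ∀ g : ℕ → ℂ, (∏ a ∈ Finset.range (2*n), if μ a = μ (2*n) then g a else 1)
      = ∏ a ∈ Finset.range n, g a := by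
    intro g
    rw [← Finset.prod_filter]
    apply Finset.prod_congr _ (fun _ _ => rfl)
    ext a
    simp only [Finset.mem_filter, Finset.mem_range, h2]
    constructor
    · rintro ⟨ha, hb⟩
      by_contra hc
      rw [h3 a (by omega) ha] at hb; simp at hb
    · intro ha; exact ⟨by omega, h1 a ha⟩
  set B : Polynomial ℂ := Polynomial.C A * ∏ a ∈ Finset.range n,
    (Polynomial.C q * Polynomial.X - Polynomial.C (p * x a)) with hB
  have hBe : ∀ t, B.eval t = A * ∏ a ∈ Finset.range n, (q * t - p * x a) := by
    intro t; simp [hB, Polynomial.eval_prod]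
  have hBd : B.natDegree ≤ n := by
    refine (Polynomial.natDegree_C_mul_le _ _).trans ?_
    refine (Polynomial.natDegree_prod_le _ _).trans ?_
    refine (Finset.sum_le_card_nsmul _ _ 1 ?_).trans (by simp)
    intro a _
    refine (Polynomial.natDegree_sub_le _ _).trans (max_le ?_ ?_)
    · exact (Polynomial.natDegree_C_mul_le _ _).trans Polynomial.natDegree_X_le
    · rw [Polynomial.natDegree_C]; omega
  have key : uni (psi q p (2*n+1) μ) (2*n) x - B = 0 := by
    apply poly_zero_of_roots (Finset.range (n+1)) (fun a => if a = n then 0 else q * x a)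
    · intro a ha b hb hab
      simp only [Finset.mem_range] at ha hb
      by_contra hne
      by_cases han : a = n
      · rw [if_pos han, if_neg (by omega), eq_comm, mul_eq_zero] at hab
        exact hab.elim h.ne_zero (hx.1 b (by omega))
      · by_cases hbn : b = n
        · rw [if_neg han, if_pos hbn, mul_eq_zero] at hab
          exact hab.elim h.ne_zero (hx.1 a (by omega))
        · rw [if_neg han, if_neg hbn] at hab
          refine hx.2 a b (by omega) (by omega) hne ?_
          rw [mul_left_cancel₀ h.ne_zero hab]
    · intro a ha
      rw [Finset.mem_range] at ha
      rw [Polynomial.eval_sub, uni_eval, hBe]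
      by_cases han : a = n
      · simp only [han, if_true]
        rw [psi_zero_move (m := n) le_rfl h1 (by rw [← two_mul]; exact h2)
          (fun i hi1 hi2 hi3 => h3 i hi1 (by omega))
          (by rw [← two_mul, Function.update_self])
          (fun i hi1 hi2 => by rw [Function.update_of_ne (by omega)]; exact hx.1 i hi1),
          P0_eval_last, hAx, hfil]
        have e1 : ∏ a ∈ Finset.range n, (q * Function.update x (2*n) 0 a
            - p * Function.update x (2*n) 0 (2*n)) = ∏ a ∈ Finset.range n, (q * x a) := by
          apply Finset.prod_congr rfl
          intro a ha
          rw [Finset.mem_range] at ha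
          rw [Function.update_self, Function.update_of_ne (by omega), mul_zero, sub_zero]
        have e2 : ∏ a ∈ Finset.range n, (q * 0 - p * x a)
            = (-p) ^ n * ∏ a ∈ Finset.range n, x a := by
          rw [← Finset.card_range n, ← Finset.prod_const, Finset.card_range, ← Finset.prod_mul_distrib]
          apply Finset.prod_congr rfl; intros; ring
        rw [e1, e2, Finset.prod_mul_distrib, Finset.prod_const, Finset.card_range]
        have e3 : (-q) ^ n * q ^ n = (-p) ^ n := by
          rw [← mul_pow, ← h.sq]; congr 1; ring
        rw [← e3]; ring
      · rw [if_neg han, psi_up_root h hn hS h3 hx (by omega),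
          Finset.prod_eq_zero (Finset.mem_range.mpr (show a < n by omega)), mul_zero, sub_zero]
        rw [← h.sq]; ring
    · rw [Finset.card_range]
      have h4 := degreeOf_psi q p hS (j := 2*n) (by omega)
      rw [h2] at h4
      have h5 := natDegree_uni_le (psi q p (2*n+1) μ) (2*n) x
      have := Polynomial.natDegree_sub_le (uni (psi q p (2*n+1) μ) (2*n) x) B
      simp only [if_true] at h4
      omega
  have e := congrArg (Polynomial.eval (x (2*n))) key
  rw [Polynomial.eval_sub, uni_eval, Function.update_eq_self, hBe, Polynomial.eval_zero,
    sub_eq_zero] at e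
  rw [e, P0_eval_rho, hfil]

end XXZ

namespace XXZ
open MvPolynomial

lemma prod_prs_first (M : ℕ) (g : ℕ × ℕ → ℂ) : ∏ e ∈ prs (M+1), g e
    = (∏ e ∈ prs M, g (e.1 + 1, e.2 + 1)) * ∏ a ∈ Finset.range M, g (0, a + 1) := by
  have : prs (M+1) = ((prs M).image fun e => (e.1 + 1, e.2 + 1))
      ∪ (Finset.range M).image fun a => (0, a + 1) := by
    ext ⟨a, b⟩
    simp only [mem_prs, Finset.mem_union, Finset.mem_image, Finset.mem_range, Prod.mk.injEq]
    constructor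
    · intro h
      by_cases h0 : a = 0
      · right; exact ⟨b - 1, by omega, by omega, by omega⟩
      · left; exact ⟨(a - 1, b - 1), by grind, by grind, by grind⟩
    · grind
  rw [this, Finset.prod_union, Finset.prod_image, Finset.prod_image]
  · intro a _ b _ hab; simpa using hab
  · rintro ⟨a, b⟩ _ ⟨c, d⟩ _ hab; simpa using hab
  · rw [Finset.disjoint_left]
    rintro ⟨a, b⟩ h1 h2
    simp only [Finset.mem_image, Finset.mem_range, Prod.mk.injEq] at h1 h2
    grind

variable {q p : ℂ} {N : ℕ}

/-- Moving a single down spin through the block of up spins when its parameter is bound to the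
first one. -/
lemma psi_bound_move (h : Om q p) {L d : ℕ} (hL : L < N) (hd : d < L) {μ : ℕ → Bool}
    (h1 : ∀ i ≤ L, i ≠ L - d → μ i = true) (h2 : μ (L - d) = false)
    (h3 : ∀ i, L < i → i < N → μ i = false)
    {y : ℕ → ℂ} (hy : y (L - d) = p * y 0) (hy0 : y 0 ≠ 0)
    (hg : ∀ i, 0 < i → i ≤ L → i ≠ L - d → y i ≠ q * y 0 ∧ y i ≠ p * y 0) :
    eval y (psi q p N μ) * ∏ b ∈ Finset.Ioc (L - d) L, (y b - y (L - d))
      = (∏ b ∈ Finset.Ioc (L - d) L, (q * y (L - d) - p * y b)) * eval y (P0 q p N μ) := by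
  induction d generalizing μ y with
  | zero =>
    rw [psi_of_not]
    · simp
    · rintro ⟨i, hi, h4, h5⟩
      by_cases hin : i < L
      · rw [h1 i (by omega) (by omega)] at h4; simp at h4
      · rw [h3 (i+1) (by omega) (by omega)] at h5; simp at h5
  | succ d ih =>
    obtain ⟨m, hm⟩ : ∃ m, m = L - (d + 1) := ⟨_, rfl⟩
    have hm' : L - d = m + 1 := by omega
    rw [← hm] at h2 hy hg h1 ⊢
    have hde : Desc N μ m := ⟨by omega, h2, h1 _ (by omega) (by omega)⟩
    have e := psi_exch (q := q) (p := p) hde y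
    have h0 : eval y (psi q p N (μ ∘ sw m)) = 0 := by
      apply block_vanish h (a := 0) (b := m) (by omega) (by omega)
      · intro c hc1 hc2
        have : ∀ c ≤ m, (μ ∘ sw m) c = true := by
          intro c hc
          by_cases hcm : c = m
          · rw [hcm, comp_sw_left]; exact h1 _ (by omega) (by omega)
          · rw [comp_sw_of_ne _ (by omega) (by omega)]; exact h1 _ (by omega) (by omega)
        rw [this c hc2, this 0 (by omega)]
      · exact hy
      · exact hy0
      · intro c hc1 hc2
        rw [hy, ← mul_assoc, ← pow_two, h.sq']
        exact (hg c hc1 (by omega) (by omega)).1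
    have hz0 : (y ∘ sw m) 0 = y 0 := comp_sw_of_ne _ (by omega) (by omega)
    have i1 := @ih (by omega) (μ ∘ sw m) (by
        intro i hi hi2
        rw [hm'] at hi2
        by_cases him : i = m
        · rw [him, comp_sw_left]; exact h1 _ (by omega) (by omega)
        · rw [comp_sw_of_ne _ (by omega) (by omega)]; exact h1 _ (by omega) (by omega))
      (by rw [hm', comp_sw_right]; exact h2)
      (by intro i hi hi2; rw [comp_sw_of_ne _ (by omega) (by omega)]; exact h3 _ hi hi2)
      (y ∘ sw m) (by rw [hm', comp_sw_right, hz0]; exact hy) (by rw [hz0]; exact hy0)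
      (by
        intro i hi hi1 hi2
        rw [hm'] at hi2
        rw [hz0]
        by_cases him : i = m
        · rw [him, comp_sw_left]; exact hg (m+1) (by omega) (by omega) (by omega)
        · rw [comp_sw_of_ne _ (by omega) (by omega)]; exact hg _ (by omega) (by omega) (by omega))
    rw [hm', comp_sw_right, ← eval_rename_perm, ← eval_rename_perm, ← P0_desc hde,
      eval_rename_perm] at i1
    have hI : Finset.Ioc m L = insert (m+1) (Finset.Ioc (m+1) L) := by
      ext a; simp only [Finset.mem_insert, Finset.mem_Ioc]; omega
    have hp : ∀ f : ℂ → ℂ, ∏ b ∈ Finset.Ioc (m+1) L, f ((y ∘ sw m) b)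
        = ∏ b ∈ Finset.Ioc (m+1) L, f (y b) := by
      intro f
      apply Finset.prod_congr rfl
      intro b hb
      rw [Finset.mem_Ioc] at hb
      rw [comp_sw_of_ne _ (by omega) (by omega)]
    rw [hp (fun t => t - y m), hp (fun t => q * y m - p * t)] at i1
    rw [hI, Finset.prod_insert (by simp), Finset.prod_insert (by simp)]
    rw [h0] at e
    linear_combination (∏ b ∈ Finset.Ioc (m+1) L, (y b - y m)) * e + (q * y m - p * y (m+1)) * i1

/-- The polynomial with first spin down vanishes when the first parameter is bound to a down spin
on the right. -/
lemma psi_down_root (h : Om q p) {n : ℕ} {μ : ℕ → Bool} (hS : Sec (2*n+1) (n+1) μ)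
    (h2 : ∀ i, 1 ≤ i → i ≤ n + 1 → μ i = true)
    {x : ℕ → ℂ} (hx : Gen (2*n+1) x) {i : ℕ} (hi : n + 1 < i) (hi2 : i < 2*n+1) :
    eval (Function.update x 0 (p * x i)) (psi q p (2*n+1) μ) = 0 := by
  set y := Function.update x 0 (p * x i) with hy
  have hyg := gen_update hx h.cube' (i := 0) (j := i) (by omega)
  rw [← hy] at hyg
  have hyl : y 0 = p * x i := by rw [hy, Function.update_self]
  have hne : ∀ a, a ≠ 0 → y a = x a := fun a ha => by rw [hy, Function.update_of_ne ha]
  have hyi : y i = x i := hne i (by omega)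
  have key : uni (psi q p (2*n+1) μ) (n+1) y = 0 := by
    apply poly_zero_of_roots (Finset.range (n+1)) (fun a => p * y a)
    · intro a ha b hb hab
      by_contra hne'
      simp only [Finset.mem_range] at ha hb
      have hab' := mul_left_cancel₀ h.ne_zero' hab
      by_cases ha0 : a = 0
      · refine hyg b a (by omega) (by omega) (Ne.symm hne') (by omega) ?_
        rw [hab']
      · refine hyg a b (by omega) (by omega) hne' (by omega) ?_
        rw [hab']
    · intro a ha
      rw [Finset.mem_range] at ha
      rw [uni_eval]
      set z := Function.update y (n+1) (p * y a) with hz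
      have hzl : z (n+1) = p * y a := by rw [hz, Function.update_self]
      have hzn : ∀ b, b ≠ n+1 → z b = y b := fun b hb => by rw [hz, Function.update_of_ne hb]
      by_cases ha0 : a = 0
      · subst ha0
        refine wheel h (i := 0) (j := n+1) (l := i) (by omega) (by omega) (by omega) ?_ ?_ ?_ ?_ μ
        · rw [hzl, hzn 0 (by omega)]
        · rw [hzl, hzn i (by omega), hyi, hyl]
          linear_combination (-x i) * h.cube'
        · rw [hzn 0 (by omega), hyl]; exact mul_ne_zero h.ne_zero' (hx.1 i hi2)
        · intro c d hc hd hcd hcn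
          rw [hzn c hcn.2.1]
          by_cases hd' : d = n+1
          · rw [hd', hzl, mul_pow, h.cube', one_mul, hyl, mul_pow, h.cube', one_mul,
              hne c hcn.1]
            exact hx.2 c i (by omega) (by omega) hcn.2.2
          · rw [hzn d hd']; exact hyg c d hc hd hcd ⟨hcn.1, hcn.2.2⟩
      · refine block_vanish h (a := a) (b := n+1) (by omega) (by omega) ?_ ?_ ?_ ?_
        · intro c hc1 hc2; rw [h2 c (by omega) (by omega), h2 a (by omega) (by omega)]
        · rw [hzl, hzn a (by omega)]
        · rw [hzn a (by omega), hne a ha0]; exact hx.1 a (by omega)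
        · intro c hc1 hc2
          rw [hzl, hzn c (by omega), hne c (by omega), hne a ha0, ← mul_assoc]
          apply ne_of_cube
          · rw [mul_pow, h.cube', one_mul]
          · exact hx.2 c a (by omega) (by omega) (by omega)
    · rw [Finset.card_range]
      have h4 := degreeOf_psi q p hS (j := n+1) (by omega)
      rw [h2 (n+1) (by omega) (by omega)] at h4
      have := natDegree_uni_le (psi q p (2*n+1) μ) (n+1) y
      simp only [if_true] at h4
      omega
  have := uni_eval (psi q p (2*n+1) μ) (n+1) y (y (n+1))
  rw [key, Function.update_eq_self] at this
  simpa using this.symm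

end XXZ

namespace XXZ
open MvPolynomial
variable {q p : ℂ} {N : ℕ}

lemma Sec.rho {a M : ℕ} {μ : ℕ → Bool} (h : Sec (M+1) a μ) : Sec (M+1) a (μ ∘ rho M) := by
  unfold Sec at *
  rw [← h]
  apply Finset.card_bij (fun i _ => XXZ.rho M i)
  · intro i hi
    simp only [Finset.mem_filter, Finset.mem_range, Function.comp] at hi ⊢
    refine ⟨?_, hi.2⟩
    simp only [XXZ.rho, Equiv.coe_fn_mk]; grind
  · intro i _ j _ hij; exact (XXZ.rho M).injective hij
  · intro j hj
    simp only [Finset.mem_filter, Finset.mem_range, Function.comp] at hj ⊢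
    refine ⟨(XXZ.rho M).symm j, ⟨?_, by simpa using hj.2⟩, by simp⟩
    simp only [XXZ.rho, Equiv.coe_fn_symm_mk]; grind

lemma Gen.ne {x : ℕ → ℂ} (hx : Gen N x) {a b : ℕ} (ha : a < N) (hb : b < N) (hab : a ≠ b)
    {c : ℂ} (hc : c ^ 3 = 1) : x a ≠ c * x b :=
  ne_of_cube hc (hx.2 a b ha hb hab)

lemma rot_base_down (h : Om q p) {n : ℕ} (hn : 1 ≤ n) {μ : ℕ → Bool} (hS : Sec (2*n+1) (n+1) μ)
    (h1 : ∀ i ≤ n, μ i = true) (h3 : ∀ i, n < i → i < 2*n+1 → μ i = false)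
    {x : ℕ → ℂ} (hx : Gen (2*n+1) x) :
    eval x (P0 q p (2*n+1) μ) = eval (x ∘ rho (2*n)) (psi q p (2*n+1) (μ ∘ rho (2*n))) := by
  have hν0 : (μ ∘ rho (2*n)) 0 = false := by
    simp only [Function.comp, rho_zero]; exact h3 _ (by omega) (by omega)
  have hνs : ∀ i < 2*n, (μ ∘ rho (2*n)) (i+1) = μ i := by
    intro i hi; simp only [Function.comp, rho_succ hi]
  have hνS := hS.rho
  have hνu : ∀ i, 1 ≤ i → i ≤ n + 1 → (μ ∘ rho (2*n)) i = true := by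
    intro i hi hi2
    obtain ⟨j, rfl⟩ : ∃ j, i = j + 1 := ⟨i - 1, by omega⟩
    rw [hνs j (by omega)]; exact h1 j (by omega)
  have hνd : ∀ i, n + 1 < i → i < 2*n+1 → (μ ∘ rho (2*n)) i = false := by
    intro i hi hi2
    obtain ⟨j, rfl⟩ : ∃ j, i = j + 1 := ⟨i - 1, by omega⟩
    rw [hνs j (by omega)]; exact h3 j (by omega) (by omega)
  set ν := μ ∘ rho (2*n) with hν
  set y := x ∘ rho (2*n) with hy
  have hy0 : y 0 = x (2*n) := by simp only [hy, Function.comp, rho_zero]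
  have hys : ∀ i < 2*n, y (i+1) = x i := by
    intro i hi; simp only [hy, Function.comp, rho_succ hi]
  have hyG : Gen (2*n+1) y := by
    have hlt : ∀ a < 2*n+1, rho (2*n) a < 2*n+1 := by
      intro a ha; simp only [XXZ.rho, Equiv.coe_fn_mk]; grind
    refine ⟨fun a ha => hx.1 _ (hlt a ha), fun a b ha hb hab => hx.2 _ _ (hlt a ha) (hlt b hb) ?_⟩
    exact fun h' => hab ((rho (2*n)).injective h')
  set A := (∏ e ∈ prs (2*n), if μ e.1 = μ e.2 then q * x e.1 - p * x e.2 else 1) with hA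
  have hfil : ∀ g : ℕ → ℂ, (∏ a ∈ Finset.range (2*n), if μ a = μ (2*n) then g a else 1)
      = ∏ a ∈ Finset.Ico (n+1) (2*n), g a := by
    intro g
    rw [← Finset.prod_filter]
    apply Finset.prod_congr _ (fun _ _ => rfl)
    ext a
    simp only [Finset.mem_filter, Finset.mem_range, Finset.mem_Ico, h3 (2*n) (by omega) (by omega)]
    constructor
    · rintro ⟨ha, hb⟩
      by_contra hc
      rw [h1 a (by omega)] at hb; simp at hb
    · intro ha; exact ⟨by omega, h3 a (by omega) (by omega)⟩
  have hfil2 : ∀ g : ℕ → ℂ, (∏ a ∈ Finset.range (2*n-1), if μ 0 = μ (a+1) then g a else 1)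
      = ∏ a ∈ Finset.range n, g a := by
    intro g
    rw [← Finset.prod_filter]
    apply Finset.prod_congr _ (fun _ _ => rfl)
    ext a
    simp only [Finset.mem_filter, Finset.mem_range, h1 0 (by omega)]
    constructor
    · rintro ⟨ha, hb⟩
      by_contra hc
      rw [h3 (a+1) (by omega) (by omega)] at hb; simp at hb
    · intro ha; exact ⟨by omega, (h1 _ (by omega)).symm⟩
  set B : Polynomial ℂ := Polynomial.C A * ∏ a ∈ Finset.Ico (n+1) (2*n),
    (Polynomial.C (q * x a) - Polynomial.C p * Polynomial.X) with hB
  have hBe : ∀ t, B.eval t = A * ∏ a ∈ Finset.Ico (n+1) (2*n), (q * x a - p * t) := by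
    intro t; simp [hB, Polynomial.eval_prod]
  have hBd : B.natDegree ≤ n - 1 := by
    refine (Polynomial.natDegree_C_mul_le _ _).trans ?_
    refine (Polynomial.natDegree_prod_le _ _).trans ?_
    refine (Finset.sum_le_card_nsmul _ _ 1 ?_).trans (by simp; omega)
    intro a _
    refine (Polynomial.natDegree_sub_le _ _).trans (max_le ?_ ?_)
    · rw [Polynomial.natDegree_C]; omega
    · exact (Polynomial.natDegree_C_mul_le _ _).trans Polynomial.natDegree_X_le
  have key : uni (psi q p (2*n+1) ν) 0 y - B = 0 := by
    apply poly_zero_of_roots (insert 0 (Finset.Ico (n+1) (2*n)))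
      (fun a => if a = 0 then q * x 0 else p * x a)
    · intro a ha b hb hab
      simp only [Finset.mem_insert, Finset.mem_Ico] at ha hb
      by_contra hne
      by_cases han : a = 0
      · rw [if_pos han, if_neg (by omega)] at hab
        refine hx.2 0 b (by omega) (by omega) (by omega) ?_
        have := congrArg (· ^ 3) hab
        simpa [mul_pow, h.cube, h.cube'] using this
      · by_cases hbn : b = 0
        · rw [if_neg han, if_pos hbn] at hab
          refine hx.2 a 0 (by omega) (by omega) (by omega) ?_
          have := congrArg (· ^ 3) hab
          simpa [mul_pow, h.cube, h.cube'] using this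
        · rw [if_neg han, if_neg hbn] at hab
          refine hx.2 a b (by omega) (by omega) hne ?_
          rw [mul_left_cancel₀ h.ne_zero' hab]
    · intro a ha
      rw [Finset.mem_insert, Finset.mem_Ico] at ha
      rw [Polynomial.eval_sub, uni_eval, hBe]
      by_cases han : a = 0
      · simp only [han, if_true]
        set z := Function.update y 0 (q * x 0) with hz
        have hz0 : z 0 = q * x 0 := by rw [hz, Function.update_self]
        have hzs : ∀ i < 2*n, z (i+1) = x i := by
          intro i hi; rw [hz, Function.update_of_ne (by omega), hys i hi]
        have hz1 : z 1 = p * z 0 := by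
          rw [hz0, hzs 0 (by omega)]; linear_combination (-x 0) * h.mul
        have hde : Desc (2*n+1) ν 0 := ⟨by omega, hν0, hνu 1 le_rfl (by omega)⟩
        have e1 := psi_exch_wheel h hde hz1 (by rw [hz0]; exact mul_ne_zero h.ne_zero (hx.1 0 (by omega)))
        have hLd : n + 1 - n = 1 := by omega
        have e2 := psi_bound_move h (N := 2*n+1) (L := n+1) (d := n) (by omega) (by omega)
          (μ := ν ∘ sw 0) (y := z)
          (by
            intro i hi hi1
            rw [hLd] at hi1
            by_cases hi0 : i = 0
            · rw [hi0, comp_sw_left]; exact hνu _ (by omega) (by omega)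
            · rw [comp_sw_of_ne _ hi0 (by omega)]; exact hνu _ (by omega) (by omega))
          (by rw [hLd, comp_sw_right 0]; exact hν0)
          (by
            intro i hi hi1
            rw [comp_sw_of_ne _ (by omega) (by omega)]; exact hνd _ hi hi1)
          (by rw [hLd]; exact hz1)
          (by rw [hz0]; exact mul_ne_zero h.ne_zero (hx.1 0 (by omega)))
          (by
            intro i hi hi1 hi2
            rw [hLd] at hi2
            obtain ⟨j, rfl⟩ : ∃ j, i = j + 1 := ⟨i - 1, by omega⟩
            rw [hzs j (by omega), hz0, ← mul_assoc, ← mul_assoc]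
            exact ⟨hx.ne (by omega) (by omega) (by omega) (by rw [mul_pow, h.cube]; ring),
              hx.ne (by omega) (by omega) (by omega) (by rw [mul_pow, h.cube, h.cube']; ring)⟩)
        have hI : ∀ g : ℕ → ℂ, ∏ b ∈ Finset.Ioc 1 (n+1), g b = ∏ a ∈ Finset.range n, g (a + 2) := by
          intro g
          apply Finset.prod_nbij' (fun b => b - 2) (fun a => a + 2)
          · intro b hb; rw [Finset.mem_Ioc] at hb; rw [Finset.mem_range]; omega
          · intro b hb; rw [Finset.mem_range] at hb; rw [Finset.mem_Ioc]; omega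
          · intro b hb; rw [Finset.mem_Ioc] at hb; omega
          · intro b hb; omega
          · intro b hb; rw [Finset.mem_Ioc] at hb; congr 1; omega
        have e3 : eval z (P0 q p (2*n+1) (ν ∘ sw 0))
            = (∏ e ∈ prs (2*n-1), if μ (e.1+1) = μ (e.2+1) then q * x (e.1+1) - p * x (e.2+1) else 1)
             * (∏ a ∈ Finset.range n, (q * (q * x 0) - p * x (a+1)))
             * ∏ a ∈ Finset.Ico (n+1) (2*n), (q * x 0 - p * x a) := by
          have hw : z = (Function.update (Function.update x 0 (q * x 0)) (2*n) (x 0) ∘ rho (2*n))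
              ∘ sw 0 := by
            funext i
            by_cases hi0 : i = 0
            · rw [hi0, comp_sw_left, hz0]
              simp only [Function.comp]
              rw [rho_succ (by omega), Function.update_of_ne (by omega), Function.update_self]
            · by_cases hi1 : i = 1
              · rw [hi1, comp_sw_right 0, hzs 0 (by omega)]
                simp only [Function.comp]
                rw [rho_zero, Function.update_self]
              · rw [comp_sw_of_ne _ hi0 (by omega)]
                rw [hz, Function.update_of_ne hi0, hy]
                simp only [Function.comp]
                rw [Function.update_of_ne, Function.update_of_ne]
                · simp only [XXZ.rho, Equiv.coe_fn_mk]; grind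
                · simp only [XXZ.rho, Equiv.coe_fn_mk]; grind
          conv_lhs => rw [hw]
          rw [← eval_rename_perm, ← P0_desc hde, hν, P0_eval_rho, hfil]
          have : 2 * n = (2*n-1) + 1 := by omega
          congr 1
          · rw [this, prod_prs_first, ← this]
            congr 1
            · apply Finset.prod_congr rfl
              rintro ⟨a, b⟩ he
              rw [mem_prs] at he
              simp only at he ⊢
              rw [Function.update_of_ne (by omega), Function.update_of_ne (by omega),
                Function.update_of_ne (by omega), Function.update_of_ne (by omega)]
            · rw [← hfil2]
              apply Finset.prod_congr rfl
              intro a ha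
              rw [Finset.mem_range] at ha
              rw [Function.update_of_ne (by omega), Function.update_self,
                Function.update_of_ne (by omega), Function.update_of_ne (by omega)]
          · apply Finset.prod_congr rfl
            intro a ha
            rw [Finset.mem_Ico] at ha
            rw [Function.update_self, Function.update_of_ne (by omega), Function.update_of_ne (by omega)]
        have e4 : A = (∏ e ∈ prs (2*n-1), if μ (e.1+1) = μ (e.2+1) then
              q * x (e.1+1) - p * x (e.2+1) else 1)
             * (∏ a ∈ Finset.range n, (q * x 0 - p * x (a+1))) := by
          have : 2 * n = (2*n-1) + 1 := by omega
          rw [hA, this, prod_prs_first, ← this, hfil2]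
        have hz2 : ∀ g : ℂ → ℂ, ∏ a ∈ Finset.range n, g (z (a+2))
            = ∏ a ∈ Finset.range n, g (x (a+1)) := by
          intro g
          apply Finset.prod_congr rfl
          intro a ha
          rw [Finset.mem_range] at ha
          rw [hzs (a+1) (by omega)]
        rw [hLd, hI, hI, e3, hz2 (fun t => t - z 1), hz2 (fun t => q * z 1 - p * t),
          hzs 0 (by omega)] at e2
        set V := ∏ a ∈ Finset.range n, (x (a+1) - x 0) with hV
        have hV0 : V ≠ 0 := by
          rw [hV, Finset.prod_ne_zero_iff]
          intro a ha
          rw [Finset.mem_range] at ha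
          rw [sub_ne_zero]
          exact ne_of_cube' (hx.2 _ _ (by omega) (by omega) (by omega))
        have e5 : ∏ a ∈ Finset.range n, (q * (q * x 0) - p * x (a+1)) = (-p) ^ n * V := by
          rw [hV]
          conv_rhs => rw [← Finset.card_range n, ← Finset.prod_const, Finset.card_range]
          rw [← Finset.prod_mul_distrib]
          apply Finset.prod_congr rfl; intros
          linear_combination x 0 * h.sq
        have e6 : ∏ a ∈ Finset.Ico (n+1) (2*n), (q * x 0 - p * x a)
            = (-q) ^ (n-1) * ∏ a ∈ Finset.Ico (n+1) (2*n), (q * x a - p * (q * x 0)) := by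
          have : (Finset.Ico (n+1) (2*n)).card = n - 1 := by rw [Nat.card_Ico]; omega
          rw [← this, ← Finset.prod_const, ← Finset.prod_mul_distrib]
          apply Finset.prod_congr rfl; intro a _
          linear_combination (x a) * h.sq - x 0 * q * h.mul
        rw [e5] at e2
        have e7 : eval z (psi q p (2*n+1) (ν ∘ sw 0)) = (-p)^n * A *
            ∏ a ∈ Finset.Ico (n+1) (2*n), (q * x 0 - p * x a) := by
          apply mul_right_cancel₀ hV0
          rw [e2, e4]; ring
        rw [e1, e7, e6]
        have e8 : (-q) * (-p)^n * (-q)^(n-1) = 1 := by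
          have : (-q)^n = (-q) * (-q)^(n-1) := by
            rw [← pow_succ']; congr 1; omega
          rw [mul_right_comm, ← this, ← mul_pow, neg_mul_neg, h.mul, one_pow]
        linear_combination (A * ∏ a ∈ Finset.Ico (n+1) (2*n), (q * x a - p * (q * x 0))) * e8
      · rw [if_neg han]
        have h5 := psi_down_root h hνS hνu hyG (i := a + 1) (by omega) (by omega)
        rw [hys a (by omega)] at h5
        rw [h5, Finset.prod_eq_zero (i := a) (by rw [Finset.mem_Ico]; omega), mul_zero, sub_zero]
        linear_combination (-x a) * h.sq'
    · rw [Finset.card_insert_of_notMem (by simp), Nat.card_Ico]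
      have h4 := degreeOf_psi q p hνS (j := 0) (by omega)
      rw [hν0] at h4
      have h5 := natDegree_uni_le (psi q p (2*n+1) ν) 0 y
      have := Polynomial.natDegree_sub_le (uni (psi q p (2*n+1) ν) 0 y) B
      simp only [Bool.false_eq_true, if_false] at h4
      omega
  have e := congrArg (Polynomial.eval (y 0)) key
  rw [Polynomial.eval_sub, uni_eval, Function.update_eq_self, hBe, Polynomial.eval_zero,
    sub_eq_zero] at e
  rw [e, P0_eval_last, hfil, hy0]

end XXZ

namespace XXZ
open MvPolynomial
variable {q p : ℂ} {N : ℕ}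

lemma sorted_of_no_desc {M a : ℕ} {μ : ℕ → Bool} (hd : ¬ ∃ i, Desc M μ i) (hS : Sec M a μ)
    {i : ℕ} (hi : i < M) : μ i = true ↔ i < a := by
  have hdn : ∀ j k, j + k < M → μ j = false → μ (j + k) = false := by
    intro j k
    induction k with
    | zero => intro _ h; exact h
    | succ k ih =>
      intro hk h
      by_contra hc
      exact hd ⟨j + k, by omega, ih (by omega) h, by rw [add_assoc]; simpa using hc⟩
  unfold Sec at hS
  cases hμ : μ i with
  | true =>
    have : Finset.range (i+1) ⊆ (Finset.range M).filter fun i => μ i = true := by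
      intro j hj
      rw [Finset.mem_range] at hj
      rw [Finset.mem_filter, Finset.mem_range]
      refine ⟨by omega, ?_⟩
      by_contra hc
      have := hdn j (i - j) (by omega) (by simpa using hc)
      rw [show j + (i - j) = i by omega, hμ] at this
      simp at this
    have := Finset.card_le_card this
    rw [Finset.card_range, hS] at this
    simp; omega
  | false =>
    have : ((Finset.range M).filter fun i => μ i = true) ⊆ Finset.range i := by
      intro j hj
      rw [Finset.mem_filter, Finset.mem_range] at hj
      rw [Finset.mem_range]
      by_contra hc
      have := hdn i (j - i) (by omega) hμ
      rw [show i + (j - i) = j by omega, hj.2] at this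
      simp at this
    have := Finset.card_le_card this
    rw [Finset.card_range, hS] at this
    simp; omega

lemma comp_rho_sw {M i : ℕ} (hi : i + 1 < M) {α : Type*} (x : ℕ → α) :
    (x ∘ sw i) ∘ rho M = (x ∘ rho M) ∘ sw (i+1) := by
  funext j
  simp only [Function.comp]
  congr 1
  simp only [sw, Equiv.swap_apply_def, rho, Equiv.coe_fn_mk]
  grind

/-- Cyclic invariance of the polynomial solution. -/
theorem psi_rot (h : Om q p) {n : ℕ} (hn : 1 ≤ n) {μ : ℕ → Bool} (hS : Sec (2*n+1) (n+1) μ) :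
    psi q p (2*n+1) μ = rename (rho (2*n)) (psi q p (2*n+1) (μ ∘ rho (2*n))) := by
  induction hm : ms (2*n+1) μ using Nat.strong_induction_on generalizing μ with
  | _ m ih =>
    by_cases hd : ∃ i, Desc (2*n) μ i
    · obtain ⟨i, hi, h2, h3⟩ := hd
      have hde : Desc (2*n+1) μ i := ⟨by omega, h2, h3⟩
      have hde' : Desc (2*n+1) (μ ∘ rho (2*n)) (i+1) := by
        refine ⟨by omega, ?_, ?_⟩
        · simp only [Function.comp]; rw [rho_succ (by omega)]; exact h2
        · simp only [Function.comp]; rw [rho_succ (by omega)]; exact h3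
      have e := ih (ms (2*n+1) (μ ∘ sw i)) (by have := ms_desc hde; omega)
        (hS.sw (by omega)) rfl
      apply eq_of_eval_of_ne (X_sub_X_ne (i := i+1) (j := i) (by omega))
      intro x hx
      rw [map_sub, eval_X, eval_X] at hx
      apply mul_left_cancel₀ hx
      rw [eval_rename, psi_exch hde]
      have e2 := psi_exch (q := q) (p := p) hde' (x ∘ rho (2*n))
      have r1 : (x ∘ rho (2*n)) (i+1) = x i := by
        simp only [Function.comp]; rw [rho_succ (by omega)]
      have r2 : (x ∘ rho (2*n)) (i+1+1) = x (i+1) := by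
        simp only [Function.comp]; rw [rho_succ (by omega)]
      rw [r1, r2] at e2
      rw [e2, ← comp_rho_sw hi, ← comp_rho_sw hi, e, eval_rename, eval_rename]
    · apply eq_of_gen (2*n+1)
      intro x hx
      rw [eval_rename]
      have hS' := hS
      unfold Sec at hS'
      rw [Finset.range_add_one, Finset.filter_insert] at hS'
      cases hl : μ (2*n) with
      | true =>
        rw [if_pos hl, Finset.card_insert_of_notMem (by simp)] at hS'
        have hs := fun i hi => sorted_of_no_desc (i := i) hd (a := n) (by unfold Sec; omega) hi
        have h3 : ∀ i, n ≤ i → i < 2*n → μ i = false := by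
          intro i hi hi2
          have := (hs i hi2).not.mpr (by omega)
          simpa using this
        rw [rot_base_up h hn hS (fun i hi => (hs i (by omega)).mpr hi) hl h3 hx, psi_of_not]
        rintro ⟨i, hi, h4, h5⟩
        by_cases hi0 : i = 0
        · subst hi0
          simp only [Function.comp, rho_zero] at h4
          rw [hl] at h4; simp at h4
        · obtain ⟨j, rfl⟩ : ∃ j, i = j + 1 := ⟨i - 1, by omega⟩
          simp only [Function.comp] at h4 h5
          rw [rho_succ (by omega)] at h4 h5
          exact hd ⟨j, by omega, h4, h5⟩
      | false =>
        rw [if_neg (by simp [hl])] at hS'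
        have hs := fun i hi => sorted_of_no_desc (i := i) hd (a := n+1) hS' hi
        have h1 : ∀ i ≤ n, μ i = true := by
          intro i hi
          by_cases h0 : i < 2*n
          · exact (hs i h0).mpr (by omega)
          · omega
        have h3 : ∀ i, n < i → i < 2*n+1 → μ i = false := by
          intro i hi hi2
          by_cases h0 : i = 2*n
          · rw [h0]; exact hl
          · have := (hs i (by omega)).not.mpr (by omega)
            simpa using this
        rw [← rot_base_down h hn hS h1 h3 hx, psi_of_not]
        rintro ⟨i, hi, h4, h5⟩
        by_cases h0 : i + 1 < 2*n
        · exact hd ⟨i, h0, h4, h5⟩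
        · rw [show i + 1 = 2*n by omega, hl] at h5; simp at h5

end XXZ

namespace XXZ
open MvPolynomial
variable {q p : ℂ} {N : ℕ}

/-- Value of a polynomial at the homogeneous point. -/
abbrev ev1 (f : R) : ℂ := eval (fun _ => 1) f

lemma ev1_rename (σ : ℕ → ℕ) (f : R) : ev1 (rename σ f) = ev1 f := by
  rw [ev1, eval_rename]; rfl

/-- Difference of the partial derivatives along a link at the homogeneous point. -/
def dl (i j : ℕ) (f : R) : ℂ := ev1 (pderiv i f) - ev1 (pderiv j f)

lemma pderiv_sw_right (i : ℕ) (f : R) :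
    ev1 (pderiv (i+1) (rename (sw i) f)) = ev1 (pderiv i f) := by
  have := pderiv_rename (sw i).injective i f
  rw [sw, Equiv.swap_apply_left] at this
  rw [this, ev1_rename]

lemma dl_par (h : Om q p) {i : ℕ} {f : R} (hf : Par q p i f) : (q - p) * dl i (i+1) f = - ev1 f := by
  have e : (C q * X i - C p * X (i+1)) * rename (sw i) f = (C q * X (i+1) - C p * X i) * f := by
    apply MvPolynomial.funext
    intro x
    simpa [eval_rename] using hf x
  have e2 := congrArg (fun g => ev1 (pderiv (i+1) g)) e
  simp only [ev1, Derivation.leibniz, map_add, map_sub, smul_eq_mul, pderiv_C, pderiv_X_self, map_mul,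
    eval_X, eval_C, map_zero, mul_zero, add_zero, map_one, mul_one] at e2
  rw [pderiv_X_of_ne (by omega)] at e2
  have r1 := pderiv_sw_right i f
  have r2 := ev1_rename (sw i) f
  simp only [ev1] at r1 r2
  simp only [map_zero, mul_zero, r1, r2] at e2
  simp only [dl, ev1]
  linear_combination e2 + eval (fun _ => 1) f * h.sum

lemma dl_of_rel {i : ℕ} {f g : R} {a b c d : ℂ}
    (e : (X (i+1) - X i) * g = (C a * X i - C b * X (i+1)) * rename (sw i) f
      - (C a - C b) * (C c * X i + C d * X (i+1)) * f) (hcd : c + d = 1) :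
    (a - b) * dl i (i+1) f = ev1 g + (b + (a - b) * d) * ev1 f := by
  have e2 := congrArg (fun g => ev1 (pderiv (i+1) g)) e
  simp only [ev1, Derivation.leibniz, map_add, map_sub, smul_eq_mul, pderiv_C, pderiv_X_self, map_mul,
    eval_X, eval_C, map_zero, mul_zero, add_zero, map_one, mul_one] at e2
  rw [pderiv_X_of_ne (by omega)] at e2
  have r1 := pderiv_sw_right i f
  have r2 := ev1_rename (sw i) f
  simp only [ev1] at r1 r2
  simp only [map_zero, mul_zero, r1, r2] at e2
  simp only [dl, ev1]
  linear_combination -e2 + (a-b) * eval (fun _ => 1) (pderiv (i+1) f) * hcd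

lemma psi_exch_poly {μ : ℕ → Bool} {i : ℕ} (h : Desc N μ i) :
    (X (i+1) - X i) * psi q p N μ = (C q * X i - C p * X (i+1)) * rename (sw i) (psi q p N (μ ∘ sw i))
      - (C q - C p) * (C 0 * X i + C 1 * X (i+1)) * psi q p N (μ ∘ sw i) := by
  apply MvPolynomial.funext
  intro x
  have := psi_exch (q := q) (p := p) h x
  simp only [map_mul, map_sub, eval_X, eval_C, eval_rename, map_add]
  linear_combination this

lemma psi_exch_symm_poly (h : Om q p) {μ : ℕ → Bool} {i : ℕ} (hd : Desc N μ i) :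
    (X (i+1) - X i) * psi q p N (μ ∘ sw i) = (C q * X i - C p * X (i+1)) * rename (sw i) (psi q p N μ)
      - (C q - C p) * (C 1 * X i + C 0 * X (i+1)) * psi q p N μ := by
  apply eq_of_eval_of_ne (X_sub_X_ne (i := i+1) (j := i) (by omega))
  intro x hx
  simp only [map_sub, eval_X] at hx
  have e1 := psi_exch (q := q) (p := p) hd x
  have e2 := psi_exch (q := q) (p := p) hd (x ∘ sw i)
  rw [comp_sw_left, comp_sw_right, comp_sw_sw] at e2
  simp only [map_mul, map_sub, eval_X, eval_C, eval_rename, map_add]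
  apply mul_left_cancel₀ hx
  linear_combination (q - p) * x i * e1 + (q * x i - p * x (i+1)) * e2 -
    (x (i+1) - x i)^2 * eval x (psi q p N (μ ∘ sw i)) * h.mul

/-- The local relation at the link `(i, i + 1)`. -/
lemma link_rel (h : Om q p) {i : ℕ} (hi : i + 1 < N) (μ : ℕ → Bool) :
    (if μ i = μ (i+1) then ev1 (psi q p N μ) else
      1/2 * ev1 (psi q p N μ) - ev1 (psi q p N (μ ∘ sw i)))
    = - (q - p) * dl i (i+1) (psi q p N μ)
      + (q - p) / 2 * ((if μ i then 1 else 0) - (if μ (i+1) then 1 else 0)) * ev1 (psi q p N μ) := by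
  cases h1 : μ i <;> cases h2 : μ (i+1)
  · have := dl_par h (psi_par (q := q) (p := p) hi (μ := μ) (by rw [h1, h2]))
    simp; linear_combination this
  · have := dl_of_rel (psi_exch_symm_poly h ⟨hi, h1, h2⟩) (by norm_num)
    simp only [Bool.false_eq_true, if_false, if_true, Bool.true_eq_false]
    linear_combination this + ev1 (psi q p N μ) / 2 * h.sum
  · have hd : Desc N (μ ∘ sw i) i := ⟨hi, by rw [comp_sw_left]; exact h2, by rw [comp_sw_right]; exact h1⟩
    have e := psi_exch_poly (q := q) (p := p) hd
    rw [comp_sw_sw] at e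
    have := dl_of_rel e (by norm_num)
    simp only [Bool.false_eq_true, if_false, if_true, Bool.true_eq_false]
    linear_combination this + ev1 (psi q p N μ) / 2 * h.sum
  · have := dl_par h (psi_par (q := q) (p := p) hi (μ := μ) (by rw [h1, h2]))
    simp; linear_combination this

lemma ev1_psi_rot (h : Om q p) {n : ℕ} (hn : 1 ≤ n) {μ : ℕ → Bool} (hS : Sec (2*n+1) (n+1) μ) :
    ev1 (psi q p (2*n+1) (μ ∘ rho (2*n))) = ev1 (psi q p (2*n+1) μ) := by
  conv_rhs => rw [psi_rot h hn hS, ev1_rename]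

/-- The local relation at the seam. -/
lemma seam_rel (h : Om q p) {n : ℕ} (hn : 1 ≤ n) {μ : ℕ → Bool} (hS : Sec (2*n+1) (n+1) μ)
    (hS' : Sec (2*n+1) (n+1) (μ ∘ Equiv.swap (2*n) 0)) :
    (if μ (2*n) = μ 0 then ev1 (psi q p (2*n+1) μ) else
      1/2 * ev1 (psi q p (2*n+1) μ) - ev1 (psi q p (2*n+1) (μ ∘ Equiv.swap (2*n) 0)))
    = - (q - p) * dl (2*n) 0 (psi q p (2*n+1) μ)
      + (q - p) / 2 * ((if μ (2*n) then 1 else 0) - (if μ 0 then 1 else 0))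
        * ev1 (psi q p (2*n+1) μ) := by
  have e := link_rel h (N := 2*n+1) (i := 0) (by omega) (μ ∘ rho (2*n))
  have r0 : (μ ∘ rho (2*n)) 0 = μ (2*n) := by simp only [Function.comp, rho_zero]
  have r1 : (μ ∘ rho (2*n)) (0+1) = μ 0 := by
    simp only [Function.comp]; rw [rho_succ (by omega)]
  have r2 : (μ ∘ rho (2*n)) ∘ sw 0 = (μ ∘ Equiv.swap (2*n) 0) ∘ rho (2*n) := by
    funext j
    simp only [Function.comp, sw, Equiv.swap_apply_def, rho, Equiv.coe_fn_mk]
    congr 1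
    grind
  have r3 : dl (2*n) 0 (psi q p (2*n+1) μ) = dl 0 (0+1) (psi q p (2*n+1) (μ ∘ rho (2*n))) := by
    rw [psi_rot h hn hS, dl, dl]
    have a1 := pderiv_rename (rho (2*n)).injective 0 (psi q p (2*n+1) (μ ∘ rho (2*n)))
    have a2 := pderiv_rename (rho (2*n)).injective 1 (psi q p (2*n+1) (μ ∘ rho (2*n)))
    rw [rho_zero] at a1
    rw [show rho (2*n) 1 = 0 from rho_succ (j := 0) (by omega)] at a2
    rw [a1, a2, ev1_rename, ev1_rename]
  rw [r0, r1, r2, ev1_psi_rot h hn hS, ev1_psi_rot h hn hS', ← r3] at e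
  exact e

end XXZ

namespace XXZ
open MvPolynomial

lemma localOp_mulVec {N : ℕ} (i : Fin N) (A : Matrix Bool Bool ℂ) (v : Cfg N → ℂ) (f : Cfg N) :
    (localOp N i A).mulVec v f = ∑ b, A (f i) b * v (Function.update f i b) := by
  classical
  rw [Matrix.mulVec, dotProduct]
  rw [← Finset.sum_subset (Finset.subset_univ (Finset.univ.image (Function.update f i)))]
  · rw [Finset.sum_image]
    · apply Finset.sum_congr rfl
      intro b _
      simp only [localOp, Matrix.of_apply, Function.update_self]
      rw [Finset.prod_eq_one, mul_one]
      intro j hj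
      rw [Finset.mem_erase] at hj
      rw [Function.update_of_ne hj.1, if_pos rfl]
    · intro b _ c _ h
      exact Function.update_injective f i h
  · intro g _ hg
    have : ∃ j ∈ Finset.univ.erase i, f j ≠ g j := by
      by_contra hc
      push Not at hc
      apply hg
      rw [Finset.mem_image]
      refine ⟨g i, Finset.mem_univ _, ?_⟩
      funext j
      by_cases hj : j = i
      · subst hj; simp
      · rw [Function.update_of_ne hj]; exact hc j (by simp [hj])
    obtain ⟨j, hj, hne⟩ := this
    simp only [localOp, Matrix.of_apply]
    rw [Finset.prod_eq_zero hj (by simp [hne])]; simp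

/-- Local energy density, shifted so that the ground state energy vanishes. -/
def hloc {N : ℕ} (v : Cfg N → ℂ) (i : Fin N) (f : Cfg N) : ℂ :=
  if f i = f (cyc N i) then v f else 1/2 * v f - v (f ∘ Equiv.swap i (cyc N i))

lemma two_site {N : ℕ} {i j : Fin N} (hij : i ≠ j) (v : Cfg N → ℂ) (f : Cfg N) :
    (-(1/2) : ℂ) * (((localOp N i sigmaX * localOp N j sigmaX
      + localOp N i sigmaY * localOp N j sigmaY
      - (1/2 : ℂ) • (localOp N i sigmaZ * localOp N j sigmaZ))).mulVec v f)
    = (if f i = f j then v f else 1/2 * v f - v (f ∘ Equiv.swap i j)) - 3/4 * v f := by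
  have hsame : ∀ b c, f i = b → f j = c →
      Function.update (Function.update f i b) j c = f := by
    intro b c hb hc
    rw [← hb, Function.update_eq_self, ← hc, Function.update_eq_self]
  have hswap : ∀ b c, f i = c → f j = b →
      Function.update (Function.update f i b) j c = f ∘ Equiv.swap i j := by
    intro b c hb hc
    funext l
    by_cases h1 : l = j
    · subst h1; simp [hb]
    · by_cases h2 : l = i
      · subst h2; simp [hij, hc]
      · simp [h1, h2, Equiv.swap_apply_of_ne_of_ne h2 h1]
  have h2 : ∀ A B : Matrix Bool Bool ℂ, (localOp N i A * localOp N j B).mulVec v f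
      = ∑ b, ∑ c, A (f i) b * (B (f j) c * v (Function.update (Function.update f i b) j c)) := by
    intro A B
    rw [← Matrix.mulVec_mulVec, localOp_mulVec]
    apply Finset.sum_congr rfl
    intro b _
    rw [localOp_mulVec, Finset.mul_sum, Function.update_of_ne hij.symm]
  rw [Matrix.sub_mulVec, Matrix.add_mulVec, Matrix.smul_mulVec]
  simp only [Pi.sub_apply, Pi.add_apply, Pi.smul_apply, smul_eq_mul, h2]
  have hI := Complex.I_mul_I
  cases h1 : f i <;> cases h3 : f j <;>
    simp [sigmaX, sigmaY, sigmaZ, hsame _ _ h1 h3, hswap _ _ h1 h3]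
  · linear_combination (-1/2 * v (Function.update (Function.update f i true) j true)) * hI
  · linear_combination (1/2 * v (f ∘ Equiv.swap i j)) * hI
  · linear_combination (1/2 * v (f ∘ Equiv.swap i j)) * hI
  · linear_combination (-1/2 * v (Function.update (Function.update f i false) j false)) * hI

lemma cyc_ne {N : ℕ} (hN : 2 ≤ N) (i : Fin N) : i ≠ cyc N i := by
  intro h
  have := congrArg Fin.val h
  simp only [cyc] at this
  by_cases h2 : i.val + 1 < N
  · rw [Nat.mod_eq_of_lt h2] at this; omega
  · have h3 : i.val + 1 = N := by have := i.isLt; omega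
    rw [h3, Nat.mod_self] at this
    omega

lemma cyc_injective (N : ℕ) : Function.Injective (cyc N) := by
  intro i j h
  have := congrArg Fin.val h
  simp only [cyc] at this
  ext
  have h1 := i.isLt
  have h2 := j.isLt
  by_cases hi : i.val + 1 < N <;> by_cases hj : j.val + 1 < N
  · rw [Nat.mod_eq_of_lt hi, Nat.mod_eq_of_lt hj] at this; omega
  · rw [Nat.mod_eq_of_lt hi, show j.val + 1 = N by omega, Nat.mod_self] at this; omega
  · rw [Nat.mod_eq_of_lt hj, show i.val + 1 = N by omega, Nat.mod_self] at this; omega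
  · omega

/-- The cyclic successor as a permutation. -/
def cycE (N : ℕ) : Equiv.Perm (Fin N) :=
  Equiv.ofBijective (cyc N) (Finite.injective_iff_bijective.mp (cyc_injective N))

lemma sum_cyc {N : ℕ} (g : Fin N → ℂ) : ∑ i, g (cyc N i) = ∑ i, g i :=
  Equiv.sum_comp (cycE N) g

lemma Hper_mulVec {N : ℕ} (hN : 2 ≤ N) (v : Cfg N → ℂ) (f : Cfg N) :
    (Hper N).mulVec v f = ∑ i, hloc v i f - 3 * N / 4 * v f := by
  rw [Hper, Matrix.smul_mulVec, Matrix.sum_mulVec]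
  simp only [Pi.smul_apply, Finset.sum_apply, smul_eq_mul]
  rw [Finset.mul_sum]
  simp only [two_site (cyc_ne hN _)]
  rw [Finset.sum_sub_distrib]
  simp [hloc]; ring

/-- Extension of a configuration to all sites. -/
def extC {N : ℕ} (f : Cfg N) : ℕ → Bool := fun j => if h : j < N then f ⟨j, h⟩ else false

/-- The configurations with `a` up spins. -/
def SecC (N a : ℕ) (f : Cfg N) : Prop := (Finset.univ.filter fun i => f i = true).card = a

lemma ext_apply {N : ℕ} (f : Cfg N) (i : Fin N) : extC f i.val = f i := by simp [extC]

lemma sec_ext {N a : ℕ} {f : Cfg N} : Sec N a (extC f) ↔ SecC N a f := by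
  unfold Sec SecC
  have : (Finset.range N).filter (fun i => extC f i = true)
      = (Finset.univ.filter fun i => f i = true).map Fin.valEmbedding := by
    ext j
    simp only [Finset.mem_filter, Finset.mem_range, Finset.mem_map, Finset.mem_univ, true_and]
    constructor
    · rintro ⟨h1, h2⟩
      exact ⟨⟨j, h1⟩, by rw [← ext_apply f]; exact h2, rfl⟩
    · rintro ⟨i, h1, rfl⟩
      exact ⟨i.isLt, by rw [← h1]; exact ext_apply f i⟩
  rw [this, Finset.card_map]

lemma SecC.perm {N a : ℕ} {f : Cfg N} (h : SecC N a f) (σ : Equiv.Perm (Fin N)) :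
    SecC N a (f ∘ σ) := by
  unfold SecC at *
  rw [← h]
  apply Finset.card_bij (fun i _ => σ i)
  · intro i hi; simpa using hi
  · intro i _ j _ hij; exact σ.injective hij
  · intro j hj
    exact ⟨σ.symm j, by simpa using hj, by simp⟩

lemma ext_comp_swap {N : ℕ} (f : Cfg N) (i j : Fin N) :
    extC (f ∘ Equiv.swap i j) = extC f ∘ Equiv.swap i.val j.val := by
  funext l
  by_cases hl : l < N
  · obtain ⟨m, rfl⟩ : ∃ m : Fin N, l = m.val := ⟨⟨l, hl⟩, rfl⟩
    simp only [ext_apply, Function.comp]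
    rw [← ext_apply f]
    congr 1
    simp only [Equiv.swap_apply_def]
    split_ifs <;> simp_all [Fin.ext_iff]
  · have h1 := i.isLt
    have h2 := j.isLt
    simp only [Function.comp]
    rw [Equiv.swap_apply_of_ne_of_ne (by omega) (by omega)]
    simp [extC, hl]

/-- The components of the ground state. -/
def vv (q p : ℂ) (N : ℕ) (f : Cfg N) : ℂ := ev1 (psi q p N (extC f))

lemma sum_hloc_vv {q p : ℂ} (h : Om q p) {n : ℕ} (hn : 1 ≤ n) {f : Cfg (2*n+1)}
    (hS : SecC (2*n+1) (n+1) f) : ∑ i, hloc (vv q p (2*n+1)) i f = 0 := by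
  set P := psi q p (2*n+1) (extC f) with hP
  set b : Fin (2*n+1) → ℂ := fun i => if f i then 1 else 0 with hb
  have key : ∀ i, hloc (vv q p (2*n+1)) i f
      = (- (q - p) * ev1 (pderiv i.val P) + (q - p) / 2 * b i * ev1 P)
      - (- (q - p) * ev1 (pderiv (cyc (2*n+1) i).val P)
        + (q - p) / 2 * b (cyc (2*n+1) i) * ev1 P) := by
    intro i
    by_cases hi : i.val + 1 < 2*n+1
    · have hc : (cyc (2*n+1) i).val = i.val + 1 := Nat.mod_eq_of_lt hi
      have e := link_rel h hi (extC f)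
      rw [← hc, ext_apply, ext_apply] at e
      have e3 : extC (f ∘ Equiv.swap i (cyc (2*n+1) i)) = extC f ∘ sw i := by
        rw [ext_comp_swap, hc]
      rw [hloc, vv, vv, e3, ← hP, e, dl]
      simp only [hb]; ring
    · have hi2 : i.val = 2*n := by have := i.isLt; omega
      have hc : (cyc (2*n+1) i).val = 0 := by simp [cyc, hi2]
      have e3 : extC (f ∘ Equiv.swap i (cyc (2*n+1) i)) = extC f ∘ Equiv.swap (2*n) 0 := by
        rw [ext_comp_swap, hc, hi2]
      have e := seam_rel h hn (sec_ext.mpr hS) (by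
        rw [← e3, sec_ext]; exact hS.perm _)
      have g1 : extC f (2*n) = f i := by rw [← ext_apply f i, hi2]
      have g2 : extC f 0 = f (cyc (2*n+1) i) := by rw [← ext_apply f (cyc (2*n+1) i), hc]
      rw [g1, g2] at e
      rw [hloc, vv, vv, e3, ← hP, e, dl, hi2, hc]
      simp only [hb]; ring
  rw [Finset.sum_congr rfl fun i _ => key i, Finset.sum_sub_distrib,
    sum_cyc (fun i => - (q - p) * ev1 (pderiv i.val P) + (q - p) / 2 * b i * ev1 P), sub_self]

end XXZ

namespace XXZ

/-- Sum over all lists of Booleans of length `m`. -/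
def Sm (m : ℕ) (F : List Bool → ℝ) : ℝ := ∑ f : Fin m → Bool, F (List.ofFn f)

lemma Sm_zero (F : List Bool → ℝ) : Sm 0 F = F [] := by simp [Sm]

lemma Sm_succ (m : ℕ) (F : List Bool → ℝ) :
    Sm (m+1) F = Sm m (fun r => F (true :: r)) + Sm m (fun r => F (false :: r)) := by
  unfold Sm
  rw [← (Fin.consEquiv (fun _ : Fin (m+1) => Bool)).sum_comp, Fintype.sum_prod_type]
  simp [Fin.consEquiv, List.ofFn_succ]

lemma Sm_congr {m : ℕ} {F G : List Bool → ℝ} (h : ∀ l, l.length = m → F l = G l) :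
    Sm m F = Sm m G := Finset.sum_congr rfl fun f _ => h _ (by simp)

lemma Sm_add_fun (m : ℕ) (F G : List Bool → ℝ) :
    Sm m (fun l => F l + G l) = Sm m F + Sm m G := Finset.sum_add_distrib

lemma Sm_mul (m : ℕ) (c : ℝ) (F : List Bool → ℝ) :
    Sm m (fun l => c * F l) = c * Sm m F := by simp [Sm, Finset.mul_sum]

lemma Sm_zero_fun (m : ℕ) : Sm m (fun _ => 0) = 0 := by simp [Sm]

lemma Sm_sum {ι : Type*} (m : ℕ) (s : Finset ι) (F : ι → List Bool → ℝ) :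
    Sm m (fun l => ∑ i ∈ s, F i l) = ∑ i ∈ s, Sm m (F i) := Finset.sum_comm

lemma Sm_nonneg {m : ℕ} {F : List Bool → ℝ} (h : ∀ l, 0 ≤ F l) : 0 ≤ Sm m F :=
  Finset.sum_nonneg fun _ _ => h _

lemma Sm_append (a b : ℕ) (F : List Bool → ℝ) :
    Sm (a + b) F = Sm a (fun α => Sm b (fun β => F (α ++ β))) := by
  induction a generalizing F with
  | zero => simp [Sm_zero]
  | succ a ih =>
    rw [show a + 1 + b = a + b + 1 by ring, Sm_succ, Sm_succ, ih, ih]; rfl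

lemma Sm_comm (a b : ℕ) (F : List Bool → List Bool → ℝ) :
    Sm a (fun α => Sm b (fun β => F α β)) = Sm b (fun β => Sm a (fun α => F α β)) :=
  Finset.sum_comm

lemma Sm_rotate_one (m : ℕ) (F : List Bool → ℝ) : Sm m (fun l => F (l.rotate 1)) = Sm m F := by
  cases m with
  | zero => simp [Sm_zero]
  | succ m =>
    have := Sm_append m 1 F
    rw [this, Sm_comm, Sm_succ, Sm_succ]
    simp [Sm_zero]

lemma Sm_rotate (m i : ℕ) (F : List Bool → ℝ) : Sm m (fun l => F (l.rotate i)) = Sm m F := by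
  induction i generalizing F with
  | zero => simp
  | succ i ih =>
    rw [← ih F, ← Sm_rotate_one m (fun l => F (l.rotate i))]
    apply Sm_congr
    intro l _
    rw [List.rotate_rotate, add_comm]

lemma alternating_nonneg {m : ℕ} (hm : Even m) (h0 : 0 < m) (Q : List Bool → ℝ) :
    0 ≤ ∑ j ∈ Finset.range m, (-1 : ℝ) ^ j * Sm m (fun l => Q l * Q (l.rotate j)) := by
  set g : List Bool → ℝ := fun l => ∑ j ∈ Finset.range m, (-1 : ℝ) ^ j * Q (l.rotate j) with hg
  have g1 : ∀ l, l.length = m → g (l.rotate 1) = - g l := by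
    intro l hl
    have e1 := Finset.sum_range_succ (fun j => (-1 : ℝ) ^ j * Q (l.rotate j)) m
    have e2 := Finset.sum_range_succ' (fun j => (-1 : ℝ) ^ j * Q (l.rotate j)) m
    rw [e1, hm.neg_one_pow] at e2
    simp only [← hl, List.rotate_length, pow_zero, List.rotate_zero] at e2
    simp only [hg, List.rotate_rotate, ← hl]
    rw [add_right_cancel e2, ← Finset.sum_neg_distrib]
    apply Finset.sum_congr rfl
    intro j _
    rw [add_comm 1 j]; ring
  have gi : ∀ i l, l.length = m → g (l.rotate i) = (-1) ^ i * g l := by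
    intro i
    induction i with
    | zero => intro l _; simp
    | succ i ih =>
      intro l hl
      rw [← List.rotate_rotate, g1 _ (by simpa), ih l hl]; ring
  have e : Sm m (fun l => g l * g l) = m * Sm m (fun l => Q l * g l) := by
    have : Sm m (fun l => g l * g l)
        = ∑ j ∈ Finset.range m, Sm m (fun l => (-1 : ℝ)^j * Q (l.rotate j) * g l) := by
      rw [← Sm_sum]
      apply Sm_congr
      intro l _
      rw [← Finset.sum_mul]
    rw [this]
    rw [Finset.sum_congr rfl (g := fun _ => Sm m (fun l => Q l * g l))]
    · simp
    · intro j _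
      rw [← Sm_rotate m j (fun l => Q l * g l)]
      apply Sm_congr
      intro l hl
      rw [gi j l hl]; ring
  have e2 : Sm m (fun l => Q l * g l)
      = ∑ j ∈ Finset.range m, (-1 : ℝ) ^ j * Sm m (fun l => Q l * Q (l.rotate j)) := by
    simp only [← Sm_mul]
    rw [← Sm_sum]
    apply Sm_congr
    intro l _
    rw [hg, Finset.mul_sum]
    apply Finset.sum_congr rfl
    intros; ring
  rw [← e2]
  have h1 : 0 ≤ Sm m (fun l => g l * g l) := Sm_nonneg fun l => mul_self_nonneg _
  rw [e] at h1
  have : (0 : ℝ) < m := by exact_mod_cast h0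
  nlinarith

/-- Component of the first supercharge. -/
def chA (φ : List Bool → ℝ) : List Bool → ℝ
  | true :: true :: r => φ (false :: r)
  | _ => 0

/-- Component of the adjoint supercharge. -/
def chB (φ : List Bool → ℝ) : List Bool → ℝ
  | false :: r => φ (true :: true :: r)
  | _ => 0

lemma susy_ineq {φ : List Bool → ℝ} (hφ : ∀ α β, φ (α ++ β) = φ (β ++ α)) {m : ℕ} (hm : Odd m) :
    0 ≤ Sm (m+1) (fun r => φ (false :: r) * φ (false :: r))
      + Sm m (fun r => φ (true :: true :: r) * φ (true :: true :: r))
      - 2 * Sm m (fun r => φ (false :: true :: r) * φ (true :: false :: r)) := by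
  have hA := alternating_nonneg (m := m + 3) (by
    obtain ⟨c, rfl⟩ := hm; exact ⟨c + 2, by ring⟩) (by omega) (chA φ)
  have hB := alternating_nonneg (m := m + 1) (by
    obtain ⟨c, rfl⟩ := hm; exact ⟨c + 1, by ring⟩) (by omega) (chB φ)
  have a0 : Sm (m+3) (fun l => chA φ l * chA φ (l.rotate 0))
      = Sm (m+1) (fun r => φ (false :: r) * φ (false :: r)) := by
    rw [Sm_succ, Sm_succ, Sm_succ]
    simp only [chA, List.rotate_zero, mul_zero, Sm_zero_fun, add_zero]
    exact (Sm_succ m (fun r => φ (false :: r) * φ (false :: r))).symm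
  have b0 : Sm (m+1) (fun l => chB φ l * chB φ (l.rotate 0))
      = Sm m (fun r => φ (true :: true :: r) * φ (true :: true :: r)) := by
    rw [Sm_succ]
    simp [chB, Sm_zero_fun]
  have a1 : Sm (m+3) (fun l => chA φ l * chA φ (l.rotate 1))
      = Sm m (fun r => φ (false :: true :: r) * φ (true :: false :: r)) := by
    rw [Sm_succ, Sm_succ, Sm_succ, Sm_succ, Sm_succ]
    simp only [List.rotate_cons_succ, List.rotate_zero, List.cons_append, chA, mul_zero, zero_mul,
      Sm_zero_fun, add_zero]
    apply Sm_congr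
    intro l _
    rw [show false :: (l ++ [true]) = (false :: l) ++ [true] from rfl, hφ (false :: l)]; rfl
  have a2 : Sm (m+3) (fun l => chA φ l * chA φ (l.rotate (m+2)))
      = Sm m (fun r => φ (false :: true :: r) * φ (true :: false :: r)) := by
    rw [← a1, ← Sm_rotate_one]
    apply Sm_congr
    intro l hl
    rw [List.rotate_rotate, show 1 + (m+2) = l.length by omega, List.rotate_length, mul_comm]
  have ab : ∀ a ∈ Finset.range m, Sm (m+3) (fun l => chA φ l * chA φ (l.rotate (a+2)))
      = Sm (m+1) (fun l => chB φ l * chB φ (l.rotate (a+1))) := by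
    intro a ha
    rw [Finset.mem_range] at ha
    obtain ⟨b, rfl⟩ : ∃ b, m = a + b + 1 := ⟨m - a - 1, by omega⟩
    have e1 : Sm (a+b+1+3) (fun l => chA φ l * chA φ (l.rotate (a+2)))
        = Sm a (fun α => Sm b (fun β => φ (false :: (α ++ true :: true :: β))
            * φ (false :: (β ++ true :: true :: α)))) := by
      have hr : ∀ (x y z w : Bool) (α β : List Bool), List.length α = a → (x :: y :: (α ++ z :: w :: β)).rotate (a+2)
          = z :: w :: (β ++ x :: y :: α) := by
        intro x y z w α β hα
        have := List.rotate_append_length_eq (x :: y :: α) (z :: w :: β)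
        rw [List.length_cons, List.length_cons, hα] at this
        exact this
      rw [show a + b + 1 + 3 = (a + (b + 1 + 1)) + 1 + 1 by ring, Sm_succ, Sm_succ, Sm_succ]
      simp only [Sm_append a (b+1+1)]
      have : ∀ x y, Sm a (fun α => Sm (b+1+1) (fun β => chA φ (x :: y :: (α ++ β))
          * chA φ ((x :: y :: (α ++ β)).rotate (a+2))))
          = Sm a (fun α => Sm b (fun β => chA φ (x :: y :: (α ++ true :: true :: β))
            * chA φ (true :: true :: (β ++ x :: y :: α)))) := by
        intro x y
        apply Sm_congr
        intro α hα
        rw [Sm_succ, Sm_succ, Sm_succ]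
        simp only [hr _ _ _ _ _ _ hα]
        simp [chA, Sm_zero_fun]
      simp only [this]
      simp [chA, Sm_zero_fun]
    have e2 : Sm (a+b+1+1) (fun l => chB φ l * chB φ (l.rotate (a+1)))
        = Sm a (fun α => Sm b (fun β => φ (true :: true :: (α ++ false :: β))
            * φ (true :: true :: (β ++ false :: α)))) := by
      have hr : ∀ (x z : Bool) (α β : List Bool), List.length α = a → (x :: (α ++ z :: β)).rotate (a+1)
          = z :: (β ++ x :: α) := by
        intro x z α β hα
        have := List.rotate_append_length_eq (x :: α) (z :: β)
        rw [List.length_cons, hα] at this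
        exact this
      rw [show a + b + 1 + 1 = (a + (b + 1)) + 1 by ring, Sm_succ]
      simp only [Sm_append a (b+1)]
      have : ∀ x, Sm a (fun α => Sm (b+1) (fun β => chB φ (x :: (α ++ β))
          * chB φ ((x :: (α ++ β)).rotate (a+1))))
          = Sm a (fun α => Sm b (fun β => chB φ (x :: (α ++ false :: β))
            * chB φ (false :: (β ++ x :: α)))) := by
        intro x
        apply Sm_congr
        intro α hα
        rw [Sm_succ]
        simp only [hr _ _ _ _ hα]
        simp [chB, Sm_zero_fun]
      simp only [this]
      simp [chB, Sm_zero_fun]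
    rw [e1, e2]
    apply Sm_congr
    intro α _
    apply Sm_congr
    intro β _
    have f1 := hφ (false :: α) (true :: true :: β)
    have f2 := hφ (false :: β) (true :: true :: α)
    simp only [List.cons_append] at f1 f2
    rw [f1, f2, mul_comm]
  rw [Finset.sum_range_succ, Finset.sum_range_succ', Finset.sum_range_succ'] at hA
  rw [Finset.sum_range_succ'] at hB
  rw [Finset.sum_congr rfl fun a ha => by rw [show a + 1 + 1 = a + 2 from rfl, ab a ha]] at hA
  rw [show (0:ℕ) + 1 = 1 from rfl, a0, a1, a2] at hA
  rw [b0] at hB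
  have hs : ∑ a ∈ Finset.range m, (-1 : ℝ) ^ (a+2) * Sm (m+1) (fun l => chB φ l * chB φ (l.rotate (a+1)))
      = - ∑ a ∈ Finset.range m, (-1 : ℝ) ^ (a+1) * Sm (m+1) (fun l => chB φ l * chB φ (l.rotate (a+1))) := by
    rw [← Finset.sum_neg_distrib]
    apply Finset.sum_congr rfl
    intros; ring
  rw [hs] at hA
  have hsign : (-1 : ℝ) ^ (m+2) = -1 := by rw [pow_add, hm.neg_one_pow]; norm_num
  rw [hsign] at hA
  simp only [pow_zero, pow_one] at hA hB
  linarith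

end XXZ

namespace XXZ

/-- Invariance under cyclic rotation, for functions of lists built from a configuration function. -/
def lst {N : ℕ} (φ : Cfg N → ℝ) (l : List Bool) : ℝ :=
  if l.length = N then φ (fun i => l.getD i.val false) else 0

lemma lst_ofFn {N : ℕ} (φ : Cfg N → ℝ) (f : Cfg N) : lst φ (List.ofFn f) = φ f := by
  simp [lst]

lemma lst_append {N : ℕ} {φ : Cfg N → ℝ} (hφ : ∀ f, φ (f ∘ cyc N) = φ f) (α β : List Bool) :
    lst φ (α ++ β) = lst φ (β ++ α) := by
  have h1 : ∀ l, lst φ (l.rotate 1) = lst φ l := by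
    intro l
    unfold lst
    rw [List.length_rotate]
    split_ifs with hl
    · rw [← hφ (fun i => l.getD i.val false)]
      congr 1
      funext i
      have hi : i.val < l.length := by rw [hl]; exact i.isLt
      simp only [Function.comp, cyc]
      rw [List.getD_eq_getElem _ _ (by simpa using hi), List.getElem_rotate,
        List.getD_eq_getElem _ _ (by rw [hl]; exact Nat.mod_lt _ i.pos)]
      simp only [hl]
    · rfl
  have hi : ∀ i l, lst φ (l.rotate i) = lst φ l := by
    intro i
    induction i with
    | zero => simp
    | succ i ih => intro l; rw [← List.rotate_rotate, h1, ih]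
  rw [← List.rotate_append_length_eq α β, hi]

/-- Real version of the local energy density. -/
def hlr {N : ℕ} (φ : Cfg N → ℝ) (i : Fin N) (f : Cfg N) : ℝ :=
  if f i = f (cyc N i) then φ f else 1/2 * φ f - φ (f ∘ Equiv.swap i (cyc N i))

lemma hlr_rot {N : ℕ} (φ : Cfg N → ℝ) (i : Fin N) (f : Cfg N) :
    hlr (fun g => φ (g ∘ cyc N)) (cyc N i) f = hlr φ i (f ∘ cyc N) := by
  unfold hlr
  simp only [Function.comp_apply]
  congr 2
  congr 1
  funext j
  simp only [Function.comp_apply]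
  congr 1
  by_cases h1 : j = i
  · subst h1; simp
  · by_cases h2 : j = cyc N i
    · subst h2; simp
    · rw [Equiv.swap_apply_of_ne_of_ne h1 h2, Equiv.swap_apply_of_ne_of_ne]
      · exact fun h => h1 (cyc_injective N h)
      · exact fun h => h2 (cyc_injective N h)

lemma sum_comp_cyc {N : ℕ} (F : Cfg N → ℝ) : ∑ f : Cfg N, F (f ∘ cyc N) = ∑ f, F f :=
  (Equiv.arrowCongr (cycE N).symm (Equiv.refl Bool)).sum_comp F

lemma link_sum_eq {N : ℕ} {φ : Cfg N → ℝ} (hφ : ∀ f, φ (f ∘ cyc N) = φ f) (i j : Fin N) :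
    ∑ f, φ f * hlr φ i f = ∑ f, φ f * hlr φ j f := by
  have hs : ∀ i : Fin N, ∑ f, φ f * hlr φ (cyc N i) f = ∑ f, φ f * hlr φ i f := by
    intro i
    rw [← sum_comp_cyc (fun f => φ f * hlr φ i f)]
    apply Finset.sum_congr rfl
    intro f _
    rw [← hlr_rot, hφ]
    simp only [hφ]
  have h0 : ∀ m (hm : m < N), ∑ f, φ f * hlr φ ⟨m, hm⟩ f
      = ∑ f, φ f * hlr φ ⟨0, by omega⟩ f := by
    intro m
    induction m with
    | zero => intro hm; rfl
    | succ m ih =>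
      intro hm
      rw [← ih (by omega), ← hs ⟨m, by omega⟩]
      have : cyc N ⟨m, by omega⟩ = ⟨m+1, hm⟩ := by
        ext; simp [cyc, Nat.mod_eq_of_lt hm]
      rw [this]
  rw [h0 i.val i.isLt, h0 j.val j.isLt]

lemma energy_nonneg {m : ℕ} (hm : Odd m) {φ : Cfg (m+2) → ℝ} (hφ : ∀ f, φ (f ∘ cyc (m+2)) = φ f) :
    0 ≤ ∑ f, φ f * ∑ i, hlr φ i f := by
  have hL := lst_append hφ
  have e0 : ∑ f, φ f * ∑ i, hlr φ i f = (m+2) * ∑ f, φ f * hlr φ 0 f := by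
    simp only [Finset.mul_sum]
    rw [Finset.sum_comm]
    rw [Finset.sum_congr rfl fun i _ => link_sum_eq hφ i 0]
    simp [Finset.mul_sum]
  have hcyc : cyc (m+2) 0 = 1 := by ext; simp [cyc]
  have e1 : ∑ f, φ f * hlr φ 0 f = Sm m (fun r => lst φ (true :: true :: r) * lst φ (true :: true :: r))
      + Sm m (fun r => lst φ (true :: false :: r) * (1/2 * lst φ (true :: false :: r)
          - lst φ (false :: true :: r)))
      + (Sm m (fun r => lst φ (false :: true :: r) * (1/2 * lst φ (false :: true :: r)
          - lst φ (true :: false :: r)))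
      + Sm m (fun r => lst φ (false :: false :: r) * lst φ (false :: false :: r))) := by
    have : ∑ f, φ f * hlr φ 0 f = Sm (m+2) (fun l => match l with
        | a :: b :: r => lst φ (a :: b :: r) * (if a = b then lst φ (a :: b :: r) else
            1/2 * lst φ (a :: b :: r) - lst φ (b :: a :: r))
        | _ => 0) := by
      apply Finset.sum_congr rfl
      intro f _
      have h1 : List.ofFn f = f 0 :: f 1 :: List.ofFn (fun i : Fin m => f i.succ.succ) := by
        rw [List.ofFn_succ, List.ofFn_succ]; rfl
      have h2 : List.ofFn (f ∘ Equiv.swap 0 1) = f 1 :: f 0 :: List.ofFn (fun i : Fin m => f i.succ.succ) := by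
        rw [List.ofFn_succ, List.ofFn_succ]
        have h3 : ∀ i : Fin m, Equiv.swap (0 : Fin (m+2)) 1 i.succ.succ = i.succ.succ := by
          intro i
          apply Equiv.swap_apply_of_ne_of_ne
          · exact Fin.succ_ne_zero _
          · intro h
            have := congrArg Fin.val h
            simp at this
        simp [h3]
      rw [h1]
      simp only
      rw [← h1, ← h2, lst_ofFn, lst_ofFn]
      unfold hlr
      rw [hcyc]
    rw [this, Sm_succ, Sm_succ, Sm_succ]
    simp
  have e2 : Sm m (fun r => lst φ (true :: false :: r) * lst φ (true :: false :: r))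
      = Sm m (fun r => lst φ (false :: true :: r) * lst φ (false :: true :: r)) := by
    have h1 := Sm_succ m (fun r => lst φ (true :: r) * lst φ (true :: r))
    have h2 := Sm_append m 1 (fun r => lst φ (true :: r) * lst φ (true :: r))
    have h3 : ∀ r x, lst φ (true :: (r ++ [x])) = lst φ (x :: true :: r) := by
      intro r x
      rw [show true :: (r ++ [x]) = (true :: r) ++ [x] from rfl, hL]; rfl
    simp only [Sm_succ 0, Sm_zero, h3, Sm_add_fun] at h2
    linarith
  have key := susy_ineq hL hm
  rw [Sm_succ] at key
  have l1 : ∀ F G : List Bool → ℝ, Sm m (fun r => F r * (1/2 * F r - G r))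
      = 1/2 * Sm m (fun r => F r * F r) - Sm m (fun r => F r * G r) := by
    intro F G
    rw [← Sm_mul, eq_sub_iff_add_eq, ← Sm_add_fun]
    apply Sm_congr
    intros; ring
  have l2 : Sm m (fun r => lst φ (true :: false :: r) * lst φ (false :: true :: r))
      = Sm m (fun r => lst φ (false :: true :: r) * lst φ (true :: false :: r)) :=
    Sm_congr fun _ _ => mul_comm _ _
  rw [l1 (fun r => lst φ (true :: false :: r)) (fun r => lst φ (false :: true :: r)),
    l1 (fun r => lst φ (false :: true :: r)) (fun r => lst φ (true :: false :: r)), l2] at e1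
  rw [e0]
  apply mul_nonneg (by positivity)
  rw [e1]
  linarith

end XXZ

namespace XXZ
open MvPolynomial
open scoped ComplexOrder

lemma exists_perm_of_card {N a : ℕ} {f g : Cfg N} (hf : SecC N a f) (hg : SecC N a g) :
    ∃ σ : Equiv.Perm (Fin N), f ∘ σ = g := by
  have hc : Fintype.card {i // g i = true} = Fintype.card {i // f i = true} := by
    rw [Fintype.card_subtype, Fintype.card_subtype, hf, hg]
  set e := Fintype.equivOfCardEq hc
  refine ⟨e.extendSubtype, ?_⟩
  funext i
  by_cases hi : g i = true
  · rw [Function.comp, hi]; exact e.extendSubtype_mem i hi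
  · rw [Function.comp, Bool.eq_false_iff.mpr hi]
    exact Bool.eq_false_iff.mpr (e.extendSubtype_not_mem i hi)

lemma zero_of_perron {N a : ℕ} {u : Cfg N → ℝ} (h0 : ∀ f, 0 ≤ u f)
    (hK : ∀ f, ∑ i, hlr u i f = 0) (hs : ∀ f, u f ≠ 0 → SecC N a f) {f0 : Cfg N}
    (hf0 : SecC N a f0) (hz : u f0 = 0) : ∀ f, u f = 0 := by
  have hstep : ∀ f, u f = 0 → ∀ i, u (f ∘ Equiv.swap i (cyc N i)) = 0 := by
    intro f hf i
    have hle : ∀ j ∈ Finset.univ, hlr u j f ≤ 0 := by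
      intro j _
      unfold hlr
      split_ifs
      · exact hf.le
      · rw [hf]; have := h0 (f ∘ Equiv.swap j (cyc N j)); linarith
    have hi := (Finset.sum_eq_zero_iff_of_nonpos hle).mp (hK f) i (Finset.mem_univ _)
    unfold hlr at hi
    split_ifs at hi with hif
    · have : f ∘ Equiv.swap i (cyc N i) = f := by
        funext l
        simp only [Function.comp, Equiv.swap_apply_def]
        split_ifs with h1 h2
        · rw [h1, hif]
        · rw [h2, hif]
        · rfl
      rw [this, hf]
    · rw [hf] at hi; linarith
  have hperm : ∀ σ : Equiv.Perm (Fin N), ∀ f, u f = 0 → u (f ∘ σ) = 0 := by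
    intro σ
    cases N with
    | zero => intro f hf; rw [Subsingleton.elim (f ∘ σ) f, hf]
    | succ m =>
      have hσ : σ ∈ Submonoid.closure (Set.range fun i : Fin m ↦ Equiv.swap i.castSucc i.succ) := by
        rw [Equiv.Perm.mclosure_swap_castSucc_succ]; trivial
      induction hσ using Submonoid.closure_induction with
      | mem x hx =>
        obtain ⟨i, rfl⟩ := hx
        intro f hf
        have : i.succ = cyc (m+1) i.castSucc := by
          ext; simp [cyc, Nat.mod_eq_of_lt]
        simp only [this]
        exact hstep f hf _
      | one => intro f hf; exact hf
      | mul x y _ _ hx hy =>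
        intro f hf
        have := hy _ (hx f hf)
        exact this
  intro f
  by_contra hf
  obtain ⟨σ, hσ⟩ := exists_perm_of_card hf0 (hs f hf)
  rw [← hσ] at hf
  exact hf (hperm σ f0 hz)

lemma Hper_apply {N : ℕ} (hN : 2 ≤ N) (f g : Cfg N) :
    Hper N f g = ∑ i, hloc (Pi.single g 1) i f - 3 * N / 4 * (Pi.single g 1 : Cfg N → ℂ) f := by
  rw [← Hper_mulVec hN, Matrix.mulVec_single_one]; rfl

lemma Hper_isHermitian {N : ℕ} (hN : 2 ≤ N) : (Hper N).IsHermitian := by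
  ext f g
  rw [Matrix.conjTranspose_apply, Hper_apply hN, Hper_apply hN]
  have h1 : (Pi.single f 1 : Cfg N → ℂ) g = (Pi.single g 1 : Cfg N → ℂ) f := by
    simp only [Pi.single_apply]
    split_ifs <;> simp_all
  have h2 : star ((Pi.single f 1 : Cfg N → ℂ) g) = (Pi.single f 1 : Cfg N → ℂ) g := by
    simp only [Pi.single_apply]
    split_ifs <;> simp
  have h3 : ∀ i, star (hloc (Pi.single f 1) i g) = hloc (Pi.single g 1) i f := by
    intro i
    have hsw : f ∘ Equiv.swap i (cyc N i) = g ↔ g ∘ Equiv.swap i (cyc N i) = f := by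
      constructor <;> (rintro rfl; funext l; simp)
    by_cases hfg : f = g
    · subst hfg
      unfold hloc
      simp only [Pi.single_apply]
      split_ifs <;> simp
    · by_cases hs : f ∘ Equiv.swap i (cyc N i) = g
      · have hs' := hsw.mp hs
        have e1 : g i = f (cyc N i) := by rw [← hs]; simp
        have e2 : g (cyc N i) = f i := by rw [← hs]; simp
        unfold hloc
        rw [e1, e2, hs, hs']
        simp only [Pi.single_apply, hfg, Ne.symm hfg, if_false, eq_comm]
        split_ifs <;> simp
      · have hs' := (not_congr hsw).mp hs
        unfold hloc
        simp only [Pi.single_apply, hfg, Ne.symm hfg, hs, hs', if_false]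
        split_ifs <;> simp
  rw [star_sub, star_sum, star_mul, h2, h1, Finset.sum_congr rfl fun i _ => h3 i]
  congr 1
  rw [mul_comm]
  congr 1
  simp

lemma Hper_posSemidef {N : ℕ} (hN : 2 ≤ N) {E₀ : ℝ}
    (hmin : ∀ (E : ℂ) (v : Cfg N → ℂ), v ≠ 0 → (Hper N).mulVec v = E • v → E₀ ≤ E.re) :
    (Hper N - (E₀ : ℂ) • 1).PosSemidef := by
  have hH : (Hper N - (E₀ : ℂ) • 1).IsHermitian := by
    apply (Hper_isHermitian hN).sub
    rw [Matrix.IsHermitian, Matrix.conjTranspose_smul, Matrix.conjTranspose_one]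
    simp
  rw [hH.posSemidef_iff_eigenvalues_nonneg]
  intro j
  have e := hH.mulVec_eigenvectorBasis j
  rw [Matrix.sub_mulVec, Matrix.smul_mulVec, Matrix.one_mulVec, sub_eq_iff_eq_add] at e
  have hne : (⇑(hH.eigenvectorBasis j) : Cfg N → ℂ) ≠ 0 := by
    intro h
    apply hH.eigenvectorBasis.orthonormal.ne_zero j
    ext f
    exact congrFun h f
  have := hmin (hH.eigenvalues j + E₀) _ hne (by
    rw [e, add_smul]; rfl)
  simpa using this

lemma Hper_real {N : ℕ} (hN : 2 ≤ N) (φ : Cfg N → ℝ) (f : Cfg N) :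
    (Hper N).mulVec (fun f => (φ f : ℂ)) f
      = ((∑ i, hlr φ i f - 3 * N / 4 * φ f : ℝ) : ℂ) := by
  rw [Hper_mulVec hN]
  push_cast
  congr 1
  apply Finset.sum_congr rfl
  intro i _
  unfold hloc hlr
  split_ifs <;> simp

lemma abs_ground {N : ℕ} (hN : 2 ≤ N) {E₀ : ℝ} (hP : (Hper N - (E₀ : ℂ) • 1).PosSemidef)
    {Ψ : Cfg N → ℂ} (hΨ : (Hper N).mulVec Ψ = (E₀ : ℂ) • Ψ) (f : Cfg N) :
    ∑ i, hlr (fun f => ‖Ψ f‖) i f = (E₀ + 3 * N / 4) * ‖Ψ f‖ := by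
  set φ : Cfg N → ℝ := fun f => ‖Ψ f‖ with hφ
  have hval : ∀ f, (Hper N - (E₀ : ℂ) • 1).mulVec (fun f => (φ f : ℂ)) f
      = ((∑ i, hlr φ i f - (E₀ + 3 * N / 4) * φ f : ℝ) : ℂ) := by
    intro f
    rw [Matrix.sub_mulVec, Pi.sub_apply, Hper_real hN, Matrix.smul_mulVec, Matrix.one_mulVec]
    simp; ring
  have hdot : star (fun f => (φ f : ℂ)) ⬝ᵥ (Hper N - (E₀ : ℂ) • 1).mulVec (fun f => (φ f : ℂ))
      = ((∑ f, φ f * (∑ i, hlr φ i f - (E₀ + 3 * N / 4) * φ f) : ℝ) : ℂ) := by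
    rw [dotProduct]
    push_cast
    apply Finset.sum_congr rfl
    intro f _
    rw [hval]
    simp
  have hle : ∑ f, φ f * (∑ i, hlr φ i f - (E₀ + 3 * N / 4) * φ f) ≤ 0 := by
    apply Finset.sum_nonpos
    intro f _
    have h1 : ∑ i, hloc Ψ i f = (E₀ + 3 * N / 4 : ℝ) * Ψ f := by
      have := congrFun hΨ f
      rw [Hper_mulVec hN, Pi.smul_apply, smul_eq_mul] at this
      push_cast
      linear_combination this
    have h2 : ((starRingEnd ℂ) (Ψ f) * ∑ i, hloc Ψ i f).re = (E₀ + 3 * N / 4) * φ f * φ f := by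
      rw [h1, mul_left_comm, Complex.re_ofReal_mul, ← Complex.normSq_eq_conj_mul_self,
        Complex.ofReal_re, Complex.normSq_eq_norm_sq]
      simp only [hφ]; ring
    have h3 : φ f * ∑ i, hlr φ i f ≤ ((starRingEnd ℂ) (Ψ f) * ∑ i, hloc Ψ i f).re := by
      rw [Finset.mul_sum, Finset.mul_sum, Complex.re_sum]
      apply Finset.sum_le_sum
      intro i _
      have hself : ((starRingEnd ℂ) (Ψ f) * Ψ f).re = φ f * φ f := by
        rw [← Complex.normSq_eq_conj_mul_self, Complex.ofReal_re, Complex.normSq_eq_norm_sq]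
        simp only [hφ]; ring
      unfold hlr hloc
      split_ifs
      · exact hself.ge
      · set g := f ∘ Equiv.swap i (cyc N i)
        have : ((starRingEnd ℂ) (Ψ f) * Ψ g).re ≤ φ f * φ g := by
          refine (Complex.re_le_norm _).trans ?_
          rw [norm_mul, Complex.norm_conj]
        have e : (starRingEnd ℂ) (Ψ f) * (1/2 * Ψ f - Ψ g)
            = ((1/2 : ℝ) : ℂ) * ((starRingEnd ℂ) (Ψ f) * Ψ f) - (starRingEnd ℂ) (Ψ f) * Ψ g := by
          push_cast; ring
        rw [e, Complex.sub_re, Complex.re_ofReal_mul, hself]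
        linarith
    nlinarith
  have hge := hP.re_dotProduct_nonneg (fun f => (φ f : ℂ))
  rw [hdot] at hge
  have h0 : ∑ f, φ f * (∑ i, hlr φ i f - (E₀ + 3 * N / 4) * φ f) = 0 := le_antisymm hle hge
  rw [h0, Complex.ofReal_zero, hP.dotProduct_mulVec_zero_iff] at hdot
  have := congrFun hdot f
  rw [hval, Pi.zero_apply, Complex.ofReal_eq_zero] at this
  linarith

end XXZ

namespace XXZ
open MvPolynomial
open scoped ComplexOrder

/-- The ground state vector, supported on the sector with `a` up spins. -/
def vS (q p : ℂ) (N a : ℕ) (f : Cfg N) : ℂ := by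
  classical exact if SecC N a f then vv q p N f else 0

lemma vS_of {q p : ℂ} {N a : ℕ} {f : Cfg N} (h : SecC N a f) : vS q p N a f = vv q p N f := if_pos h
lemma vS_of_not {q p : ℂ} {N a : ℕ} {f : Cfg N} (h : ¬ SecC N a f) : vS q p N a f = 0 := if_neg h

lemma Hper_vS {q p : ℂ} (h : Om q p) {n : ℕ} (hn : 1 ≤ n) :
    (Hper (2*n+1)).mulVec (vS q p (2*n+1) (n+1))
      = ((-(3 * (2*n+1) / 4) : ℝ) : ℂ) • vS q p (2*n+1) (n+1) := by
  funext f
  rw [Hper_mulVec (by omega), Pi.smul_apply, smul_eq_mul]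
  have : ∑ i, hloc (vS q p (2*n+1) (n+1)) i f = 0 := by
    by_cases hf : SecC (2*n+1) (n+1) f
    · rw [← sum_hloc_vv h hn hf]
      apply Finset.sum_congr rfl
      intro i _
      unfold hloc
      rw [vS_of hf, vS_of (hf.perm _)]
    · apply Finset.sum_eq_zero
      intro i _
      unfold hloc
      rw [vS_of_not hf, vS_of_not]
      · simp
      · intro hc
        apply hf
        have := hc.perm (Equiv.swap i (cyc (2*n+1) i))
        convert this using 1
        funext l; simp
  rw [this]
  push_cast; ring

/-- The configuration with the first `a` spins up. -/
def fBase (N a : ℕ) : Cfg N := fun i => decide (i.val < a)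

lemma fBase_sec {N a : ℕ} (h : a ≤ N) : SecC N a (fBase N a) := by
  unfold SecC fBase
  simp only [decide_eq_true_eq]
  rw [Fin.card_filter_val_lt]
  omega

lemma vv_fBase_ne {q p : ℂ} (h : Om q p) (N a : ℕ) : vv q p N (fBase N a) ≠ 0 := by
  rw [vv, psi_of_not, ev1, P0_eval]
  · rw [Finset.prod_ne_zero_iff]
    intro e _
    have := sub_ne_zero.mpr h.ne
    split_ifs <;> simpa
  · rintro ⟨i, h1, h2, h3⟩
    have e2 := ext_apply (fBase N a) ⟨i, by omega⟩
    have e3 := ext_apply (fBase N a) ⟨i+1, by omega⟩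
    simp only [fBase] at e2 e3
    rw [h2] at e2
    rw [h3] at e3
    have := of_decide_eq_true e3.symm
    have := of_decide_eq_false e2.symm
    omega

lemma hlr_smul_sum {N : ℕ} {ι : Type*} (s : Finset ι) (u : ι → Cfg N → ℝ) (i : Fin N) (f : Cfg N) :
    hlr (fun g => ∑ t ∈ s, u t g) i f = ∑ t ∈ s, hlr (u t) i f := by
  unfold hlr
  split_ifs
  · rfl
  · rw [Finset.sum_sub_distrib, Finset.mul_sum]

lemma rot_ground {N : ℕ} {φ : Cfg N → ℝ} {ε : ℝ} (h : ∀ f, ∑ i, hlr φ i f = ε * φ f) (f : Cfg N) :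
    ∑ i, hlr (fun g => φ (g ∘ cyc N)) i f = ε * φ (f ∘ cyc N) := by
  rw [← h, ← Equiv.sum_comp (cycE N)]
  exact Finset.sum_congr rfl fun i _ => hlr_rot φ i f

lemma energy_ge {m : ℕ} (hm : Odd m) {φ : Cfg (m+2) → ℝ} {ε : ℝ} (h0 : ∀ f, 0 ≤ φ f)
    (hne : ∃ f, φ f ≠ 0) (h : ∀ f, ∑ i, hlr φ i f = ε * φ f) : 0 ≤ ε := by
  set u : ℕ → Cfg (m+2) → ℝ := fun t f => φ (f ∘ (cyc (m+2))^[t]) with hu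
  have hu1 : ∀ t f, u (t+1) f = u t (f ∘ cyc (m+2)) := by
    intro t f
    simp only [hu, Function.iterate_succ', Function.comp_assoc]
  have hcyc : ∀ t (i : Fin (m+2)), ((cyc (m+2))^[t] i).val = (i.val + t) % (m+2) := by
    intro t
    induction t with
    | zero => intro i; simp [Nat.mod_eq_of_lt i.isLt]
    | succ t ih =>
      intro i
      rw [Function.iterate_succ', Function.comp_apply, cyc]
      simp only [ih]
      rw [Nat.mod_add_mod, add_assoc]
  have huN : ∀ f, u (m+2) f = u 0 f := by
    intro f
    simp only [hu, Function.iterate_zero]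
    congr 1
    funext i
    simp only [Function.comp]
    congr 1
    ext
    rw [hcyc, Nat.add_mod_right, Nat.mod_eq_of_lt i.isLt]; rfl
  have hug : ∀ t f, ∑ i, hlr (u t) i f = ε * u t f := by
    intro t
    induction t with
    | zero => exact h
    | succ t ih =>
      have : u (t+1) = fun g => u t (g ∘ cyc (m+2)) := funext (hu1 t)
      rw [this]
      exact rot_ground ih
  set Φ : Cfg (m+2) → ℝ := fun f => ∑ t ∈ Finset.range (m+2), u t f with hΦ
  have hΦg : ∀ f, ∑ i, hlr Φ i f = ε * Φ f := by
    intro f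
    simp only [hΦ, hlr_smul_sum]
    rw [Finset.sum_comm, Finset.mul_sum]
    exact Finset.sum_congr rfl fun t _ => hug t f
  have hΦr : ∀ f, Φ (f ∘ cyc (m+2)) = Φ f := by
    intro f
    simp only [hΦ, ← hu1]
    have e1 := Finset.sum_range_succ (fun t => u t f) (m+2)
    rw [Finset.sum_range_succ', huN] at e1
    linarith
  have key := energy_nonneg hm hΦr
  simp only [hΦg] at key
  obtain ⟨f, hf⟩ := hne
  have hpos : 0 < ∑ f, Φ f * Φ f := by
    apply Finset.sum_pos' (fun _ _ => mul_self_nonneg _)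
    refine ⟨f, Finset.mem_univ _, mul_self_pos.mpr (ne_of_gt ?_)⟩
    apply Finset.sum_pos' (fun _ _ => h0 _)
    exact ⟨0, by simp, lt_of_le_of_ne (h0 f) hf.symm⟩
  by_contra hc
  push Not at hc
  have : ∑ f, Φ f * (ε * Φ f) = ε * ∑ f, Φ f * Φ f := by
    rw [Finset.mul_sum]; apply Finset.sum_congr rfl; intros; ring
  rw [this] at key
  nlinarith

lemma ground_unique {q p : ℂ} (h : Om q p) {n : ℕ} (hn : 1 ≤ n) {Ψ : Cfg (2*n+1) → ℂ} (hΨ : Ψ ≠ 0)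
    {E₀ : ℝ} (hground : (Hper (2*n+1)).mulVec Ψ = (E₀ : ℂ) • Ψ)
    (hmin : ∀ (E : ℂ) (v : Cfg (2*n+1) → ℂ), v ≠ 0 →
      (Hper (2*n+1)).mulVec v = E • v → E₀ ≤ E.re)
    (hsec : ∀ f, Ψ f ≠ 0 → SecC (2*n+1) (n+1) f) :
    (∀ f, SecC (2*n+1) (n+1) f → Ψ f ≠ 0) ∧
      ∃ c : ℂ, c ≠ 0 ∧ ∀ f, SecC (2*n+1) (n+1) f → vv q p (2*n+1) f = c * Ψ f := by
  set f0 := fBase (2*n+1) (n+1) with hf0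
  have hf0s : SecC (2*n+1) (n+1) f0 := fBase_sec (by omega)
  have hP := Hper_posSemidef (by omega) hmin
  have hv0 : vS q p (2*n+1) (n+1) f0 ≠ 0 := by rw [vS_of hf0s]; exact vv_fBase_ne h _ _
  have hε1 : E₀ ≤ -(3 * (2*n+1) / 4) := by
    have := hmin _ (vS q p (2*n+1) (n+1)) (fun h0 => hv0 (congrFun h0 f0)) (Hper_vS h hn)
    rwa [Complex.ofReal_re] at this
  have hexists : ∃ f, Ψ f ≠ 0 := by
    by_contra hc
    push Not at hc
    exact hΨ (funext hc)
  obtain ⟨m, hm, rfl⟩ : ∃ m, Odd (2*m+1) ∧ n = m + 1 := ⟨n-1, ⟨n-1, rfl⟩, by omega⟩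
  have habs : ∀ v : Cfg (2*(m+1)+1) → ℂ, (Hper (2*(m+1)+1)).mulVec v = (E₀ : ℂ) • v → ∀ f,
      ∑ i, hlr (fun f => ‖v f‖) i f = (E₀ + 3 * (2*(m+1:ℕ)+1) / 4) * ‖v f‖ := by
    intro v hv f
    have := abs_ground (by omega) hP hv f
    rw [this]; push_cast; ring
  have hε2 : 0 ≤ E₀ + 3 * (2*(m+1:ℕ)+1) / 4 := by
    obtain ⟨f, hf⟩ := hexists
    exact energy_ge (m := 2*m+1) hm (φ := fun f => ‖Ψ f‖) (fun _ => norm_nonneg _)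
      ⟨f, norm_ne_zero_iff.mpr hf⟩ (habs Ψ hground)
  have hε : E₀ + 3 * (2*(m+1:ℕ)+1) / 4 = 0 := by linarith
  have hEv : E₀ = -(3 * (2*(m+1:ℕ)+1) / 4) := by linarith
  rw [hε] at habs
  have hper : ∀ v : Cfg (2*(m+1)+1) → ℂ, (Hper (2*(m+1)+1)).mulVec v = (E₀ : ℂ) • v →
      (∀ f, v f ≠ 0 → SecC (2*(m+1)+1) (m+1+1) f) → ∀ g, SecC (2*(m+1)+1) (m+1+1) g → v g = 0 →
      ∀ f, v f = 0 := by
    intro v hv hs g hg hvg f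
    have := zero_of_perron (u := fun f => ‖v f‖) (fun _ => norm_nonneg _)
      (fun f => by rw [habs v hv, zero_mul]) (fun f hf => hs f (norm_ne_zero_iff.mp hf)) hg
      (norm_eq_zero.mpr hvg) f
    exact norm_eq_zero.mp this
  have hpos : ∀ f, SecC (2*(m+1)+1) (m+1+1) f → Ψ f ≠ 0 := by
    intro g hg hz
    obtain ⟨f, hf⟩ := hexists
    exact hf (hper Ψ hground hsec g hg hz f)
  refine ⟨hpos, ?_⟩
  have hΨ0 := hpos f0 hf0s
  set c := vS q p (2*(m+1)+1) (m+1+1) f0 / Ψ f0 with hc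
  refine ⟨c, div_ne_zero hv0 hΨ0, ?_⟩
  have hw := hper (vS q p (2*(m+1)+1) (m+1+1) - c • Ψ) (by
    rw [Matrix.mulVec_sub, Matrix.mulVec_smul, hground, Hper_vS h hn, smul_sub, hEv]
    rw [smul_comm c]) (by
    intro f hf
    by_contra hcon
    apply hf
    have : Ψ f = 0 := by by_contra h1; exact hcon (hsec f h1)
    simp [vS_of_not hcon, this]) f0 hf0s (by
    simp [hc, hΨ0])
  intro f hf
  have := hw f
  rw [Pi.sub_apply, vS_of hf, Pi.smul_apply, smul_eq_mul, sub_eq_zero] at this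
  exact this

end XXZ

namespace XXZ
open MvPolynomial

/-- The weight attached to the down spins of a configuration. -/
def wtZ (N : ℕ) (μ : ℕ → Bool) : R := ∏ j ∈ Finset.range N, if μ j then 1 else X j

/-- The contribution of a configuration to the emptiness formation sum. -/
def gg (q p : ℂ) (n : ℕ) (μ : ℕ → Bool) : R :=
  wtZ (2 * n + 1) μ * psi q p (2 * n + 1) μ * psi p q (2 * n + 1) μ

open Classical in
/-- The inhomogeneous emptiness formation sum. -/
def GG (q p : ℂ) (n k : ℕ) : R :=
  ∑ f : Cfg (2 * n + 1),
    if SecC (2 * n + 1) (n + 1) f ∧ ∀ j < k, extC f j = true then gg q p n (extC f) else 0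

lemma wtZ_eval (N : ℕ) (μ : ℕ → Bool) (x : ℕ → ℂ) :
    eval x (wtZ N μ) = ∏ j ∈ Finset.range N, if μ j then 1 else x j := by
  rw [wtZ, map_prod]
  apply Finset.prod_congr rfl
  intro j _
  split_ifs <;> simp

lemma wtZ_eval_split {N i : ℕ} (hi : i + 1 < N) (μ : ℕ → Bool) (x : ℕ → ℂ) :
    eval x (wtZ N μ) = (if μ i then 1 else x i) * ((if μ (i + 1) then 1 else x (i + 1))
      * ∏ j ∈ ((Finset.range N).erase i).erase (i + 1), if μ j then 1 else x j) := by
  rw [wtZ_eval,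
    ← Finset.mul_prod_erase (Finset.range N) _ (Finset.mem_range.mpr (by omega : i < N)),
    ← Finset.mul_prod_erase ((Finset.range N).erase i) _ (a := i + 1) (by simp; omega)]

lemma prod_erase_sw {N i : ℕ} (μ ν : ℕ → Bool) (x y : ℕ → ℂ)
    (hμ : ν = μ ∨ ν = μ ∘ sw i) (hx : y = x ∨ y = x ∘ sw i) :
    ∏ j ∈ ((Finset.range N).erase i).erase (i + 1), (if ν j then 1 else y j)
      = ∏ j ∈ ((Finset.range N).erase i).erase (i + 1), if μ j then 1 else x j := by
  apply Finset.prod_congr rfl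
  intro j hj
  simp only [Finset.mem_erase] at hj
  have h1 : ν j = μ j := by
    rcases hμ with rfl | rfl
    · rfl
    · exact comp_sw_of_ne μ hj.2.1 hj.1
  have h2 : y j = x j := by
    rcases hx with rfl | rfl
    · rfl
    · exact comp_sw_of_ne x hj.2.1 hj.1
  rw [h1, h2]

lemma gg_pair_aux {q p : ℂ} (h : Om q p) {n i : ℕ} (hi : i + 1 < 2 * n + 1) {μ : ℕ → Bool}
    (hd : Desc (2 * n + 1) μ i) (x : ℕ → ℂ) (hx : x (i + 1) - x i ≠ 0) :
    eval (x ∘ sw i) (gg q p n μ) + eval (x ∘ sw i) (gg q p n (μ ∘ sw i))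
      = eval x (gg q p n μ) + eval x (gg q p n (μ ∘ sw i)) := by
  obtain ⟨-, h2, h3⟩ := id hd
  have e1 := psi_exch (q := q) (p := p) hd x
  have e2 := psi_exch (q := p) (p := q) hd x
  have e3 := psi_exch (q := q) (p := p) hd (x ∘ sw i)
  have e4 := psi_exch (q := p) (p := q) hd (x ∘ sw i)
  simp only [comp_sw_left, comp_sw_right, comp_sw_sw] at e1 e2 e3 e4
  simp only [gg, map_mul, wtZ_eval_split hi, comp_sw_left, comp_sw_right, h2, h3]
  rw [prod_erase_sw μ μ x (x ∘ sw i) (.inl rfl) (.inr rfl),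
    prod_erase_sw μ (μ ∘ sw i) x (x ∘ sw i) (.inr rfl) (.inr rfl),
    prod_erase_sw μ (μ ∘ sw i) x x (.inr rfl) (.inl rfl)]
  simp only [if_true, Bool.false_eq_true, if_false]
  generalize (∏ j ∈ ((Finset.range (2 * n + 1)).erase i).erase (i + 1),
    if μ j then 1 else x j) = W
  have hm := h.mul
  set a := x i
  set b := x (i + 1)
  set D := eval x (psi q p (2 * n + 1) μ)
  set D' := eval x (psi p q (2 * n + 1) μ)
  set Ds := eval (x ∘ sw i) (psi q p (2 * n + 1) μ)
  set Ds' := eval (x ∘ sw i) (psi p q (2 * n + 1) μ)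
  set U := eval x (psi q p (2 * n + 1) (μ ∘ sw i))
  set U' := eval x (psi p q (2 * n + 1) (μ ∘ sw i))
  set Us := eval (x ∘ sw i) (psi q p (2 * n + 1) (μ ∘ sw i))
  set Us' := eval (x ∘ sw i) (psi p q (2 * n + 1) (μ ∘ sw i))
  apply mul_left_cancel₀ (mul_ne_zero hx hx)
  linear_combination W * b * ((a - b) * Ds * e4 + ((p * b - q * a) * U' - (p - q) * a * Us') * e3)
    - W * a * ((b - a) * D * e2 + ((p * a - q * b) * Us' - (p - q) * b * U') * e1)
    + W * (b - a) ^ 2 * (b * U * U' - a * Us * Us') * hm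

lemma gg_pair {q p : ℂ} (h : Om q p) {n i : ℕ} (hi : i + 1 < 2 * n + 1) (μ : ℕ → Bool) :
    rename (sw i) (gg q p n μ + gg q p n (μ ∘ sw i)) = gg q p n μ + gg q p n (μ ∘ sw i) := by
  apply eq_of_eval_of_ne (D := (X (i + 1) - X i)
    * ((C q * X i - C p * X (i + 1)) * (C p * X i - C q * X (i + 1))))
  · intro h0
    have := congrArg (eval (fun j => if j = i then (1 : ℂ) else 0)) h0
    simp at this
    rcases this with h1 | h1
    · exact h.ne_zero h1
    · exact h.ne_zero' h1
  intro x hx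
  simp only [map_mul, map_sub, eval_X, eval_C] at hx
  have hx1 := left_ne_zero_of_mul hx
  have hx2 := right_ne_zero_of_mul hx
  simp only [map_add, eval_rename_perm]
  by_cases h1 : μ i = μ (i + 1)
  · have h2 := comp_sw_of_eq h1
    have e1 := psi_par (q := q) (p := p) hi h1 x
    have e2 := psi_par (q := p) (p := q) hi h1 x
    rw [h2]
    have : eval (x ∘ sw i) (gg q p n μ) = eval x (gg q p n μ) := by
      simp only [gg, map_mul, wtZ_eval_split hi, comp_sw_left, comp_sw_right, ← h1]
      rw [prod_erase_sw μ μ x (x ∘ sw i) (.inl rfl) (.inr rfl)]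
      apply mul_left_cancel₀ hx2
      generalize (∏ j ∈ ((Finset.range (2 * n + 1)).erase i).erase (i + 1),
        if μ j then 1 else x j) = W
      set s := eval (x ∘ sw i) (psi q p (2 * n + 1) μ)
      set s' := eval (x ∘ sw i) (psi p q (2 * n + 1) μ)
      set c := eval x (psi q p (2 * n + 1) μ)
      set c' := eval x (psi p q (2 * n + 1) μ)
      by_cases h3 : μ i
      · simp only [h3, if_true]
        linear_combination W * (p * x i - q * x (i + 1)) * s' * e1
          + W * (q * x (i + 1) - p * x i) * c * e2
      · simp only [h3]
        simp only [Bool.false_eq_true, if_false]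
        linear_combination x i * x (i + 1) * (W * (p * x i - q * x (i + 1)) * s' * e1
          + W * (q * x (i + 1) - p * x i) * c * e2)
    rw [this]
  · have : Desc (2 * n + 1) μ i ∨ Desc (2 * n + 1) (μ ∘ sw i) i := by
      unfold Desc
      rw [comp_sw_left, comp_sw_right]
      cases h3 : μ i <;> cases h4 : μ (i + 1) <;> simp_all
    rcases this with hd | hd
    · exact gg_pair_aux h hi hd x hx1
    · have := gg_pair_aux h hi hd x hx1
      rw [comp_sw_sw] at this
      linear_combination this

lemma GG_symm {q p : ℂ} (h : Om q p) {n k i : ℕ} (hk : k ≤ i) (hi : i + 1 < 2 * n + 1) :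
    rename (sw i) (GG q p n k) = GG q p n k := by
  classical
  let σ : Equiv.Perm (Fin (2 * n + 1)) := Equiv.swap ⟨i, by omega⟩ ⟨i + 1, hi⟩
  have hext : ∀ f : Cfg (2 * n + 1), extC (f ∘ σ) = extC f ∘ sw i := fun f =>
    ext_comp_swap f _ _
  have hcond : ∀ f : Cfg (2 * n + 1),
      (SecC (2 * n + 1) (n + 1) (f ∘ σ) ∧ ∀ j < k, extC (f ∘ σ) j = true)
      ↔ (SecC (2 * n + 1) (n + 1) f ∧ ∀ j < k, extC f j = true) := by
    intro f
    have h1 : SecC (2 * n + 1) (n + 1) (f ∘ σ) ↔ SecC (2 * n + 1) (n + 1) f := by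
      constructor
      · intro h1
        have := h1.perm σ
        have e : (f ∘ σ) ∘ σ = f := by funext a; simp [σ]
        rwa [e] at this
      · exact fun h1 => h1.perm σ
    rw [h1, hext]
    refine and_congr Iff.rfl (forall₂_congr fun j hj => ?_)
    rw [comp_sw_of_ne _ (by omega) (by omega)]
  let t : Cfg (2 * n + 1) → R := fun f =>
    if SecC (2 * n + 1) (n + 1) f ∧ ∀ j < k, extC f j = true then gg q p n (extC f) else 0
  have hbij : ∑ f, t (f ∘ σ) = ∑ f, t f := by
    apply Function.Bijective.sum_comp (e := fun f : Cfg (2 * n + 1) => f ∘ σ)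
    apply Function.Involutive.bijective
    intro f; funext a; simp [σ]
  have h2 : (2 : R) * GG q p n k = ∑ f, (t f + t (f ∘ σ)) := by
    rw [Finset.sum_add_distrib, hbij]
    change 2 * ∑ f, t f = _
    ring
  have h3 : rename (sw i) ((2 : R) * GG q p n k) = 2 * GG q p n k := by
    rw [h2, map_sum]
    apply Finset.sum_congr rfl
    intro f _
    by_cases hc : SecC (2 * n + 1) (n + 1) f ∧ ∀ j < k, extC f j = true
    · simp only [t, if_pos hc, if_pos ((hcond f).mpr hc), hext]
      exact gg_pair h hi _
    · simp only [t, if_neg hc, if_neg (fun h => hc ((hcond f).mp h))]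
      simp
  have h4 : (2 : R) ≠ 0 := two_ne_zero
  apply mul_left_cancel₀ h4
  rw [← h3, map_mul, map_ofNat]

lemma degreeOf_wtZ (N : ℕ) (μ : ℕ → Bool) (j : ℕ) :
    degreeOf j (wtZ N μ) ≤ if μ j then 0 else 1 := by
  unfold wtZ
  refine (degreeOf_prod_le _ _ _).trans ?_
  by_cases hj : j ∈ Finset.range N
  · rw [← Finset.add_sum_erase _ _ hj, Finset.sum_eq_zero, add_zero]
    · split_ifs
      · simp [degreeOf_one]
      · simp
    · intro a ha
      have := Finset.ne_of_mem_erase ha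
      split_ifs
      · simp [degreeOf_one]
      · simp [degreeOf_X, this.symm]
  · rw [Finset.sum_eq_zero]
    · exact Nat.zero_le _
    · intro a ha
      have : a ≠ j := fun h => hj (h ▸ ha)
      split_ifs
      · simp [degreeOf_one]
      · simp [degreeOf_X, this.symm]

lemma degreeOf_gg (q p : ℂ) {n : ℕ} (hn : 1 ≤ n) {μ : ℕ → Bool}
    (hS : Sec (2 * n + 1) (n + 1) μ) {j : ℕ} (hj : j < 2 * n + 1) :
    degreeOf j (gg q p n μ) ≤ 2 * n := by
  unfold gg
  have h1 := degreeOf_wtZ (2 * n + 1) μ j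
  have h2 := degreeOf_psi q p hS hj
  have h3 := degreeOf_psi p q hS hj
  refine (degreeOf_mul_le _ _ _).trans ((Nat.add_le_add_right (degreeOf_mul_le _ _ _) _).trans ?_)
  split_ifs at h1 h2 h3 <;> omega

lemma degreeOf_GG (q p : ℂ) {n : ℕ} (k : ℕ) (hn : 1 ≤ n) {j : ℕ} (hj : j < 2 * n + 1) :
    degreeOf j (GG q p n k) ≤ 2 * n := by
  classical
  unfold GG
  refine (degreeOf_sum_le _ _ _).trans (Finset.sup_le fun f _ => ?_)
  split_ifs with hc
  · exact degreeOf_gg q p hn (sec_ext.mpr hc.1) hj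
  · simp

end XXZ

namespace XXZ
open MvPolynomial

/-- Appends two spins to a configuration of length `N`. -/
def ap (N : ℕ) (a b : Bool) (ν : ℕ → Bool) : ℕ → Bool :=
  Function.update (Function.update ν N a) (N + 1) b

lemma ap_lt {N : ℕ} (a b : Bool) (ν : ℕ → Bool) {j : ℕ} (h : j < N) : ap N a b ν j = ν j := by
  rw [ap, Function.update_of_ne (by omega), Function.update_of_ne (by omega)]

lemma ap_left (N : ℕ) (a b : Bool) (ν : ℕ → Bool) : ap N a b ν N = a := by
  rw [ap, Function.update_of_ne (by omega), Function.update_self]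

lemma ap_right (N : ℕ) (a b : Bool) (ν : ℕ → Bool) : ap N a b ν (N + 1) = b := by
  rw [ap, Function.update_self]

lemma ap_gt {N : ℕ} (a b : Bool) (ν : ℕ → Bool) {j : ℕ} (h : N + 1 < j) : ap N a b ν j = ν j := by
  rw [ap, Function.update_of_ne (by omega), Function.update_of_ne (by omega)]

lemma ap_sw {N i : ℕ} (hi : i + 1 < N) (a b : Bool) (ν : ℕ → Bool) :
    ap N a b (ν ∘ sw i) = ap N a b ν ∘ sw i := by
  funext j
  by_cases h1 : j = i
  · subst h1
    rw [comp_sw_left, ap_lt _ _ _ (by omega), ap_lt _ _ _ hi, comp_sw_left]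
  by_cases h2 : j = i + 1
  · subst h2
    rw [comp_sw_right, ap_lt _ _ _ hi, ap_lt _ _ _ (by omega), comp_sw_right]
  rw [comp_sw_of_ne _ h1 h2]
  by_cases h3 : j < N
  · rw [ap_lt _ _ _ h3, ap_lt _ _ _ h3, comp_sw_of_ne _ h1 h2]
  by_cases h4 : j = N
  · subst h4; rw [ap_left, ap_left]
  by_cases h5 : j = N + 1
  · subst h5; rw [ap_right, ap_right]
  · rw [ap_gt _ _ _ (by omega), ap_gt _ _ _ (by omega), comp_sw_of_ne _ h1 h2]

lemma ap_sw_last (N : ℕ) (a b : Bool) (ν : ℕ → Bool) : ap N a b ν ∘ sw N = ap N b a ν := by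
  funext j
  by_cases h1 : j = N
  · subst h1; rw [comp_sw_left, ap_right, ap_left]
  by_cases h2 : j = N + 1
  · subst h2; rw [comp_sw_right, ap_right, ap_left]
  rw [comp_sw_of_ne _ h1 h2]
  by_cases h3 : j < N
  · rw [ap_lt _ _ _ h3, ap_lt _ _ _ h3]
  · rw [ap_gt _ _ _ (by omega), ap_gt _ _ _ (by omega)]

lemma sec_ap_iff {N c : ℕ} {a b : Bool} {ν : ℕ → Bool} :
    Sec (N + 2) c (ap N a b ν)
      ↔ ((Finset.range N).filter fun i => ν i = true).card + a.toNat + b.toNat = c := by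
  unfold Sec
  have e : (Finset.range N).filter (fun i => ap N a b ν i = true)
      = (Finset.range N).filter fun i => ν i = true := by
    apply Finset.filter_congr
    intro i hi
    rw [ap_lt _ _ _ (Finset.mem_range.mp hi)]
  rw [Finset.range_add_one, Finset.filter_insert, Finset.range_add_one, Finset.filter_insert, e,
    ap_left, ap_right]
  have n1 : N ∉ (Finset.range N).filter fun i => ν i = true := by simp
  have n2 : N + 1 ∉ (Finset.range N).filter fun i => ν i = true := by simp
  have n3 : N + 1 ∉ insert N ((Finset.range N).filter fun i => ν i = true) := by simp
  cases a <;> cases b <;>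
    simp [Finset.card_insert_of_notMem n1, Finset.card_insert_of_notMem n2,
      Finset.card_insert_of_notMem n3]

/-- The product of the linear factors produced by a fused pair at the last two sites. -/
lemma prod_range_sw {N i : ℕ} (hi : i + 1 < N) (c : ℂ → ℂ) (x : ℕ → ℂ) :
    ∏ j ∈ Finset.range N, c ((x ∘ sw i) j) = ∏ j ∈ Finset.range N, c (x j) := by
  apply Finset.prod_nbij' (sw i) (sw i)
  · intro j hj
    simp only [Finset.mem_range, sw, Equiv.swap_apply_def] at hj ⊢
    grind
  · intro j hj
    simp only [Finset.mem_range, sw, Equiv.swap_apply_def] at hj ⊢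
    grind
  · intro j _; simp [sw]
  · intro j _; simp [sw]
  · intro j _; rfl

lemma psi_fuse_base {q p : ℂ} (h : Om q p) {n : ℕ} {ν : ℕ → Bool}
    (hS : Sec (2 * n + 1) (n + 1) ν) (hd : ¬ ∃ i, Desc (2 * n + 1) ν i) {x : ℕ → ℂ}
    (hx : x (2 * n + 2) = p * x (2 * n + 1)) :
    eval x (psi q p (2 * n + 3) (ap (2 * n + 1) false true ν))
      = ((-p) ^ n * ∏ j ∈ Finset.range (2 * n + 1), (x (2 * n + 1) - p * x j))
        * eval x (psi q p (2 * n + 1) ν) := by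
  have hso : ∀ i, i < 2 * n + 1 → (ν i = true ↔ i < n + 1) := fun i hi =>
    sorted_of_no_desc hd hS hi
  set μ := ap (2 * n + 1) false true ν with hμ
  have hSμ : Sec (2 * (n + 1) + 1) (n + 1 + 1) μ := by
    rw [show 2 * (n + 1) + 1 = 2 * n + 1 + 2 by ring, hμ, sec_ap_iff]
    have : ((Finset.range (2 * n + 1)).filter fun i => ν i = true).card = n + 1 := hS
    rw [this]; rfl
  have hrot := psi_rot h (by omega : 1 ≤ n + 1) hSμ
  rw [show 2 * n + 3 = 2 * (n + 1) + 1 by ring, hrot, eval_rename]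
  have hnd : ¬ ∃ i, Desc (2 * (n + 1) + 1) (μ ∘ rho (2 * (n + 1))) i := by
    rintro ⟨i, h1, h2, h3⟩
    simp only [Function.comp] at h2 h3
    rw [rho_succ (by omega)] at h3
    rcases Nat.eq_zero_or_pos i with rfl | hi
    · rw [rho_zero, hμ, show 2 * (n + 1) = 2 * n + 1 + 1 by ring, ap_right] at h2
      simp at h2
    · obtain ⟨i, rfl⟩ : ∃ j, i = j + 1 := ⟨i - 1, by omega⟩
      rw [rho_succ (by omega)] at h2
      have hi2 : i + 1 < 2 * n + 1 := by
        by_contra hc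
        have : i + 1 = 2 * n + 1 := by omega
        rw [this, hμ, ap_left] at h3
        simp at h3
      rw [hμ, ap_lt _ _ _ (by omega)] at h2 h3
      have := (hso _ hi2).mp h3
      have := (hso i (by omega)).mpr (by omega)
      rw [this] at h2
      simp at h2
  rw [psi_of_not hnd, P0_eval_rho, psi_of_not hd, P0_eval]
  have hlast : μ (2 * (n + 1)) = true := by
    rw [hμ, show 2 * (n + 1) = 2 * n + 1 + 1 by ring, ap_right]
  have e1 := P0_eval_last (q := q) (p := p) μ x (2 * n + 1)
  rw [P0_eval] at e1
  rw [show 2 * (n + 1) = 2 * n + 1 + 1 by ring] at hlast ⊢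
  rw [e1, Finset.prod_range_succ _ (2 * n + 1), hlast]
  have hmid : μ (2 * n + 1) = false := by rw [hμ, ap_left]
  rw [hmid, if_neg (by simp), mul_one, mul_assoc, ← Finset.prod_mul_distrib, mul_comm]
  have e2 : ∏ e ∈ prs (2 * n + 1), (if μ e.1 = μ e.2 then q * x e.1 - p * x e.2 else 1)
      = ∏ e ∈ prs (2 * n + 1), (if ν e.1 = ν e.2 then q * x e.1 - p * x e.2 else 1) := by
    apply Finset.prod_congr rfl
    intro e he
    rw [mem_prs] at he
    rw [hμ, ap_lt _ _ _ (by omega), ap_lt _ _ _ (by omega)]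
  rw [e2]
  congr 1
  have e3 : ∀ a ∈ Finset.range (2 * n + 1),
      ((if μ a = false then q * x a - p * x (2 * n + 1) else 1)
        * (if μ a = true then q * x (2 * n + 1 + 1) - p * x a else 1))
      = (if ν a = false then -p else 1) * (x (2 * n + 1) - p * x a) := by
    intro a ha
    rw [hμ, ap_lt _ _ _ (Finset.mem_range.mp ha)]
    have hx' : x (2 * n + 1 + 1) = p * x (2 * n + 1) := hx
    cases ν a
    · simp; linear_combination (-x a) * h.sq'
    · simp only [if_true, Bool.true_eq_false, if_false, one_mul, hx']
      linear_combination x (2 * n + 1) * h.mul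
  rw [Finset.prod_congr rfl e3, Finset.prod_mul_distrib]
  congr 1
  rw [Finset.prod_ite, Finset.prod_const, Finset.prod_const_one, mul_one]
  congr 1
  have h4 := hS.compl
  simpa [show 2 * n + 1 - (n + 1) = n by omega] using h4

/-- The polynomial solution at a fused pair located at the last two sites. -/
lemma psi_fuse {q p : ℂ} (h : Om q p) {n : ℕ} {ν : ℕ → Bool}
    (hS : Sec (2 * n + 1) (n + 1) ν) {x : ℕ → ℂ}
    (hx : x (2 * n + 2) = p * x (2 * n + 1))
    (hinj : ∀ a b, a < 2 * n + 1 → b < 2 * n + 1 → a ≠ b → x a ≠ x b) :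
    eval x (psi q p (2 * n + 3) (ap (2 * n + 1) false true ν))
      = ((-p) ^ n * ∏ j ∈ Finset.range (2 * n + 1), (x (2 * n + 1) - p * x j))
        * eval x (psi q p (2 * n + 1) ν) := by
  induction hm : ms (2 * n + 1) ν using Nat.strong_induction_on generalizing ν x with
  | _ m ih =>
    by_cases hd : ∃ i, Desc (2 * n + 1) ν i
    swap
    · exact psi_fuse_base h hS hd hx
    obtain ⟨i, hi⟩ := hd
    have hi1 := hi.1
    have hm1 := ms_desc hi
    have hd2 : Desc (2 * n + 3) (ap (2 * n + 1) false true ν) i := by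
      refine ⟨by omega, ?_, ?_⟩
      · rw [ap_lt _ _ _ (by omega)]; exact hi.2.1
      · rw [ap_lt _ _ _ hi1]; exact hi.2.2
    have e1 := psi_exch (q := q) (p := p) hi x
    have e2 := psi_exch (q := q) (p := p) hd2 x
    rw [← ap_sw hi1] at e2
    have i1 := ih _ (by omega) (hS.sw hi1) hx hinj rfl
    have i2 := ih _ (by omega) (hS.sw hi1) (x := x ∘ sw i) (by
      rw [comp_sw_of_ne x (by omega) (by omega), comp_sw_of_ne x (by omega) (by omega)]
      exact hx) (by
      intro a b ha hb hab
      apply hinj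
      · simp only [sw, Equiv.swap_apply_def]; grind
      · simp only [sw, Equiv.swap_apply_def]; grind
      · exact fun hc => hab ((sw i).injective hc)) rfl
    rw [comp_sw_of_ne x (by omega) (by omega),
      prod_range_sw hi1 (fun y => x (2 * n + 1) - p * y)] at i2
    apply mul_left_cancel₀ (sub_ne_zero.mpr (hinj (i + 1) i hi1 (by omega) (by omega)))
    rw [e2, i1, i2]
    linear_combination -((-p) ^ n * ∏ j ∈ Finset.range (2 * n + 1), (x (2 * n + 1) - p * x j)) * e1

/-- The components only depend on the parameters attached to the sites. -/
lemma psi_eval_congr {q p : ℂ} {N : ℕ} (ν : ℕ → Bool) {x y : ℕ → ℂ}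
    (hinj : ∀ a b, a < N → b < N → a ≠ b → x a ≠ x b) (hxy : ∀ j, j < N → y j = x j) :
    eval y (psi q p N ν) = eval x (psi q p N ν) := by
  induction hm : ms N ν using Nat.strong_induction_on generalizing ν x y with
  | _ m ih =>
    by_cases hd : ∃ i, Desc N ν i
    swap
    · rw [psi_of_not hd, P0_eval, P0_eval]
      apply Finset.prod_congr rfl
      intro e he
      rw [mem_prs] at he
      rw [hxy _ (by omega), hxy _ (by omega)]
    obtain ⟨i, hi⟩ := hd
    have hi1 := hi.1
    have hm1 := ms_desc hi
    have e1 := psi_exch (q := q) (p := p) hi x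
    have e2 := psi_exch (q := q) (p := p) hi y
    have hlt : ∀ j, j < N → sw i j < N := by
      intro j hj
      simp only [sw, Equiv.swap_apply_def]; grind
    have e3 := ih _ (by omega) (ν ∘ sw i) hinj hxy rfl
    have e4 := ih _ (by omega) (ν ∘ sw i) (x := x ∘ sw i) (y := y ∘ sw i) (by
      intro a b ha hb hab
      exact hinj _ _ (hlt a ha) (hlt b hb) fun hc => hab ((sw i).injective hc)) (by
      intro j hj
      exact hxy _ (hlt j hj)) rfl
    rw [e3, e4, hxy i (by omega), hxy (i + 1) hi1] at e2
    apply mul_left_cancel₀ (sub_ne_zero.mpr (hinj (i + 1) i hi1 (by omega) (by omega)))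
    rw [e1, e2]

/-- Reading a sum over configurations of length `N + 1` off its last spin. -/
lemma sum_extC_succ {A : Type*} [AddCommMonoid A] (N : ℕ) (F : (ℕ → Bool) → A) :
    ∑ f : Cfg (N + 1), F (extC f) = ∑ f : Cfg N, ∑ b : Bool, F (Function.update (extC f) N b) := by
  rw [← (Fin.snocEquiv fun _ => Bool).sum_comp, Fintype.sum_prod_type, Finset.sum_comm]
  refine Finset.sum_congr rfl fun f _ => Finset.sum_congr rfl fun b _ => ?_
  congr 1
  funext j
  simp only [extC, Fin.snocEquiv, Equiv.coe_fn_mk, Function.update_apply]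
  by_cases h1 : j = N
  · subst h1
    rw [dif_pos (by omega), if_pos rfl]
    exact Fin.snoc_last (α := fun _ => Bool) b f
  · rw [if_neg h1]
    by_cases h2 : j < N
    · rw [dif_pos (by omega), dif_pos h2]
      exact Fin.snoc_castSucc (α := fun _ => Bool) b f ⟨j, h2⟩
    · rw [dif_neg (by omega), dif_neg h2]

lemma sum_extC_ap {A : Type*} [AddCommMonoid A] (N : ℕ) (F : (ℕ → Bool) → A) :
    ∑ f : Cfg (N + 2), F (extC f)
      = ∑ f : Cfg N, ∑ a : Bool, ∑ b : Bool, F (ap N a b (extC f)) := by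
  rw [sum_extC_succ (N + 1) F]
  exact sum_extC_succ N fun μ => ∑ b : Bool, F (Function.update μ (N + 1) b)

open Classical in
lemma GG_eq (q p : ℂ) (n k : ℕ) : GG q p n k = ∑ f : Cfg (2 * n + 1),
    if Sec (2 * n + 1) (n + 1) (extC f) ∧ ∀ j < k, extC f j = true then gg q p n (extC f)
      else 0 := by
  unfold GG
  simp only [sec_ext]

lemma gg_fuse {q p : ℂ} (h : Om q p) {n : ℕ} {ν : ℕ → Bool}
    (hS : Sec (2 * n + 1) (n + 1) ν) {x : ℕ → ℂ}
    (hx : x (2 * n + 2) = p * x (2 * n + 1)) (h0 : x (2 * n + 1) ≠ 0)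
    (hinj : ∀ a b, a < 2 * n + 1 → b < 2 * n + 1 → a ≠ b → x a ≠ x b) :
    eval x (gg q p (n + 1) (ap (2 * n + 1) false true ν))
      + eval x (gg q p (n + 1) (ap (2 * n + 1) true false ν))
      = (1 - p) / (q - p) * x (2 * n + 1) * p ^ (2 * n + 1)
        * (∏ j ∈ Finset.range (2 * n + 1), (x (2 * n + 1) - p * x j)) ^ 2
        * eval x (gg q p n ν) := by
  have hqp : q - p ≠ 0 := sub_ne_zero.mpr h.ne
  rw [← ap_sw_last _ false true]
  set μ := ap (2 * n + 1) false true ν with hμ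
  have hd : Desc (2 * (n + 1) + 1) μ (2 * n + 1) :=
    ⟨by omega, ap_left _ _ _ _, ap_right _ _ _ _⟩
  have hx' : x (2 * n + 1 + 1) = p * x (2 * n + 1) := hx
  have f1 := psi_fuse h hS hx hinj
  have hsw : ∀ j, j < 2 * n + 1 → (x ∘ sw (2 * n + 1)) j = x j := fun j hj =>
    comp_sw_of_ne x (by omega) (by omega)
  have s1 := comp_sw_left (2 * n + 1) x
  have s2 := comp_sw_right (2 * n + 1) x
  have f2 := psi_fuse h.symm hS (x := x ∘ sw (2 * n + 1)) (by
      rw [s1]; refine s2.trans ?_; rw [hx']; linear_combination (-x (2 * n + 1)) * h.mul) (by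
      intro a b ha hb hab
      rw [hsw a ha, hsw b hb]
      exact hinj a b ha hb hab)
  rw [← hμ] at f1 f2
  have e1 := psi_exch_wheel h hd hx' h0
  have e2 := psi_exch (q := p) (p := q) hd x
  have e3 := psi_exch (q := p) (p := q) hd (x ∘ sw (2 * n + 1))
  rw [s1, s2, comp_sw_sw] at e3
  rw [hx'] at e2 e3
  have hloc : eval (x ∘ sw (2 * n + 1)) (psi p q (2 * n + 1) ν)
      = eval x (psi p q (2 * n + 1) ν) := by
    have := psi_eval_congr (q := p) (p := q) (N := 2 * n + 1) ν hinj hsw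
    exact this
  have hprod : ∏ j ∈ Finset.range (2 * n + 1), ((x ∘ sw (2 * n + 1)) (2 * n + 1)
        - q * (x ∘ sw (2 * n + 1)) j)
      = p ^ (2 * n + 1) * ∏ j ∈ Finset.range (2 * n + 1), (x (2 * n + 1) - p * x j) := by
    conv_rhs => rw [← Finset.card_range (2 * n + 1), ← Finset.prod_const,
      Finset.card_range, ← Finset.prod_mul_distrib]
    apply Finset.prod_congr rfl
    intro j hj
    rw [s1, hx', hsw j (Finset.mem_range.mp hj)]
    linear_combination x j * h.sq'
  rw [hprod, hloc] at f2
  have hw : ∀ a b, eval x (wtZ (2 * (n + 1) + 1) (ap (2 * n + 1) a b ν))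
      = (if a then 1 else x (2 * n + 1)) * (if b then 1 else x (2 * n + 2))
        * eval x (wtZ (2 * n + 1) ν) := by
    intro a b
    rw [wtZ_eval, wtZ_eval, show 2 * (n + 1) + 1 = 2 * n + 1 + 1 + 1 by ring,
      Finset.prod_range_succ, Finset.prod_range_succ, ap_left, ap_right]
    rw [Finset.prod_congr rfl fun j hj => by rw [ap_lt _ _ _ (Finset.mem_range.mp hj)]]
    ring
  have w1 := hw false true
  have w2 := hw true false
  rw [← hμ] at w1
  rw [← ap_sw_last _ false true, ← hμ] at w2
  simp only [Bool.false_eq_true, if_true, if_false, hx] at w1 w2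
  simp only [gg, map_mul, w1, w2]
  rw [show 2 * n + 3 = 2 * (n + 1) + 1 by ring] at f1 f2
  set P := ∏ j ∈ Finset.range (2 * n + 1), (x (2 * n + 1) - p * x j)
  set t := x (2 * n + 1)
  set D := eval x (psi q p (2 * (n + 1) + 1) μ)
  set D' := eval x (psi p q (2 * (n + 1) + 1) μ)
  set Ds' := eval (x ∘ sw (2 * n + 1)) (psi p q (2 * (n + 1) + 1) μ)
  set U := eval x (psi q p (2 * (n + 1) + 1) (μ ∘ sw (2 * n + 1)))
  set U' := eval x (psi p q (2 * (n + 1) + 1) (μ ∘ sw (2 * n + 1)))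
  set Us' := eval (x ∘ sw (2 * n + 1)) (psi p q (2 * (n + 1) + 1) (μ ∘ sw (2 * n + 1)))
  have hU : U = -p * D := by linear_combination p * e1 - U * h.mul
  have g3 : (q - p) * Us' = (1 - p) * Ds' := by
    apply mul_left_cancel₀ h0
    linear_combination -e3 - U' * t * h.sq'
  have g2 : D' - q * U' = Us' := by
    have hp1 : (p - 1) * t ≠ 0 := mul_ne_zero (sub_ne_zero.mpr h.ne_one') h0
    apply mul_left_cancel₀ hp1
    linear_combination e2 - U' * t * h.sq' - Us' * t * h.mul
  have hpq : (-p) ^ n * (-q) ^ n = 1 := by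
    rw [← mul_pow, show -p * -q = 1 by linear_combination h.mul, one_pow]
  have main : (q - p) * (t * D * D' + p * t * U * U') = (1 - p) * t * D * Ds' := by
    rw [hU]
    linear_combination t * D * g3 + (q - p) * t * D * g2 - (q - p) * t * D * U' * h.sq'
  have : t * D * D' + p * t * U * U' = (1 - p) / (q - p) * (t * D * Ds') := by
    rw [div_mul_eq_mul_div, eq_div_iff hqp]
    linear_combination main
  have e5 : eval x (wtZ (2 * n + 1) ν) * (t * D * D' + p * t * U * U')
      = eval x (wtZ (2 * n + 1) ν) * ((1 - p) / (q - p) * (t * D * Ds')) := by rw [this]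
  rw [f1, f2] at e5
  rw [f1]
  linear_combination e5 + ((1 - p) / (q - p) * t * p ^ (2 * n + 1) * P ^ 2 *
    (eval x (wtZ (2 * n + 1) ν) * eval x (psi q p (2 * n + 1) ν)
      * eval x (psi p q (2 * n + 1) ν))) * hpq

end XXZ

namespace XXZ
open MvPolynomial

/-- The emptiness formation sum at a fused pair located at the last two sites. -/
lemma GG_fuse {q p : ℂ} (h : Om q p) {n k : ℕ} (hk : k ≤ 2 * n + 1) {x : ℕ → ℂ}
    (hx : x (2 * n + 2) = p * x (2 * n + 1)) (h0 : x (2 * n + 1) ≠ 0)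
    (hinj : ∀ a b, a < 2 * n + 1 → b < 2 * n + 1 → a ≠ b → x a ≠ x b) :
    eval x (GG q p (n + 1) k)
      = (1 - p) / (q - p) * x (2 * n + 1) * p ^ (2 * n + 1)
        * (∏ j ∈ Finset.range (2 * n + 1), (x (2 * n + 1) - p * x j)) ^ 2
        * eval x (GG q p n k) := by
  classical
  rw [GG_eq, GG_eq]
  have := sum_extC_ap (2 * n + 1) fun μ => if Sec (2 * n + 1 + 2) (n + 1 + 1) μ ∧
    ∀ j < k, μ j = true then gg q p (n + 1) μ else 0
  refine (congrArg (eval x) this).trans ?_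
  rw [map_sum, map_sum, Finset.mul_sum]
  refine Finset.sum_congr rfl fun f _ => ?_
  simp only [Fintype.sum_bool, map_add]
  have hkk : ∀ a b, (∀ j < k, ap (2 * n + 1) a b (extC f) j = true) ↔ ∀ j < k, extC f j = true := by
    intro a b
    refine forall₂_congr fun j hj => ?_
    rw [ap_lt _ _ _ (by omega)]
  have hsame : ∀ a, eval x (if Sec (2 * n + 1 + 2) (n + 1 + 1) (ap (2 * n + 1) a a (extC f)) ∧
      ∀ j < k, ap (2 * n + 1) a a (extC f) j = true
      then gg q p (n + 1) (ap (2 * n + 1) a a (extC f)) else 0) = 0 := by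
    intro a
    split_ifs
    · rw [gg, map_mul, map_mul, psi_par_wheel h (i := 2 * n + 1) (by omega) _ hx h0]
      · simp
      · rw [ap_left, ap_right]
    · simp
  rw [hsame, hsame]
  simp only [sec_ap_iff, hkk]
  by_cases hc : Sec (2 * n + 1) (n + 1) (extC f) ∧ ∀ j < k, extC f j = true
  · have hc1 : ((Finset.range (2 * n + 1)).filter fun i => extC f i = true).card = n + 1 := hc.1
    rw [if_pos hc, if_pos ⟨by rw [hc1]; rfl, hc.2⟩, if_pos ⟨by rw [hc1]; rfl, hc.2⟩,
      ← gg_fuse h hc.1 hx h0 hinj]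
    ring
  · rw [if_neg hc, if_neg, if_neg]
    · simp
    · rintro ⟨h1, h2⟩
      refine hc ⟨?_, h2⟩
      simp only [Bool.toNat_true, Bool.toNat_false] at h1
      unfold Sec; omega
    · rintro ⟨h1, h2⟩
      refine hc ⟨?_, h2⟩
      simp only [Bool.toNat_true, Bool.toNat_false] at h1
      unfold Sec; omega

/-- The norm form `a² + ab + b²`. -/
def qd (a b : ℂ) : ℂ := a ^ 2 + a * b + b ^ 2

lemma Om.qd {q p : ℂ} (h : Om q p) (a b : ℂ) : (q * a - p * b) * (p * a - q * b) = qd a b := by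
  unfold XXZ.qd
  linear_combination (a ^ 2 + b ^ 2) * h.mul - a * b * (h.sq + h.sq' + h.sum)

lemma sec_full {n : ℕ} {μ : ℕ → Bool} (hS : Sec (2 * n + 1) (n + 1) μ)
    (hk : ∀ j < n + 1, μ j = true) {j : ℕ} (hj : j < 2 * n + 1) : μ j = true ↔ j < n + 1 := by
  have hsub : Finset.range (n + 1) ⊆ (Finset.range (2 * n + 1)).filter fun i => μ i = true := by
    intro i hi
    rw [Finset.mem_range] at hi
    exact Finset.mem_filter.mpr ⟨Finset.mem_range.mpr (by omega), hk i hi⟩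
  have := Finset.eq_of_subset_of_card_le hsub (by
    have h1 : _ = _ := hS
    rw [h1, Finset.card_range])
  constructor
  · intro h1
    have : j ∈ Finset.range (n + 1) := by
      rw [this]; exact Finset.mem_filter.mpr ⟨Finset.mem_range.mpr hj, h1⟩
    exact Finset.mem_range.mp this
  · exact hk j

lemma sec_almost_full {n : ℕ} {μ : ℕ → Bool} (hS : Sec (2 * n + 1) (n + 1) μ)
    (hk : ∀ j < n, μ j = true) (hl : μ (2 * n) = true) {j : ℕ} (hj : j < 2 * n + 1) :
    μ j = true ↔ j < n ∨ j = 2 * n := by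
  by_cases hn : n = 0
  · subst hn; obtain rfl : j = 0 := by omega
    simpa using hl
  have hsub : insert (2 * n) (Finset.range n)
      ⊆ (Finset.range (2 * n + 1)).filter fun i => μ i = true := by
    intro i hi
    rw [Finset.mem_insert, Finset.mem_range] at hi
    refine Finset.mem_filter.mpr ⟨Finset.mem_range.mpr (by omega), ?_⟩
    rcases hi with rfl | hi
    · exact hl
    · exact hk i hi
  have := Finset.eq_of_subset_of_card_le hsub (by
    have h1 : _ = _ := hS
    rw [h1, Finset.card_insert_of_notMem (by simp; omega), Finset.card_range])
  constructor
  · intro h1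
    have : j ∈ insert (2 * n) (Finset.range n) := by
      rw [this]; exact Finset.mem_filter.mpr ⟨Finset.mem_range.mpr hj, h1⟩
    rw [Finset.mem_insert, Finset.mem_range] at this
    omega
  · rintro (h1 | rfl)
    · exact hk j h1
    · exact hl

lemma extC_mk {N : ℕ} (P : ℕ → Prop) [DecidablePred P] {j : ℕ} (hj : j < N) :
    extC (fun i : Fin N => decide (P i.val)) j = decide (P j) := by
  unfold extC; rw [dif_pos hj]

lemma extC_inj {N : ℕ} {f g : Cfg N} (h : ∀ j < N, extC f j = extC g j) : f = g := by
  funext i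
  rw [← ext_apply f, ← ext_apply g]
  exact h _ i.isLt

/-- The maximal emptiness formation sum. -/
lemma GG_top {q p : ℂ} (h : Om q p) (n : ℕ) (x : ℕ → ℂ) :
    eval x (GG q p n (n + 1)) = (∏ j ∈ Finset.range (2 * n + 1), if j < n + 1 then 1 else x j)
      * ∏ e ∈ prs (2 * n + 1), if (e.1 < n + 1 ↔ e.2 < n + 1) then qd (x e.1) (x e.2) else 1 := by
  classical
  rw [GG_eq, map_sum]
  have hb : ∀ j < 2 * n + 1, extC (fBase (2 * n + 1) (n + 1)) j = decide (j < n + 1) :=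
    fun j hj => extC_mk (fun i => i < n + 1) hj
  rw [Finset.sum_eq_single (fBase (2 * n + 1) (n + 1))]
  · rw [if_pos ⟨sec_ext.mpr (fBase_sec (by omega)), fun j hj => by
      rw [hb j (by omega)]; simpa using hj⟩]
    have hnd : ¬ ∃ i, Desc (2 * n + 1) (extC (fBase (2 * n + 1) (n + 1))) i := by
      rintro ⟨i, h1, h2, h3⟩
      rw [hb _ (by omega)] at h2 h3
      have := of_decide_eq_true h3
      have := of_decide_eq_false h2
      omega
    rw [gg, map_mul, map_mul, psi_of_not hnd, psi_of_not hnd, P0_eval, P0_eval, mul_assoc,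
      ← Finset.prod_mul_distrib, wtZ_eval]
    congr 1
    · refine Finset.prod_congr rfl fun j hj => ?_
      rw [hb j (Finset.mem_range.mp hj)]; simp
    · refine Finset.prod_congr rfl fun e he => ?_
      rw [mem_prs] at he
      rw [hb _ (by omega), hb _ (by omega)]
      simp only [decide_eq_decide]
      split_ifs
      · exact h.qd _ _
      · ring
  · intro f _ hf
    rw [if_neg, map_zero]
    rintro ⟨h1, h2⟩
    apply hf
    apply extC_inj
    intro j hj
    rw [hb j hj, Bool.eq_iff_iff, sec_full h1 h2 hj]; simp
  · simp

/-- The next to maximal emptiness formation sum when the last parameter vanishes. -/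
lemma GG_zero {q p : ℂ} (h : Om q p) {n : ℕ} (hn : 1 ≤ n) {x : ℕ → ℂ} (hx : x (2 * n) = 0) :
    eval x (GG q p n n) = (∏ j ∈ Finset.range (2 * n), if j < n then (x j) ^ 2 else x j)
      * ∏ e ∈ prs (2 * n), if (e.1 < n ↔ e.2 < n) then qd (x e.1) (x e.2) else 1 := by
  classical
  rw [GG_eq, map_sum]
  let f0 : Cfg (2 * n + 1) := fun i => decide (i.val < n ∨ i.val = 2 * n)
  have hb : ∀ j < 2 * n + 1, extC f0 j = decide (j < n ∨ j = 2 * n) :=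
    fun j hj => extC_mk (fun i => i < n ∨ i = 2 * n) hj
  have hS0 : Sec (2 * n + 1) (n + 1) (extC f0) := by
    unfold Sec
    have : (Finset.range (2 * n + 1)).filter (fun i => extC f0 i = true)
        = insert (2 * n) (Finset.range n) := by
      ext j
      rw [Finset.mem_filter, Finset.mem_insert, Finset.mem_range, Finset.mem_range]
      constructor
      · rintro ⟨h1, h2⟩
        rw [hb j h1] at h2
        have := of_decide_eq_true h2
        omega
      · intro h1
        refine ⟨by omega, ?_⟩
        rw [hb j (by omega)]
        exact decide_eq_true (by omega)
    rw [this, Finset.card_insert_of_notMem (by simp; omega), Finset.card_range]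
  rw [Finset.sum_eq_single f0]
  · rw [if_pos ⟨hS0, fun j hj => by rw [hb j (by omega)]; simp [hj]⟩]
    have hnd : ¬ ∃ i, Desc (2 * n + 1) (extC f0 ∘ rho (2 * n)) i := by
      rintro ⟨i, h1, h2, h3⟩
      simp only [Function.comp] at h2 h3
      rw [rho_succ (by omega), hb _ (by omega)] at h3
      have h3' := of_decide_eq_true h3
      rcases Nat.eq_zero_or_pos i with rfl | hi
      · rw [rho_zero, hb _ (by omega)] at h2
        simp at h2
      · obtain ⟨i, rfl⟩ : ∃ j, i = j + 1 := ⟨i - 1, by omega⟩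
        rw [rho_succ (by omega), hb _ (by omega)] at h2
        have := of_decide_eq_false h2
        omega
    rw [gg, map_mul, map_mul, psi_rot h hn hS0, psi_rot h.symm hn hS0, eval_rename, eval_rename,
      psi_of_not hnd, psi_of_not hnd, P0_eval_rho, P0_eval_rho, wtZ_eval,
      Finset.prod_range_succ, hx]
    have e1 : ∀ q p : ℂ, ∏ a ∈ Finset.range (2 * n),
        (if extC f0 a = extC f0 (2 * n) then q * 0 - p * x a else 1)
        = ∏ a ∈ Finset.range (2 * n), if a < n then -p * x a else 1 := by
      intro q p
      refine Finset.prod_congr rfl fun a ha => ?_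
      rw [Finset.mem_range] at ha
      rw [hb a (by omega), hb (2 * n) (by omega)]
      by_cases h1 : a < n
      · simp [h1]
      · rw [if_neg h1, if_neg]
        simp; omega
    have e2 : ∀ q p : ℂ, ∏ e ∈ prs (2 * n),
        (if extC f0 e.1 = extC f0 e.2 then q * x e.1 - p * x e.2 else 1)
        = ∏ e ∈ prs (2 * n), if (e.1 < n ↔ e.2 < n) then q * x e.1 - p * x e.2 else 1 := by
      intro q p
      refine Finset.prod_congr rfl fun e he => ?_
      rw [mem_prs] at he
      refine if_congr ?_ rfl rfl
      rw [hb _ (by omega), hb _ (by omega), decide_eq_decide]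
      omega
    have e3 : ∏ a ∈ Finset.range (2 * n), (if extC f0 a = true then 1 else x a)
        = ∏ a ∈ Finset.range (2 * n), if a < n then 1 else x a := by
      refine Finset.prod_congr rfl fun a ha => ?_
      rw [Finset.mem_range] at ha
      rw [hb a (by omega)]
      refine if_congr ?_ rfl rfl
      rw [decide_eq_true_eq]; omega
    have e4 : extC f0 (2 * n) = true := by rw [hb _ (by omega)]; simp
    rw [e1, e1, e2, e2, e3, if_pos e4, mul_one]
    have e5 : ∏ e ∈ prs (2 * n), (if (e.1 < n ↔ e.2 < n) then qd (x e.1) (x e.2) else 1)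
        = (∏ e ∈ prs (2 * n), if (e.1 < n ↔ e.2 < n) then q * x e.1 - p * x e.2 else 1)
        * ∏ e ∈ prs (2 * n), if (e.1 < n ↔ e.2 < n) then p * x e.1 - q * x e.2 else 1 := by
      rw [← Finset.prod_mul_distrib]
      refine Finset.prod_congr rfl fun e he => ?_
      split_ifs
      · exact (h.qd _ _).symm
      · ring
    have e6 : ∏ j ∈ Finset.range (2 * n), (if j < n then (x j) ^ 2 else x j)
        = (∏ a ∈ Finset.range (2 * n), if a < n then 1 else x a)
          * ((∏ a ∈ Finset.range (2 * n), if a < n then -p * x a else 1)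
          * ∏ a ∈ Finset.range (2 * n), if a < n then -q * x a else 1) := by
      rw [← Finset.prod_mul_distrib, ← Finset.prod_mul_distrib]
      refine Finset.prod_congr rfl fun a _ => ?_
      split_ifs
      · linear_combination -(x a ^ 2) * h.mul
      · ring
    rw [e5, e6]
    ring
  · intro f _ hf
    split_ifs with hc
    · have hl : extC f (2 * n) ≠ true := by
        intro hl
        apply hf
        apply extC_inj
        intro j hj
        rw [hb j hj, Bool.eq_iff_iff, sec_almost_full hc.1 hc.2 hl hj]; simp
      rw [gg, map_mul, map_mul, wtZ_eval, Finset.prod_range_succ, if_neg hl, hx]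
      ring
    · simp
  · simp

end XXZ

namespace XXZ

section Tri

variable {S : Type*} [CommRing S]

open Polynomial in
/-- The part of `P` of degrees congruent to `1` modulo `3`, divided by the variable. -/
def tri (P : Polynomial S) : Polynomial S := expand S 3 (contract 3 (divX P))

open Polynomial

lemma coeff_tri (P : S[X]) (i : ℕ) : (tri P).coeff i = if 3 ∣ i then P.coeff (i + 1) else 0 := by
  rw [tri, coeff_expand (by norm_num)]
  split_ifs with h
  · obtain ⟨j, rfl⟩ := h
    rw [coeff_contract (by norm_num), coeff_divX]
    congr 2
    omega
  · rfl

lemma tri_add (P Q : S[X]) : tri (P + Q) = tri P + tri Q := by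
  ext i; simp only [coeff_tri, coeff_add]; split_ifs <;> simp

lemma tri_sub (P Q : S[X]) : tri (P - Q) = tri P - tri Q := by
  ext i; simp only [coeff_tri, coeff_sub]; split_ifs <;> simp

lemma tri_C_mul (a : S) (P : S[X]) : tri (C a * P) = C a * tri P := by
  ext i; simp only [coeff_tri, coeff_C_mul]; split_ifs <;> simp

lemma tri_X_cube_mul (P : S[X]) : tri (X ^ 3 * P) = X ^ 3 * tri P := by
  ext i
  simp only [coeff_tri, coeff_X_pow_mul']
  by_cases h3 : 3 ≤ i
  · rw [if_pos h3, if_pos (by omega : 3 ≤ i + 1), show i + 1 - 3 = i - 3 + 1 by omega]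
    refine if_congr ?_ rfl rfl
    omega
  · rw [if_neg h3]
    split_ifs with h1 h2
    · exfalso; omega
    · rfl
    · rfl

lemma tri_cube_sub_mul (a : S) (P : S[X]) : tri ((X ^ 3 - C a) * P) = (X ^ 3 - C a) * tri P := by
  rw [sub_mul, tri_sub, tri_X_cube_mul, tri_C_mul, sub_mul]

lemma tri_monomial (i : ℕ) (a : S) :
    tri (monomial i a) = if i % 3 = 1 then monomial (i - 1) a else 0 := by
  ext j
  rw [coeff_tri, coeff_monomial]
  split_ifs with h1 h2 h3 h4 h5
  · rw [coeff_monomial, if_pos (by omega)]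
  · omega
  · rw [coeff_monomial, if_neg (by omega)]
  · simp
  · rw [coeff_monomial, if_neg (by omega)]
  · simp

lemma eval_tri_zero (P : S[X]) : (tri P).eval 0 = P.coeff 1 := by
  rw [← coeff_zero_eq_eval_zero, coeff_tri]; simp

lemma map_tri {S' : Type*} [CommRing S'] (φ : S →+* S') (P : S[X]) :
    (tri P).map φ = tri (P.map φ) := by
  ext i; simp only [coeff_tri, coeff_map]; split_ifs <;> simp

/-- The columns of the determinant. -/
def colE (n : ℕ) (P : S[X]) (c : ℕ) : S[X] := if c < n then X ^ (3 * c + 1) else tri (X ^ (c - n) * P)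

/-- The matrix representing the emptiness formation sum. -/
def Emat (n m : ℕ) (P : S[X]) (z : ℕ → S) : Matrix (Fin (n + m)) (Fin (n + m)) S :=
  Matrix.of fun r c => (colE n P c).eval (z r)

end Tri

open Polynomial

lemma eval_tri {q p : ℂ} (h : Om q p) (P : ℂ[X]) (x : ℂ) :
    3 * x * (tri P).eval x = P.eval x + p * P.eval (q * x) + q * P.eval (p * x) := by
  induction P using Polynomial.induction_on' with
  | add P Q hP hQ => rw [tri_add]; simp only [eval_add]; linear_combination hP + hQ
  | monomial i a =>
    rw [tri_monomial]
    simp only [eval_monomial, mul_pow]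
    obtain ⟨j, hj⟩ : ∃ j, i = 3 * j + i % 3 := ⟨i / 3, by omega⟩
    have hq : q ^ (3 * j) = 1 := by rw [pow_mul, h.cube, one_pow]
    have hp : p ^ (3 * j) = 1 := by rw [pow_mul, h.cube', one_pow]
    have h3 : i % 3 < 3 := Nat.mod_lt _ (by norm_num)
    have hqi : q ^ i = q ^ (i % 3) := by
      conv_lhs => rw [hj]
      rw [pow_add, hq, one_mul]
    have hpi : p ^ i = p ^ (i % 3) := by
      conv_lhs => rw [hj]
      rw [pow_add, hp, one_mul]
    rw [hqi, hpi]
    generalize hr : i % 3 = r at *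
    interval_cases r
    · rw [if_neg (by omega)]; simp; linear_combination -(a * x ^ i) * h.sum
    · rw [if_pos rfl, eval_monomial]
      have : x ^ i = x ^ (i - 1) * x := by rw [← pow_succ]; congr 1; omega
      rw [this]; linear_combination (-2 * a * x ^ (i - 1) * x) * h.mul
    · rw [if_neg (by omega)]; simp
      linear_combination -(a * x ^ i) * (h.sum + (q + p) * h.mul)

/-- Recursion of the determinant at a fused pair of parameters. -/
lemma det_Emat_fuse {q p : ℂ} (h : Om q p) (n m : ℕ) {t : ℂ} (ht : t ≠ 0) (P : ℂ[X]) (z : ℕ → ℂ)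
    (h0 : z 0 = p * t) (h1 : z 1 = t) :
    (Emat (n + 1) (m + 1) ((X - C (p * t)) * (X - C t) * P) z).det
      = (-1) ^ n * ((p - 1) * p / 3)
        * (((X - C (p * t)) * (X - C t) * P).eval (q * t))
        * (∏ r ∈ Finset.range (n + m), (z (r + 2) ^ 3 - t ^ 3))
        * (Emat n m P fun r => z (r + 2)).det := by
  set Q := (X - C (p * t)) * (X - C t) * P with hQ
  set ρ := p * Q.eval (q * t) / (3 * t) with hρ
  have hQ1 : Q.eval t = 0 := by simp [hQ]
  have hQ2 : Q.eval (p * t) = 0 := by simp [hQ]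
  have hφ : ∀ s, (tri (X ^ s * Q)).eval t = (q * t) ^ s * ρ := by
    intro s
    have e := eval_tri h (X ^ s * Q) t
    simp only [eval_mul, eval_pow, eval_X, hQ1, hQ2] at e
    have ht3 : 3 * t ≠ 0 := mul_ne_zero three_ne_zero ht
    apply mul_left_cancel₀ ht3
    rw [e, hρ]; field_simp; ring
  have hφ' : ∀ s, (tri (X ^ s * Q)).eval (p * t) = (q * t) ^ s * ρ := by
    intro s
    have e := eval_tri h (X ^ s * Q) (p * t)
    have e1 : q * (p * t) = t := by linear_combination t * h.mul
    have e2 : p * (p * t) = q * t := by linear_combination t * h.sq'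
    simp only [eval_mul, eval_pow, eval_X, hQ1, hQ2, e1, e2] at e
    have ht3 : 3 * (p * t) ≠ 0 := mul_ne_zero three_ne_zero (mul_ne_zero h.ne_zero' ht)
    apply mul_left_cancel₀ ht3
    rw [e, hρ]
    generalize Q.eval (q * t) = V
    have e3 : 3 * (p * t) * ((q * t) ^ s * (p * V / (3 * t))) = p ^ 2 * ((q * t) ^ s * V) := by
      field_simp
    rw [e3, h.sq']; ring
  have hcube : (X - C (q * t)) * Q = (X ^ 3 - C (t ^ 3)) * P := by
    have : (X - C (q * t)) * ((X - C (p * t)) * (X - C t)) = (X ^ 3 - C (t ^ 3) : ℂ[X]) := by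
      have e1 : (C q + C p : ℂ[X]) = -1 := by rw [← C_add, h.sum]; simp
      have e2 : (C q * C p : ℂ[X]) = 1 := by rw [← C_mul, h.mul]; simp
      simp only [C_mul, C_pow]
      linear_combination (-(X ^ 2) * C t + X * C t ^ 2) * e1 + (X * C t ^ 2 - C t ^ 3) * e2
    rw [hQ, ← this]; ring
  let coef : Fin (n + 1 + m) → ℂ := fun j =>
    if j.val < n then t ^ 3 else if j.val = n then 0 else q * t
  let A : Matrix (Fin (n + 1 + m + 1)) (Fin (n + 1 + m + 1)) ℂ := Emat (n + 1) (m + 1) Q z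
  let B : Matrix (Fin (n + 1 + m + 1)) (Fin (n + 1 + m + 1)) ℂ := Matrix.of fun r c =>
    if c.val = 0 then z r else if c.val < n + 1 then (z r ^ 3 - t ^ 3) * z r ^ (3 * (c.val - 1) + 1)
    else if c.val = n + 1 then (tri Q).eval (z r)
    else (z r ^ 3 - t ^ 3) * (tri (X ^ (c.val - (n + 2)) * P)).eval (z r)
  have hAB : A.det = B.det := by
    refine Matrix.det_eq_of_forall_col_eq_smul_add_pred coef ?_ ?_
    · intro i
      simp [A, B, Emat, colE]
    · intro i j
      simp only [A, B, Emat, colE, coef, Matrix.of_apply, Fin.val_succ, Fin.val_castSucc]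
      by_cases hj1 : j.val < n
      · rw [if_pos (by omega), if_neg (by omega), if_pos (by omega), if_pos hj1, if_pos (by omega)]
        simp only [eval_pow, eval_X, Nat.add_sub_cancel]
        ring
      by_cases hj2 : j.val = n
      · rw [if_neg (by omega), if_neg (by omega), if_neg (by omega), if_pos (by omega),
          if_neg hj1, if_pos hj2, show j.val + 1 - (n + 1) = 0 by omega]
        simp
      · rw [if_neg (by omega), if_neg (by omega), if_neg (by omega), if_neg (by omega),
          if_neg hj1, if_neg hj2, if_neg (by omega)]
        obtain ⟨s, hs⟩ : ∃ s, j.val = n + 1 + s := ⟨j.val - (n + 1), by omega⟩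
        rw [hs, show n + 1 + s + 1 - (n + 1) = s + 1 by omega,
          show n + 1 + s + 1 - (n + 2) = s by omega, show n + 1 + s - (n + 1) = s by omega]
        have e1 : X ^ (s + 1) * Q = (X ^ 3 - C (t ^ 3)) * (X ^ s * P)
            + C (q * t) * (X ^ s * Q) := by
          linear_combination X ^ s * hcube
        rw [e1, tri_add, tri_cube_sub_mul, tri_C_mul]
        simp
  let B' : Matrix (Fin (n + 1 + m + 1)) (Fin (n + 1 + m + 1)) ℂ :=
    B.updateRow 0 (B 0 + (-1 : ℂ) • B ⟨1, by omega⟩)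
  have hB' : B'.det = B.det :=
    Matrix.det_updateRow_add_smul_self B (by intro hc; simp [Fin.ext_iff] at hc) (-1)
  have hz1 : z 1 ^ 3 - t ^ 3 = 0 := by rw [h1]; ring
  have hz0 : z 0 ^ 3 - t ^ 3 = 0 := by rw [h0]; linear_combination t ^ 3 * h.cube'
  have htri1 : (tri Q).eval (z 1) = ρ := by
    rw [h1]; simpa using hφ 0
  have htri0 : (tri Q).eval (z 0) = ρ := by
    rw [h0]; simpa using hφ' 0
  have hB'0 : ∀ c, B' 0 c = if c = 0 then (p - 1) * t else 0 := by
    intro c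
    simp only [B', Matrix.updateRow_self, Pi.add_apply, Pi.smul_apply, B, Matrix.of_apply,
      Fin.val_zero, hz0, hz1, zero_mul, htri0, htri1, smul_eq_mul]
    by_cases hc : c = 0
    · subst hc; simp [h0, h1]; ring
    · have : c.val ≠ 0 := fun hh => hc (Fin.ext hh)
      rw [if_neg this, if_neg this, if_neg hc]
      split_ifs <;> simp
  have hd1 : B'.det = (p - 1) * t * (B'.submatrix Fin.succ Fin.succ).det := by
    rw [Matrix.det_succ_row_zero, Finset.sum_eq_single 0]
    · rw [hB'0, if_pos rfl]
      simp
    · intro b _ hb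
      rw [hB'0, if_neg hb]; ring
    · simp
  have hsub : B'.submatrix Fin.succ Fin.succ = B.submatrix Fin.succ Fin.succ := by
    ext r c
    simp only [Matrix.submatrix_apply, B']
    rw [Matrix.updateRow_ne (Fin.succ_ne_zero r)]
  have e5 : n + 1 + m = n + m + 1 := by omega
  let F : Matrix (Fin (n + m + 1)) (Fin (n + m + 1)) ℂ :=
    (B.submatrix Fin.succ Fin.succ).submatrix (Fin.cast e5.symm) (Fin.cast e5.symm)
  have hF : F.det = (B.submatrix Fin.succ Fin.succ).det :=
    Matrix.det_submatrix_equiv_self (finCongr e5.symm) _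
  have hFr : ∀ r c, F r c = if c.val < n then
      (z (r.val + 1) ^ 3 - t ^ 3) * z (r.val + 1) ^ (3 * c.val + 1)
      else if c.val = n then (tri Q).eval (z (r.val + 1))
      else (z (r.val + 1) ^ 3 - t ^ 3)
        * (tri (X ^ (c.val - (n + 1)) * P)).eval (z (r.val + 1)) := by
    intro r c
    simp only [F, B, Matrix.submatrix_apply, Matrix.of_apply, Fin.val_succ, Fin.val_cast]
    rw [if_neg (by omega), Nat.add_sub_cancel, show c.val + 1 - (n + 2) = c.val - (n + 1) by omega]
    simp only [Nat.add_lt_add_iff_right, Nat.add_right_cancel_iff]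
  have hF0 : ∀ c, F 0 c = if c.val = n then ρ else 0 := by
    intro c
    rw [hFr]
    simp only [Fin.val_zero, zero_add, hz1, htri1, zero_mul]
    split_ifs <;> first | rfl | omega
  let cn : Fin (n + m + 1) := ⟨n, by omega⟩
  have hd2 : F.det = (-1) ^ n * ρ * (F.submatrix Fin.succ cn.succAbove).det := by
    rw [Matrix.det_succ_row_zero, Finset.sum_eq_single cn]
    · rw [hF0, if_pos rfl]
    · intro b _ hb
      rw [hF0, if_neg fun hh => hb (Fin.ext hh)]; ring
    · simp
  have hd3 : F.submatrix Fin.succ cn.succAbove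
      = Matrix.of fun r c : Fin (n + m) => (z (r.val + 2) ^ 3 - t ^ 3)
        * (Emat n m P fun r => z (r + 2)) r c := by
    ext r c
    simp only [Matrix.submatrix_apply, Matrix.of_apply, Emat, colE]
    rw [hFr]
    simp only [Fin.val_succ]
    by_cases hc : c.val < n
    · rw [Fin.succAbove_of_castSucc_lt _ _ (by rw [Fin.lt_def]; exact hc)]
      simp only [Fin.val_castSucc]
      rw [if_pos hc, if_pos hc]
      simp
    · rw [Fin.succAbove_of_le_castSucc _ _ (by rw [Fin.le_def]; exact not_lt.mp hc)]
      simp only [Fin.val_succ]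
      rw [if_neg (by omega), if_neg (by omega), if_neg hc, Nat.add_sub_add_right]
  change A.det = _
  rw [hAB, ← hB', hd1, hsub, ← hF, hd2, hd3, Matrix.det_mul_column, Finset.prod_range, hρ]
  field_simp

end XXZ

namespace XXZ

section Swap

open Polynomial

variable {S : Type*} [CommRing S]

/-- The polynomial with simple zeros at the parameters `k, …, N - 1` and double zeros at the
parameters `0, …, k - 1`. -/
def PP (k N : ℕ) (x : ℕ → S) : S[X] :=
  (∏ j ∈ Finset.Ico k N, (X - C (x j))) * (∏ j ∈ Finset.range k, (X - C (x j))) ^ 2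

/-- The determinant built from the parameters. -/
def Ed (n m k : ℕ) (x : ℕ → S) : S := (Emat n m (PP k (2 * n + 1) x) fun r => x (2 * n - r)).det

/-- The Vandermonde determinant of the last `M` parameters. -/
def Vd (n M : ℕ) (x : ℕ → S) : S :=
  (Matrix.vandermonde fun r : Fin M => x (2 * n - r.val)).det

lemma PP_map {S' : Type*} [CommRing S'] (φ : S →+* S') (k N : ℕ) (x : ℕ → S) :
    (PP k N x).map φ = PP k N (φ ∘ x) := by
  simp [PP, Polynomial.map_prod, Polynomial.map_mul, Polynomial.map_pow]

lemma Ed_map {S' : Type*} [CommRing S'] (φ : S →+* S') (n m k : ℕ) (x : ℕ → S) :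
    φ (Ed n m k x) = Ed n m k (φ ∘ x) := by
  unfold Ed
  rw [RingHom.map_det]
  congr 1
  ext r c
  simp only [RingHom.mapMatrix_apply, Matrix.map_apply, Emat, Matrix.of_apply, colE]
  rw [← PP_map, ← Polynomial.eval_map_apply]
  split_ifs
  · simp
  · rw [map_tri]; simp [Function.comp]

lemma Vd_map {S' : Type*} [CommRing S'] (φ : S →+* S') (n M : ℕ) (x : ℕ → S) :
    φ (Vd n M x) = Vd n M (φ ∘ x) := by
  unfold Vd
  rw [RingHom.map_det]
  congr 1
  ext r c
  simp [Matrix.vandermonde]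

lemma det_rows_swap {n M i : ℕ} (hM : M ≤ 2 * n + 1) (hi : 2 * n + 1 - M ≤ i)
    (hi' : i + 1 < 2 * n + 1) (F : Fin M → S → S) (x : ℕ → S) :
    (Matrix.of fun r c : Fin M => F c ((x ∘ sw i) (2 * n - r.val))).det
      = -(Matrix.of fun r c : Fin M => F c (x (2 * n - r.val))).det := by
  let a : Fin M := ⟨2 * n - (i + 1), by omega⟩
  let b : Fin M := ⟨2 * n - i, by omega⟩
  have hab : a ≠ b := by simp only [a, b, ne_eq, Fin.mk.injEq]; omega
  have := Matrix.det_permute (Equiv.swap a b)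
    (Matrix.of fun r c : Fin M => F c (x (2 * n - r.val)))
  rw [Equiv.Perm.sign_swap hab] at this
  simp only [Units.val_neg, Units.val_one, Int.cast_neg, Int.cast_one, neg_mul, one_mul] at this
  rw [← this]
  congr 1
  ext r c
  simp only [Matrix.submatrix_apply, Matrix.of_apply, id]
  congr 1
  by_cases ha : r = a
  · subst ha
    rw [Equiv.swap_apply_left]
    simp only [a, b]
    rw [show 2 * n - (2 * n - (i + 1)) = i + 1 by omega, comp_sw_right,
      show 2 * n - (2 * n - i) = i by omega]
  by_cases hb : r = b
  · subst hb
    rw [Equiv.swap_apply_right]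
    simp only [a, b]
    rw [show 2 * n - (2 * n - i) = i by omega, comp_sw_left,
      show 2 * n - (2 * n - (i + 1)) = i + 1 by omega]
  rw [Equiv.swap_apply_of_ne_of_ne ha hb]
  have ha' : r.val ≠ 2 * n - (i + 1) := fun hh => ha (Fin.ext hh)
  have hb' : r.val ≠ 2 * n - i := fun hh => hb (Fin.ext hh)
  have := r.isLt
  rw [comp_sw_of_ne x (by omega) (by omega)]

lemma Vd_swap {n M i : ℕ} (hM : M ≤ 2 * n + 1) (hi : 2 * n + 1 - M ≤ i)
    (hi' : i + 1 < 2 * n + 1) (x : ℕ → S) : Vd n M (x ∘ sw i) = -Vd n M x :=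
  det_rows_swap hM hi hi' (fun c y => y ^ c.val) x

lemma PP_swap {k N i : ℕ} (hi : k ≤ i) (hi' : i + 1 < N) (x : ℕ → S) :
    PP k N (x ∘ sw i) = PP k N x := by
  unfold PP
  congr 1
  · apply Finset.prod_equiv (sw i)
    · intro j
      simp only [Finset.mem_Ico]
      unfold sw
      grind
    · intro j _; simp
  · congr 1
    apply Finset.prod_congr rfl
    intro j hj
    rw [comp_sw_of_ne x (by have := Finset.mem_range.mp hj; omega)
      (by have := Finset.mem_range.mp hj; omega)]

lemma Ed_swap {n m k i : ℕ} (hm : m + k = n + 1) (hi : k ≤ i)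
    (hi' : i + 1 < 2 * n + 1) (x : ℕ → S) : Ed n m k (x ∘ sw i) = -Ed n m k x := by
  unfold Ed
  rw [PP_swap hi hi']
  exact det_rows_swap (by omega) (by omega) hi'
    (fun c y => (colE n (PP k (2 * n + 1) x) c.val).eval y) x

end Swap

/-- The sign in the determinant representation. -/
def sg (m : ℕ) : ℂ := (-1) ^ (m.choose 2)

lemma sg_succ (m : ℕ) : sg (m + 1) = (-1) ^ m * sg m := by
  unfold sg
  rw [Nat.choose_succ_succ' m 1, Nat.choose_one_right, pow_add]

/-- The defect of the determinant representation. -/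
def Fd (q p : ℂ) (n m k : ℕ) (x : ℕ → ℂ) : ℂ :=
  MvPolynomial.eval x (GG q p n k) * Vd n (n + m) x
    - sg m * (∏ e ∈ prs k, qd (x e.1) (x e.2)) * Ed n m k x

lemma Fd_swap {q p : ℂ} (h : Om q p) {n m k i : ℕ} (hm : m + k = n + 1) (hi : k ≤ i)
    (hi' : i + 1 < 2 * n + 1) (x : ℕ → ℂ) : Fd q p n m k (x ∘ sw i) = -Fd q p n m k x := by
  unfold Fd
  rw [Ed_swap hm hi hi', Vd_swap (by omega) (by omega) hi', ← eval_rename_perm,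
    GG_symm h hi hi']
  have : ∏ e ∈ prs k, qd ((x ∘ sw i) e.1) ((x ∘ sw i) e.2) = ∏ e ∈ prs k, qd (x e.1) (x e.2) := by
    apply Finset.prod_congr rfl
    intro e he
    have := mem_prs.mp he
    rw [comp_sw_of_ne x (by omega) (by omega), comp_sw_of_ne x (by omega) (by omega)]
  rw [this]; ring

lemma Vd_succ (n M : ℕ) (x : ℕ → ℂ) :
    Vd (n + 1) (M + 2) x = (x (2 * n + 1) - x (2 * n + 2))
      * (∏ r ∈ Finset.range M, (x (2 * n - r) - x (2 * n + 1)) * (x (2 * n - r) - x (2 * n + 2)))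
      * Vd n M x := by
  have hs : ∀ (M : ℕ) (v : Fin (M + 1) → ℂ), (Matrix.vandermonde v).det
      = (∏ r : Fin M, (v r.succ - v 0)) * (Matrix.vandermonde fun r : Fin M => v r.succ).det := by
    intro M v
    rw [Matrix.det_vandermonde, Fin.prod_univ_succ, Matrix.det_vandermonde]
    congr 1
    · rw [Fin.prod_Ioi_zero]
    · apply Finset.prod_congr rfl
      intro i _
      rw [Fin.prod_Ioi_succ]
  unfold Vd
  rw [hs, hs, Fin.prod_univ_succ, Finset.prod_mul_distrib, Finset.prod_range, Finset.prod_range]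
  simp only [Fin.val_succ, Fin.val_zero]
  have e : ∀ r, 2 * (n + 1) - (r + 1 + 1) = 2 * n - r := fun r => by omega
  simp only [e, Nat.sub_zero, show 2 * (n + 1) - (0 + 1) = 2 * n + 1 by omega]
  rw [show 2 * (n + 1) = 2 * n + 2 by ring]
  ring

lemma Fd_fuse {q p : ℂ} (h : Om q p) {n m k : ℕ} (hm : m + k = n + 1)
    (IH : ∀ x, Gen (2 * n + 1) x → Fd q p n m k x = 0) {x : ℕ → ℂ} (hx : Gen (2 * n + 2) x)
    (hf : x (2 * n + 2) = p * x (2 * n + 1)) : Fd q p (n + 1) (m + 1) k x = 0 := by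
  have hx' : Gen (2 * n + 1) x := ⟨fun a ha => hx.1 a (by omega),
    fun a b ha hb hab => hx.2 a b (by omega) (by omega) hab⟩
  have I := IH x hx'
  set t := x (2 * n + 1) with ht
  have ht0 : t ≠ 0 := hx.1 _ (by omega)
  have hPP : PP k (2 * (n + 1) + 1) x
      = (Polynomial.X - Polynomial.C (p * t)) * (Polynomial.X - Polynomial.C t)
        * PP k (2 * n + 1) x := by
    unfold PP
    rw [show 2 * (n + 1) + 1 = 2 * n + 1 + 1 + 1 by ring, Finset.prod_Ico_succ_top (by omega),
      Finset.prod_Ico_succ_top (by omega), show 2 * n + 1 + 1 = 2 * n + 2 by ring, hf]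
    ring
  unfold Fd at I ⊢
  rw [GG_fuse h (by omega) hf ht0 fun a b ha hb hab hh => hx'.2 a b ha hb hab (by rw [hh]),
    show n + 1 + (m + 1) = n + m + 2 by ring, Vd_succ]
  have hE : Ed (n + 1) (m + 1) k x = (-1) ^ n * ((p - 1) * p / 3)
        * ((PP k (2 * (n + 1) + 1) x).eval (q * t))
        * (∏ r ∈ Finset.range (n + m), (x (2 * n - r) ^ 3 - t ^ 3)) * Ed n m k x := by
    unfold Ed
    rw [hPP, det_Emat_fuse h n m ht0 (PP k (2 * n + 1) x) _
      (show x (2 * n + 2) = p * t from hf) (show x (2 * n + 1) = t from rfl)]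
    have e : ∀ r, 2 * (n + 1) - (r + 2) = 2 * n - r := fun r => by omega
    simp only [e]
  rw [hE, hPP, sg_succ, hf, ← ht]
  have hIco : ∀ f : ℕ → ℂ, ∏ r ∈ Finset.range (n + m), f (2 * n - r)
      = ∏ j ∈ Finset.Ico k (2 * n + 1), f j := by
    intro f
    rw [Finset.range_eq_Ico, Finset.prod_Ico_reflect f 0 (by omega : n + m ≤ 2 * n + 1)]
    congr 2; omega
  have hall : (∏ j ∈ Finset.range (2 * n + 1), (t - p * x j)) ^ 2
        * ∏ r ∈ Finset.range (n + m), (x (2 * n - r) - t) * (x (2 * n - r) - p * t)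
      = p ^ (2 * (2 * n + 1)) * (-1) ^ (n + m) * ((PP k (2 * n + 1) x).eval (q * t))
        * ∏ r ∈ Finset.range (n + m), (x (2 * n - r) ^ 3 - t ^ 3) := by
    rw [hIco fun y => (x y - t) * (x y - p * t), hIco fun y => x y ^ 3 - t ^ 3]
    have e1 : ∏ j ∈ Finset.range (2 * n + 1), (t - p * x j)
        = p ^ (2 * n + 1) * ((∏ j ∈ Finset.range k, (q * t - x j))
          * ∏ j ∈ Finset.Ico k (2 * n + 1), (q * t - x j)) := by
      rw [Finset.prod_range_mul_prod_Ico _ (by omega : k ≤ 2 * n + 1),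
        show p ^ (2 * n + 1) = ∏ _j ∈ Finset.range (2 * n + 1), p by simp,
        ← Finset.prod_mul_distrib]
      apply Finset.prod_congr rfl
      intro j _
      linear_combination (-t) * h.mul
    have e2 : ∏ j ∈ Finset.Ico k (2 * n + 1), (x j ^ 3 - t ^ 3)
        = (-1) ^ (n + m) * (∏ j ∈ Finset.Ico k (2 * n + 1), (q * t - x j))
          * ∏ j ∈ Finset.Ico k (2 * n + 1), (x j - t) * (x j - p * t) := by
      have hc : (Finset.Ico k (2 * n + 1)).card = n + m := by rw [Nat.card_Ico]; omega
      rw [← hc, ← Finset.prod_const, ← Finset.prod_mul_distrib, ← Finset.prod_mul_distrib]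
      apply Finset.prod_congr rfl
      intro j _
      linear_combination (x j ^ 2 * t - x j * t ^ 2) * h.sum - (x j * t ^ 2 - t ^ 3) * h.mul
    rw [e1, e2]
    unfold PP
    simp only [Polynomial.eval_mul, Polynomial.eval_pow, Polynomial.eval_prod, Polynomial.eval_sub,
      Polynomial.eval_X, Polynomial.eval_C]
    have e3 : ((-1 : ℂ) ^ (n + m)) * (-1) ^ (n + m) = 1 := by
      rw [← mul_pow]; norm_num
    linear_combination (-(p ^ (2 * (2 * n + 1)) * (∏ j ∈ Finset.Ico k (2 * n + 1), (q * t - x j)) ^ 2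
      * (∏ j ∈ Finset.range k, (q * t - x j)) ^ 2
      * ∏ j ∈ Finset.Ico k (2 * n + 1), (x j - t) * (x j - p * t))) * e3
  have hp3 : p ^ (2 * n + 1) * p ^ (2 * (2 * n + 1)) = 1 := by
    rw [← pow_add, show 2 * n + 1 + 2 * (2 * n + 1) = 3 * (2 * n + 1) by ring, pow_mul, h.cube',
      one_pow]
  simp only [Polynomial.eval_mul, Polynomial.eval_sub, Polynomial.eval_X, Polynomial.eval_C]
  have hqp : q - p ≠ 0 := sub_ne_zero.mpr h.ne
  set A := ∏ j ∈ Finset.range (2 * n + 1), (t - p * x j)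
  set B := ∏ r ∈ Finset.range (n + m), (x (2 * n - r) - t) * (x (2 * n - r) - p * t)
  set D := ∏ r ∈ Finset.range (n + m), (x (2 * n - r) ^ 3 - t ^ 3)
  set V := (PP k (2 * n + 1) x).eval (q * t)
  set Gn := MvPolynomial.eval x (GG q p n k)
  set pr := ∏ e ∈ prs k, qd (x e.1) (x e.2)
  have hc : (1 - p) / (q - p) * (1 - p) = (p - 1) * p / 3 * (q - p) * (q - 1) := by
    have e0 : (q - p) ^ 2 = -3 := by linear_combination h.sq + h.sq' + h.sum - 2 * h.mul
    rw [div_mul_eq_mul_div, div_eq_iff hqp]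
    linear_combination (-(p - 1) * p * (q - 1) / 3) * e0 + (p - 1) * h.mul
  have hs : ((-1 : ℂ) ^ m) * (-1) ^ m = 1 := by rw [← mul_pow]; norm_num
  have key : (1 - p) / (q - p) * t * p ^ (2 * n + 1) * A ^ 2 * Gn * ((t - p * t) * B * Vd n (n + m) x)
      = ((1 - p) / (q - p) * (1 - p)) * t ^ 2 * p ^ (2 * n + 1) * (A ^ 2 * B)
        * (Gn * Vd n (n + m) x) := by ring
  rw [key, hall, hc, sub_eq_zero.mp I]
  linear_combination ((p - 1) * p / 3 * (q - p) * (q - 1) * t ^ 2 * (-1) ^ (n + m) * V * D *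
    (sg m * pr * Ed n m k x)) * hp3

end XXZ

namespace XXZ

lemma prs_split (a b : ℕ) (f : ℕ → ℕ → ℂ) :
    ∏ e ∈ prs (a + b), (if (e.1 < a ↔ e.2 < a) then f e.1 e.2 else 1)
      = (∏ e ∈ prs a, f e.1 e.2) * ∏ e ∈ prs b, f (a + e.1) (a + e.2) := by
  classical
  rw [← Finset.prod_filter]
  have : (prs (a + b)).filter (fun e => (e.1 < a ↔ e.2 < a))
      = prs a ∪ (prs b).image (fun e => (a + e.1, a + e.2)) := by
    ext ⟨u, v⟩
    simp only [Finset.mem_filter, mem_prs, Finset.mem_union, Finset.mem_image, Prod.mk.injEq,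
      Prod.exists]
    constructor
    · rintro ⟨⟨h1, h2⟩, h3⟩
      by_cases hv : v < a
      · exact Or.inl ⟨h1, hv⟩
      · exact Or.inr ⟨u - a, v - a, by omega, by omega, by omega⟩
    · rintro (h1 | ⟨u', v', h1, rfl, rfl⟩) <;> omega
  rw [this, Finset.prod_union, Finset.prod_image]
  · intro e _ e' _ he
    simp only [Prod.mk.injEq, Nat.add_left_cancel_iff] at he
    exact Prod.ext he.1 he.2
  · rw [Finset.disjoint_left]
    rintro e h1 h2
    obtain ⟨e', _, rfl⟩ := Finset.mem_image.mp h2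
    have := mem_prs.mp h1
    simp only at this
    omega

lemma vand_cube (a M c : ℕ) (hc : c + 1 = a + M) (x : ℕ → ℂ) :
    (Matrix.vandermonde fun r : Fin M => x (c - r.val) ^ 3).det
      = (∏ e ∈ prs M, qd (x (a + e.1)) (x (a + e.2)))
        * (Matrix.vandermonde fun r : Fin M => x (c - r.val)).det := by
  rw [Matrix.det_vandermonde, Matrix.det_vandermonde]
  have e1 : ∀ i j : Fin M, x (c - j.val) ^ 3 - x (c - i.val) ^ 3
      = qd (x (c - j.val)) (x (c - i.val)) * (x (c - j.val) - x (c - i.val)) := by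
    intro i j; unfold qd; ring
  simp only [e1, Finset.prod_mul_distrib]
  congr 1
  rw [Finset.prod_sigma']
  apply Finset.prod_bij (fun e _ => (M - 1 - e.2.val, M - 1 - e.1.val))
  · rintro ⟨i, j⟩ he
    simp only [Finset.mem_sigma, Finset.mem_univ, Finset.mem_Ioi, true_and, Fin.lt_def] at he
    rw [mem_prs]; simp only
    have := j.isLt
    omega
  · rintro ⟨i, j⟩ he ⟨i', j'⟩ he' heq
    simp only [Prod.mk.injEq] at heq
    have h1 : i = i' := Fin.ext (by omega)
    have h2 : j = j' := Fin.ext (by omega)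
    rw [h1, h2]
  · rintro ⟨u, v⟩ he
    have he := mem_prs.mp he
    simp only at he
    refine ⟨⟨⟨M - 1 - v, by omega⟩, ⟨M - 1 - u, by omega⟩⟩, ?_, ?_⟩
    · simp only [Finset.mem_sigma, Finset.mem_univ, Finset.mem_Ioi, true_and, Fin.lt_def]
      omega
    · simp only [Prod.mk.injEq]
      omega
  · rintro ⟨i, j⟩ he
    have := i.isLt
    have := j.isLt
    simp only
    congr 2 <;> omega

lemma det_vandermonde_cons (M : ℕ) (v : Fin (M + 1) → ℂ) : (Matrix.vandermonde v).det
    = (∏ r : Fin M, (v r.succ - v 0)) * (Matrix.vandermonde fun r : Fin M => v r.succ).det := by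
  rw [Matrix.det_vandermonde, Fin.prod_univ_succ, Matrix.det_vandermonde]
  congr 1
  · rw [Fin.prod_Ioi_zero]
  · apply Finset.prod_congr rfl
    intro i _
    rw [Fin.prod_Ioi_succ]

lemma det_cube_cols (M : ℕ) (v : Fin M → ℂ) :
    (Matrix.of fun r c : Fin M => v r ^ (3 * c.val + 1)).det
      = (∏ r, v r) * (Matrix.vandermonde fun r => v r ^ 3).det := by
  rw [← Matrix.det_mul_column]
  congr 1
  ext r c
  simp only [Matrix.of_apply, Matrix.vandermonde_apply]
  rw [← pow_mul]; ring

lemma prod_tail (n M : ℕ) (hM : M ≤ n + 1) (f : ℕ → ℂ) :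
    ∏ r : Fin M, f (n - r.val) = ∏ j ∈ Finset.Ico (n + 1 - M) (n + 1), f j := by
  rw [← Finset.prod_range fun r => f (n - r), Finset.range_eq_Ico,
    Finset.prod_Ico_reflect f 0 (by omega)]
  congr 2

/-- The determinant representation when all up spins are prescribed. -/
lemma Fd_top {q p : ℂ} (h : Om q p) (n : ℕ) (x : ℕ → ℂ) : Fd q p n 0 (n + 1) x = 0 := by
  have hE : Ed n 0 (n + 1) x = (∏ r : Fin n, x (2 * n - r.val))
      * (Matrix.vandermonde fun r : Fin n => x (2 * n - r.val) ^ 3).det := by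
    rw [← det_cube_cols n fun r : Fin n => x (2 * n - r.val)]
    unfold Ed
    congr 1
    ext r c
    simp [Emat, colE]
  have hsp := prs_split (n + 1) n fun i j => qd (x i) (x j)
  rw [show n + 1 + n = 2 * n + 1 by ring] at hsp
  unfold Fd
  rw [GG_top h, hsp, hE, vand_cube (n + 1) n (2 * n) (by ring), prod_tail (2 * n) n (by omega),
    ← Finset.prod_range_mul_prod_Ico _ (by omega : n + 1 ≤ 2 * n + 1),
    Finset.prod_congr (g := fun _ => 1) rfl (fun j hj => if_pos (Finset.mem_range.mp hj)),
    Finset.prod_const_one, show 2 * n + 1 - n = n + 1 by omega,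
    Finset.prod_congr (s₁ := Finset.Ico (n + 1) (2 * n + 1)) (g := fun j => x j) rfl
      (fun j hj => if_neg (by have := Finset.mem_Ico.mp hj; omega))]
  have : sg 0 = 1 := by simp [sg]
  rw [this, show Vd n (n + 0) x = (Matrix.vandermonde fun r : Fin n => x (2 * n - r.val)).det
    from rfl]
  ring

/-- The determinant representation when the last parameter vanishes. -/
lemma Fd_zero {q p : ℂ} (h : Om q p) {n : ℕ} (hn : 1 ≤ n) {x : ℕ → ℂ} (hx : x (2 * n) = 0) :
    Fd q p n 1 n x = 0 := by
  have hsp := prs_split n n fun i j => qd (x i) (x j)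
  rw [← two_mul] at hsp
  have hP : PP n (2 * n + 1) x = Polynomial.X * PP n (2 * n) x := by
    unfold PP
    rw [Finset.prod_Ico_succ_top (by omega), hx, Polynomial.C_0, sub_zero]
    ring
  have hP0 : (tri (PP n (2 * n + 1) x)).eval 0
      = (-1) ^ n * (∏ j ∈ Finset.Ico n (2 * n), x j) * (∏ j ∈ Finset.range n, x j) ^ 2 := by
    rw [eval_tri_zero, hP, Polynomial.coeff_X_mul, Polynomial.coeff_zero_eq_eval_zero]
    unfold PP
    simp only [Polynomial.eval_mul, Polynomial.eval_pow, Polynomial.eval_prod, Polynomial.eval_sub,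
      Polynomial.eval_X, Polynomial.eval_C, zero_sub]
    rw [Finset.prod_neg, Finset.prod_neg, Nat.card_Ico, Finset.card_range,
      show 2 * n - n = n by omega]
    have e3 : ((-1 : ℂ) ^ n) * (-1) ^ n = 1 := by rw [← mul_pow]; norm_num
    linear_combination ((-1) ^ n * (∏ j ∈ Finset.Ico n (2 * n), x j)
      * (∏ j ∈ Finset.range n, x j) ^ 2) * e3
  have hz : ∀ r : Fin n, 2 * n - (r.val + 1) = 2 * n - 1 - r.val := fun r => by omega
  have hE : Ed n 1 n x = (-1) ^ n * (tri (PP n (2 * n + 1) x)).eval 0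
      * ((∏ r : Fin n, x (2 * n - 1 - r.val))
      * (Matrix.vandermonde fun r : Fin n => x (2 * n - 1 - r.val) ^ 3).det) := by
    rw [← det_cube_cols n fun r : Fin n => x (2 * n - 1 - r.val)]
    unfold Ed
    rw [Matrix.det_succ_row_zero, Fin.sum_univ_castSucc, Finset.sum_eq_zero, zero_add]
    · congr 2
      · simp [Emat, colE, hx]
      · ext r c
        simp only [Emat, Matrix.of_apply, colE, Matrix.submatrix_apply, Fin.succAbove_last,
          Fin.val_castSucc, if_pos c.isLt, Fin.val_succ, hz]
        simp
    · intro c _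
      simp [Emat, colE, hx]
  unfold Fd
  rw [GG_zero h hn hx, hsp, hE, hP0, vand_cube n n (2 * n - 1) (by omega),
    prod_tail (2 * n - 1) n (by omega),
    ← Finset.prod_range_mul_prod_Ico _ (by omega : n ≤ 2 * n), Vd, det_vandermonde_cons]
  simp only [Fin.val_zero, Nat.sub_zero, hx, sub_zero, Fin.val_succ, hz]
  rw [prod_tail (2 * n - 1) n (by omega), show 2 * n - 1 + 1 = 2 * n by omega,
    show 2 * n - n = n by omega, Finset.prod_congr (s₁ := Finset.range n) (g := fun j => x j ^ 2)
      rfl (fun j hj => if_pos (Finset.mem_range.mp hj)), Finset.prod_pow,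
    Finset.prod_congr (s₁ := Finset.Ico n (2 * n)) (g := fun j => x j) rfl
      (fun j hj => if_neg (by have := Finset.mem_Ico.mp hj; omega))]
  have : sg 1 = 1 := by simp [sg]
  rw [this]
  have e3 : ((-1 : ℂ) ^ n) * (-1) ^ n = 1 := by rw [← mul_pow]; norm_num
  generalize (∏ j ∈ Finset.Ico n (2 * n), x j) = a
  generalize (∏ j ∈ Finset.range n, x j) = b
  generalize (∏ e ∈ prs n, qd (x e.1) (x e.2)) = c
  generalize (∏ e ∈ prs n, qd (x (n + e.1)) (x (n + e.2))) = d
  generalize (Matrix.vandermonde fun r : Fin n => x (2 * n - 1 - r.val)).det = w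
  linear_combination (-(a ^ 2 * b ^ 2 * c * d * w)) * e3

end XXZ

namespace XXZ

section Degree

open Polynomial

lemma natDegree_det_le {d : ℕ} (A : Matrix (Fin d) (Fin d) ℂ[X]) (v u : Fin d → ℕ)
    (hA : ∀ r c, (A r c).natDegree ≤ v r + u c) : A.det.natDegree ≤ (∑ r, v r) + ∑ c, u c := by
  rw [Matrix.det_apply]
  apply natDegree_sum_le_of_forall_le
  intro σ _
  refine (natDegree_smul_le _ _).trans ((natDegree_prod_le _ _).trans ?_)
  rw [← Equiv.sum_comp σ v, ← Finset.sum_add_distrib]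
  exact Finset.sum_le_sum fun i _ => hA _ _

lemma PP_congr {S : Type*} [CommRing S] {k N : ℕ} (hk : k ≤ N) {x y : ℕ → S}
    (h : ∀ j < N, x j = y j) : PP k N x = PP k N y := by
  unfold PP
  congr 1
  · exact Finset.prod_congr rfl fun j hj => by rw [h j (Finset.mem_Ico.mp hj).2]
  · congr 1
    exact Finset.prod_congr rfl fun j hj => by
      rw [h j (lt_of_lt_of_le (Finset.mem_range.mp hj) hk)]

lemma natDegree_PP_le {k N : ℕ} (hk : k ≤ N) (x : ℕ → ℂ) : (PP k N x).natDegree ≤ N + k := by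
  unfold PP
  refine natDegree_mul_le.trans ?_
  have h1 : (∏ j ∈ Finset.Ico k N, (X - C (x j))).natDegree ≤ N - k := by
    refine (natDegree_prod_le _ _).trans ?_
    simp
  have h2 : ((∏ j ∈ Finset.range k, (X - C (x j))) ^ 2).natDegree ≤ 2 * k := by
    refine natDegree_pow_le.trans (Nat.mul_le_mul_left 2 ((natDegree_prod_le _ _).trans ?_))
    simp
  omega

lemma natDegree_tri_le {P : ℂ[X]} {d : ℕ} (h : P.natDegree ≤ d + 1) : (tri P).natDegree ≤ d := by
  rw [natDegree_le_iff_coeff_eq_zero]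
  intro i hi
  rw [coeff_tri]
  split_ifs
  · exact coeff_eq_zero_of_natDegree_lt (by omega)
  · rfl

/-- The parameters with the one at `i` replaced by the variable. -/
def varAt (x : ℕ → ℂ) (i : ℕ) : ℕ → ℂ[X] := Function.update (fun j => C (x j)) i X

lemma varAt_self (x : ℕ → ℂ) (i : ℕ) : varAt x i i = X := Function.update_self ..

lemma varAt_ne (x : ℕ → ℂ) {i j : ℕ} (h : j ≠ i) : varAt x i j = C (x j) :=
  Function.update_of_ne h ..

lemma eval_varAt (x : ℕ → ℂ) (i : ℕ) (t : ℂ) :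
    (evalRingHom t) ∘ varAt x i = Function.update x i t := by
  ext j
  by_cases h : j = i
  · subst h; simp [varAt_self]
  · simp [varAt_ne x h, Function.update_of_ne h]

lemma natDegree_Vd_le (n M : ℕ) (hM : M ≤ 2 * n + 1) (x : ℕ → ℂ) :
    (Vd n M (varAt x (2 * n))).natDegree ≤ M - 1 := by
  cases M with
  | zero => simp [Vd]
  | succ M =>
    unfold Vd
    refine (natDegree_det_le _ (fun r => if r = 0 then M else 0) (fun _ => 0) ?_).trans ?_
    · intro r c
      rw [Matrix.vandermonde_apply]
      by_cases hr : r = 0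
      · subst hr
        simp only [Fin.val_zero, Nat.sub_zero, varAt_self, natDegree_X_pow, if_pos]
        omega
      · have : r.val ≠ 0 := fun hh => hr (Fin.ext hh)
        rw [varAt_ne _ (by omega), ← C_pow, natDegree_C]
        exact Nat.zero_le _
    · simp

lemma natDegree_Ed_le {n m k : ℕ} (hn : 1 ≤ n) (hm : m + k = n + 1) (hk : k ≤ n) (x : ℕ → ℂ) :
    (Ed n m k (varAt x (2 * n))).natDegree ≤ 3 * n + m - 1 := by
  obtain ⟨M, hM⟩ : ∃ M, n + m = M + 1 := ⟨n + m - 1, by omega⟩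
  set P0 := PP k (2 * n) x with hP0
  have hP : PP k (2 * n + 1) (varAt x (2 * n)) = X * P0.map C - C X * P0.map C := by
    have e : PP k (2 * n) (varAt x (2 * n)) = P0.map C := by
      rw [hP0, PP_map]
      exact PP_congr (by omega) fun j hj => varAt_ne _ (by omega)
    rw [← e]
    unfold PP
    rw [Finset.prod_Ico_succ_top (by omega), varAt_self]
    ring
  have hφ : ∀ s (w : ℂ[X]), (tri (X ^ s * PP k (2 * n + 1) (varAt x (2 * n)))).eval w
      = ((tri (X ^ (s + 1) * P0)).map C).eval w - X * ((tri (X ^ s * P0)).map C).eval w := by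
    intro s w
    have e1 : (X : ℂ[X][X]) ^ s * PP k (2 * n + 1) (varAt x (2 * n))
        = (X ^ (s + 1) * P0).map C - C X * (X ^ s * P0).map C := by
      rw [hP]; simp only [Polynomial.map_mul, Polynomial.map_pow, map_X]; ring
    rw [e1, tri_sub, tri_C_mul, map_tri, map_tri]
    simp
  have hC : ∀ (A : ℂ[X]) (a : ℂ), (A.map C).eval (C a) = C (A.eval a) := by
    intro A a; rw [eval_map, eval₂_at_apply]
  have hX : ∀ (A : ℂ[X]), (A.map C).eval X = A := by
    intro A; rw [eval_map, eval₂_C_X]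
  have hdP : P0.natDegree ≤ 2 * n + k := natDegree_PP_le (by omega) x
  have hds : ∀ s, (X ^ s * P0).natDegree ≤ s + (2 * n + k) := fun s =>
    natDegree_mul_le.trans (by rw [natDegree_X_pow]; omega)
  unfold Ed
  refine (natDegree_det_le _ (fun r => if r.val = 0 then 3 * n - 1 else 0)
    (fun c => if c.val < n then 0 else 1) ?_).trans ?_
  · intro r c
    have hc := c.isLt
    simp only [Emat, Matrix.of_apply, colE]
    by_cases hr : r.val = 0
    · simp only [hr, Nat.sub_zero, varAt_self, if_pos]
      by_cases hcn : c.val < n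
      · rw [if_pos hcn, if_pos hcn, eval_pow, eval_X, natDegree_X_pow]
        omega
      · rw [if_neg hcn, if_neg hcn, hφ, hX, hX]
        refine (natDegree_sub_le _ _).trans (max_le ?_ ?_)
        · exact natDegree_tri_le ((hds _).trans (by omega))
        · refine natDegree_mul_le.trans ?_
          rw [natDegree_X]
          have := natDegree_tri_le (P := X ^ (c.val - n) * P0) (d := 3 * n - 1)
            ((hds _).trans (by omega))
          omega
    · rw [if_neg hr, varAt_ne _ (by omega)]
      by_cases hcn : c.val < n
      · rw [if_pos hcn, eval_pow, eval_X, ← C_pow, natDegree_C]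
        exact Nat.zero_le _
      · rw [if_neg hcn, if_neg hcn, hφ, hC, hC]
        refine (natDegree_sub_le _ _).trans (max_le ?_ ?_)
        · rw [natDegree_C]; exact Nat.zero_le _
        · refine natDegree_mul_le.trans ?_
          rw [natDegree_C, natDegree_X]
  · rw [Fin.sum_univ_eq_sum_range (fun c => if c < n then 0 else 1) (n + m),
      Fin.sum_univ_eq_sum_range (fun r => if r = 0 then 3 * n - 1 else 0) (n + m),
      Finset.sum_range_add (fun c => if c < n then 0 else 1)]
    have e3 : ∑ r ∈ Finset.range (n + m), (if r = 0 then 3 * n - 1 else 0) = 3 * n - 1 := by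
      rw [hM, Finset.sum_range_succ']; simp
    have e1 : ∑ c ∈ Finset.range n, (if c < n then 0 else 1) = 0 :=
      Finset.sum_eq_zero fun c hc => if_pos (Finset.mem_range.mp hc)
    have e2 : ∑ c ∈ Finset.range m, (if n + c < n then 0 else 1) = m := by simp
    rw [e1, e2, e3]
    omega

end Degree

lemma exists_poly_Fd (q p : ℂ) {n m k : ℕ} (hn : 1 ≤ n) (hm : m + k = n + 1) (hk : k ≤ n)
    (x : ℕ → ℂ) : ∃ F : Polynomial ℂ, F.natDegree ≤ 3 * n + m - 1 ∧
      ∀ t, F.eval t = Fd q p n m k (Function.update x (2 * n) t) := by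
  refine ⟨uni (GG q p n k) (2 * n) x * Vd n (n + m) (varAt x (2 * n))
    - Polynomial.C (sg m * (∏ e ∈ prs k, qd (x e.1) (x e.2))) * Ed n m k (varAt x (2 * n)), ?_, ?_⟩
  · refine (Polynomial.natDegree_sub_le _ _).trans (max_le ?_ ?_)
    · refine Polynomial.natDegree_mul_le.trans ?_
      have h1 := (natDegree_uni_le (GG q p n k) (2 * n) x).trans
        (degreeOf_GG q p k hn (j := 2 * n) (by omega))
      have h2 := natDegree_Vd_le n (n + m) (by omega) x
      omega
    · exact (Polynomial.natDegree_C_mul_le _ _).trans (natDegree_Ed_le hn hm hk x)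
  · intro t
    have h1 := Vd_map (Polynomial.evalRingHom t) n (n + m) (varAt x (2 * n))
    have h2 := Ed_map (Polynomial.evalRingHom t) n m k (varAt x (2 * n))
    rw [eval_varAt, Polynomial.coe_evalRingHom] at h1 h2
    have h3 : ∏ e ∈ prs k, qd (Function.update x (2 * n) t e.1) (Function.update x (2 * n) t e.2)
        = ∏ e ∈ prs k, qd (x e.1) (x e.2) := by
      apply Finset.prod_congr rfl
      intro e he
      have := mem_prs.mp he
      rw [Function.update_of_ne (by omega), Function.update_of_ne (by omega)]
    unfold Fd
    rw [h3, Polynomial.eval_sub, Polynomial.eval_mul, Polynomial.eval_mul, h1, h2, uni_eval,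
      Polynomial.eval_C]

/-- The determinant representation when the last parameter is related to another one. -/
lemma Fd_root {q p : ℂ} (h : Om q p) {n m k : ℕ} (hm : m + k = n + 1)
    (IH : ∀ x, Gen (2 * n + 1) x → Fd q p n m k x = 0) (d : ℕ) :
    ∀ j, j + d = 2 * n + 1 → k ≤ j → ∀ x, Gen (2 * n + 2) x → x (2 * n + 2) ^ 3 = x j ^ 3 →
      Fd q p (n + 1) (m + 1) k x = 0 := by
  have hsw : ∀ i, k ≤ i → i ≤ 2 * n + 1 → ∀ x, Fd q p (n + 1) (m + 1) k (x ∘ sw i) = 0 →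
      Fd q p (n + 1) (m + 1) k x = 0 := by
    intro i hi hi' x h0
    rw [Fd_swap h (by omega) hi (by omega)] at h0
    exact neg_eq_zero.mp h0
  induction d with
  | zero =>
    intro j hj hk x hx h3
    have hj : j = 2 * n + 1 := hj
    subst hj
    have ht0 : x (2 * n + 1) ≠ 0 := hx.1 _ (by omega)
    by_cases c1 : x (2 * n + 2) = x (2 * n + 1)
    · have := Fd_swap (m := m + 1) (n := n + 1) (k := k) (i := 2 * n + 1) h (by omega) hk
        (by omega) x
      have e : x ∘ sw (2 * n + 1) = x := by
        funext a
        simp only [Function.comp, sw, Equiv.swap_apply_def]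
        split_ifs with h1 h2
        · rw [h1, ← c1]
        · rw [h2, ← c1]
        · rfl
      rw [e] at this
      exact self_eq_neg.mp this
    by_cases c2 : x (2 * n + 2) = p * x (2 * n + 1)
    · exact Fd_fuse h hm IH hx c2
    have c3 : x (2 * n + 2) = q * x (2 * n + 1) := by
      have e : (x (2 * n + 2) - x (2 * n + 1)) * ((x (2 * n + 2) - p * x (2 * n + 1))
          * (x (2 * n + 2) - q * x (2 * n + 1))) = 0 := by
        linear_combination h3 + (-(x (2 * n + 2) ^ 2 * x (2 * n + 1))
          + x (2 * n + 2) * x (2 * n + 1) ^ 2) * h.sum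
          + (x (2 * n + 2) * x (2 * n + 1) ^ 2 - x (2 * n + 1) ^ 3) * h.mul
      rcases mul_eq_zero.mp e with e | e
      · exact absurd (sub_eq_zero.mp e) c1
      rcases mul_eq_zero.mp e with e | e
      · exact absurd (sub_eq_zero.mp e) c2
      · exact sub_eq_zero.mp e
    apply hsw (2 * n + 1) hk le_rfl
    have hl : (x ∘ sw (2 * n + 1)) (2 * n + 1) = q * x (2 * n + 1) := by
      rw [comp_sw_left]; exact c3
    refine Fd_fuse h hm IH ?_ ?_
    · have hc : ∀ a < 2 * n + 2, (x ∘ sw (2 * n + 1)) a ^ 3 = x a ^ 3 := by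
        intro a ha
        by_cases ha' : a = 2 * n + 1
        · subst ha'; rw [hl, mul_pow, h.cube, one_mul]
        · rw [comp_sw_of_ne x ha' (by omega)]
      refine ⟨fun a ha h0 => hx.1 a ha ?_, fun a b ha hb hab => ?_⟩
      · have := hc a ha
        rw [h0] at this
        exact pow_eq_zero_iff (three_ne_zero) |>.mp (by rw [← this]; norm_num)
      · rw [hc a ha, hc b hb]; exact hx.2 a b ha hb hab
    · rw [hl, show 2 * n + 2 = 2 * n + 1 + 1 from rfl, comp_sw_right]
      linear_combination (-x (2 * n + 1)) * h.mul
  | succ d ih =>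
    intro j hj hk x hx h3
    apply hsw j hk (by omega)
    refine ih (j + 1) (by omega) (by omega) _ ?_ ?_
    · have hb : ∀ a < 2 * n + 2, sw j a < 2 * n + 2 := by
        intro a ha; unfold sw; grind
      exact ⟨fun a ha => hx.1 _ (hb a ha), fun a b ha hb' hab =>
        hx.2 _ _ (hb a ha) (hb b hb') ((sw j).injective.ne hab)⟩
    · rw [comp_sw_right, comp_sw_of_ne x (by omega) (by omega)]
      exact h3

/-- Determinant representation of the emptiness formation sums. -/
theorem Fd_eq_zero {q p : ℂ} (h : Om q p) (n : ℕ) : ∀ m k, m + k = n + 1 → ∀ x,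
    Gen (2 * n + 1) x → Fd q p n m k x = 0 := by
  classical
  induction n with
  | zero =>
    intro m k hm x hx
    rcases Nat.eq_zero_or_pos m with rfl | hm0
    · obtain rfl : k = 1 := by omega
      exact Fd_top h 0 x
    · obtain rfl : k = 0 := by omega
      obtain rfl : m = 1 := by omega
      have hG : GG q p 0 0 = GG q p 0 1 := by
        rw [GG_eq, GG_eq]
        apply Finset.sum_congr rfl
        intro f _
        refine if_congr (and_congr_right fun hs => ?_) rfl rfl
        unfold Sec at hs
        simp only [Nat.mul_zero, Nat.zero_add, Finset.range_one, Finset.filter_singleton] at hs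
        simp only [Nat.lt_one_iff, forall_eq, Nat.not_lt_zero, false_implies, implies_true, true_iff]
        by_contra h0
        rw [if_neg h0] at hs
        simp at hs
      have hE : Ed 0 1 0 x = 1 := by
        unfold Ed
        refine (Matrix.det_fin_one _).trans ?_
        simp only [Emat, colE, Matrix.of_apply]
        have : tri (PP 0 (2 * 0 + 1) x) = 1 := by
          ext i
          rw [coeff_tri]
          simp [PP, Polynomial.coeff_one, Polynomial.coeff_X]
          grind
        simpa using congrArg (Polynomial.eval (x 0)) this
      unfold Fd
      rw [hG, GG_top h, hE]
      simp [sg, Vd, prs, Finset.filter_singleton]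
  | succ n ih =>
    intro m k hm x hx
    rcases Nat.eq_zero_or_pos m with rfl | hm0
    · obtain rfl : k = n + 1 + 1 := by omega
      exact Fd_top h (n + 1) x
    obtain ⟨m, rfl⟩ : ∃ m', m = m' + 1 := ⟨m - 1, by omega⟩
    obtain ⟨F, hF, hFe⟩ := exists_poly_Fd q p (n := n + 1) (m := m + 1) (k := k) (by omega)
      (by omega) (by omega) x
    rw [show 2 * (n + 1) = 2 * n + 2 by ring] at hFe
    have hup : ∀ t, Gen (2 * n + 2) (Function.update x (2 * n + 2) t) := by
      intro t
      have e : ∀ a < 2 * n + 2, Function.update x (2 * n + 2) t a = x a := fun a ha =>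
        Function.update_of_ne (by omega) ..
      refine ⟨fun a ha => ?_, fun a b ha hb hab => ?_⟩
      · rw [e a ha]; exact hx.1 a (by omega)
      · rw [e a ha, e b hb]; exact hx.2 a b (by omega) (by omega) hab
    have hroot : ∀ j ∈ Finset.Ico k (2 * n + 2), ∀ c : ℂ, c ^ 3 = 1 → F.eval (c * x j) = 0 := by
      intro j hj c hc
      have hj := Finset.mem_Ico.mp hj
      rw [hFe]
      refine Fd_root h (by omega) (ih m k (by omega)) (2 * n + 1 - j) j (by omega) hj.1 _ (hup _) ?_
      rw [Function.update_self, Function.update_of_ne (by omega), mul_pow, hc, one_mul]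
    have hF0 : F = 0 := by
      set L := 2 * n + 2 - k with hL
      have hqi : ∀ i j, i < 3 → j < 3 → q ^ i = q ^ j → i = j := by
        intro i j hi hj hij
        have h1 := h.ne_one
        have h2 := h.ne_one'
        have h3 := h.ne
        have h4 := h.sq
        interval_cases i <;> interval_cases j <;> first | rfl | skip
        all_goals
          exfalso
          simp only [pow_zero, pow_one, h4] at hij
          first
            | exact h1 hij | exact h1 hij.symm | exact h2 hij | exact h2 hij.symm
            | exact h3 hij | exact h3 hij.symm
      apply poly_zero_of_roots (Finset.range (3 * L + if m = 0 then 1 else 0))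
        (fun a => if a = 3 * L then 0 else q ^ (a % 3) * x (k + a / 3))
      · intro a ha b hb hab
        have ha := Finset.mem_range.mp ha
        have hb := Finset.mem_range.mp hb
        have ha' : a ≤ 3 * L := by split_ifs at ha <;> omega
        have hb' : b ≤ 3 * L := by split_ifs at hb <;> omega
        have hne : ∀ a, a < 3 * L → q ^ (a % 3) * x (k + a / 3) ≠ 0 := fun a ha =>
          mul_ne_zero (pow_ne_zero _ h.ne_zero) (hx.1 _ (by omega))
        by_cases h1 : a = 3 * L
        · by_cases h2 : b = 3 * L
          · rw [h1, h2]
          · rw [if_pos h1, if_neg h2] at hab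
            exact absurd hab.symm (hne b (by omega))
        · by_cases h2 : b = 3 * L
          · rw [if_neg h1, if_pos h2] at hab
            exact absurd hab (hne a (by omega))
          · rw [if_neg h1, if_neg h2] at hab
            have hd : a / 3 = b / 3 := by
              by_contra hdne
              refine hx.2 (k + a / 3) (k + b / 3) (by omega) (by omega) (by omega) ?_
              have h3 := congrArg (· ^ 3) hab
              simp only [mul_pow] at h3
              rwa [← pow_mul, ← pow_mul, mul_comm (a % 3), mul_comm (b % 3), pow_mul, pow_mul,
                h.cube, one_pow, one_pow, one_mul, one_mul] at h3
            rw [hd] at hab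
            have := hqi _ _ (Nat.mod_lt _ (by norm_num)) (Nat.mod_lt _ (by norm_num))
              (mul_right_cancel₀ (hx.1 (k + b / 3) (by omega)) hab)
            omega
      · intro a ha
        have ha := Finset.mem_range.mp ha
        by_cases h1 : a = 3 * L
        · rw [if_pos h1]
          have hm0 : m = 0 := by
            by_contra hmne
            rw [if_neg hmne] at ha
            omega
          subst hm0
          obtain rfl : k = n + 1 := by omega
          rw [hFe]
          exact Fd_zero h (by omega) (show Function.update x (2 * n + 2) 0 (2 * n + 2) = 0 by simp)
        · have ha' : a < 3 * L := by split_ifs at ha <;> omega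
          rw [if_neg h1]
          apply hroot
          · rw [Finset.mem_Ico]; omega
          · rw [← pow_mul, mul_comm, pow_mul, h.cube, one_pow]
      · rw [Finset.card_range]
        split_ifs <;> omega
    have := hFe (x (2 * n + 2))
    rw [Function.update_eq_self, hF0, Polynomial.eval_zero] at this
    exact this.symm

end XXZ

namespace XXZ

section Newton

open Polynomial

variable {S : Type*} [CommRing S]

/-- Iterated quotients in the Newton interpolation at the nodes `z`. -/
def nd (z : ℕ → S) (f : S[X]) : ℕ → S[X]
  | 0 => f
  | l + 1 => nd z f l /ₘ (X - C (z l))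

lemma nd_step (z : ℕ → S) (f : S[X]) (l : ℕ) :
    nd z f l = C ((nd z f l).eval (z l)) + (X - C (z l)) * nd z f (l + 1) := by
  conv_lhs => rw [← modByMonic_add_div (nd z f l) (X - C (z l))]
  rw [modByMonic_X_sub_C_eq_C_eval, nd]

lemma nd_expand (z : ℕ → S) (f : S[X]) (M : ℕ) :
    f = ∑ l ∈ Finset.range M, C ((nd z f l).eval (z l)) * ∏ i ∈ Finset.range l, (X - C (z i))
      + (∏ i ∈ Finset.range M, (X - C (z i))) * nd z f M := by
  induction M with
  | zero => simp [nd]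
  | succ M ih =>
    rw [Finset.sum_range_succ, Finset.prod_range_succ]
    conv_lhs => rw [ih, nd_step z f M]
    ring

lemma nd_map {S' : Type*} [CommRing S'] (φ : S →+* S') (z : ℕ → S) (f : S[X]) (l : ℕ) :
    (nd z f l).map φ = nd (φ ∘ z) (f.map φ) l := by
  induction l with
  | zero => rfl
  | succ l ih =>
    rw [nd, nd, map_divByMonic _ (monic_X_sub_C _), ih]
    simp

lemma det_eval_eq [Nontrivial S] {M : ℕ} (z : ℕ → S) (f : Fin M → S[X]) :
    (Matrix.of fun r c : Fin M => (f c).eval (z r)).det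
      = (Matrix.vandermonde fun r : Fin M => z r).det
        * (Matrix.of fun l c : Fin M => (nd z (f c) l).eval (z l)).det := by
  have hmon : ∀ l, ∀ i ∈ Finset.range l, (X - C (z i)).Monic := fun l i _ => monic_X_sub_C _
  rw [Matrix.det_eval_matrixOfPolynomials_eq_det_vandermonde _
    (fun l : Fin M => ∏ i ∈ Finset.range l.val, (X - C (z i)))
    (fun l => by rw [natDegree_prod_of_monic _ _ (hmon _)]; simp)
    (fun l => monic_prod_of_monic _ _ (hmon _)), ← Matrix.det_mul]
  congr 1
  ext r c
  rw [Matrix.mul_apply, Matrix.of_apply]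
  conv_lhs => rw [nd_expand z (f c) M]
  have h0 : (∏ i ∈ Finset.range M, (X - C (z i))).eval (z r) = 0 := by
    rw [eval_prod]
    exact Finset.prod_eq_zero (Finset.mem_range.mpr r.isLt) (by simp)
  rw [eval_add, eval_mul, h0, zero_mul, add_zero, eval_finsetSum, Finset.sum_range]
  refine Finset.sum_congr rfl fun l _ => ?_
  simp only [eval_mul, eval_C, Matrix.of_apply]
  ring

lemma nd_const (a : S) (f : S[X]) (l : ℕ) :
    (nd (fun _ => a) f l).eval a = (taylor a f).coeff l := by
  have key : ∀ l j, (taylor a (nd (fun _ => a) f l)).coeff j = (taylor a f).coeff (j + l) := by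
    intro l
    induction l with
    | zero => intro j; rfl
    | succ l ih =>
      intro j
      rw [← add_assoc, add_right_comm, ← ih (j + 1)]
      conv_rhs => rw [nd_step]
      rw [map_add, taylor_mul, map_sub, taylor_X, taylor_C, taylor_C, add_sub_cancel_right,
        coeff_add, coeff_X_mul, coeff_C_succ, zero_add]
  rw [← zero_add l, ← key, taylor_coeff_zero, zero_add]

end Newton

lemma GG_mul_Vd {q p : ℂ} (h : Om q p) {n m k : ℕ} (hm : m + k = n + 1) :
    GG q p n k * Vd n (n + m) MvPolynomial.X
      = MvPolynomial.C (sg m) * (∏ e ∈ prs k, (MvPolynomial.X e.1 ^ 2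
        + MvPolynomial.X e.1 * MvPolynomial.X e.2 + MvPolynomial.X e.2 ^ 2))
        * Ed n m k MvPolynomial.X := by
  apply eq_of_gen (2 * n + 1)
  intro x hx
  have h0 := Fd_eq_zero h n m k hm x hx
  have h1 := Vd_map (MvPolynomial.eval x) n (n + m) MvPolynomial.X
  have h2 := Ed_map (MvPolynomial.eval x) n m k MvPolynomial.X
  have hc : (MvPolynomial.eval x) ∘ (MvPolynomial.X : ℕ → R) = x := by
    funext i; simp
  rw [hc] at h1 h2
  rw [map_mul, map_mul, map_mul, h1, h2, map_prod, MvPolynomial.eval_C]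
  unfold Fd qd at h0
  simpa using sub_eq_zero.mp h0

/-- The homogeneous determinant. -/
def Dt (n m : ℕ) (P : Polynomial ℂ) : ℂ :=
  (Matrix.of fun l c : Fin (n + m) => (Polynomial.taylor 1 (colE n P c.val)).coeff l.val).det

lemma ev1_GG {q p : ℂ} (h : Om q p) {n m k : ℕ} (hm : m + k = n + 1) :
    ev1 (GG q p n k) = sg m * 3 ^ (k.choose 2)
      * Dt n m ((Polynomial.X - Polynomial.C 1) ^ (2 * n + 1 + k)) := by
  have hG := GG_mul_Vd h hm
  set z : ℕ → R := fun r => MvPolynomial.X (2 * n - r) with hz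
  have hE : Ed n m k (MvPolynomial.X : ℕ → R) = Vd n (n + m) MvPolynomial.X
      * (Matrix.of fun l c : Fin (n + m) =>
        (nd z (colE n (PP k (2 * n + 1) MvPolynomial.X) c.val) l).eval (z l)).det :=
    det_eval_eq z fun c : Fin (n + m) => colE n (PP k (2 * n + 1) MvPolynomial.X) c.val
  have hV : Vd n (n + m) (MvPolynomial.X : ℕ → R) ≠ 0 := by
    unfold Vd
    rw [Matrix.det_vandermonde_ne_zero_iff]
    intro a b hab
    have := MvPolynomial.X_injective hab
    exact Fin.ext (by omega)
  rw [hE] at hG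
  have hG' := mul_right_cancel₀ hV (hG.trans (by ring :
    _ = (MvPolynomial.C (sg m) * (∏ e ∈ prs k, (MvPolynomial.X e.1 ^ 2
        + MvPolynomial.X e.1 * MvPolynomial.X e.2 + MvPolynomial.X e.2 ^ 2))
      * (Matrix.of fun l c : Fin (n + m) =>
        (nd z (colE n (PP k (2 * n + 1) MvPolynomial.X) c.val) l).eval (z l)).det)
        * Vd n (n + m) MvPolynomial.X))
  have hcard : ∀ k, (prs k).card = k.choose 2 := by
    intro k
    induction k with
    | zero => simp [prs]
    | succ k ih =>
      have : prs (k + 1) = prs k ∪ (Finset.range k).image fun i => (i, k) := by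
        ext ⟨a, b⟩
        simp only [mem_prs, Finset.mem_union, Finset.mem_image, Finset.mem_range, Prod.mk.injEq]
        constructor
        · intro hab
          by_cases hb : b = k
          · exact Or.inr ⟨a, by omega, rfl, hb.symm⟩
          · left; omega
        · rintro (hab | ⟨i, hi, rfl, rfl⟩) <;> omega
      rw [this, Finset.card_union_of_disjoint, Finset.card_image_of_injective, ih,
        Finset.card_range, Nat.choose_succ_succ' k 1, Nat.choose_one_right, add_comm]
      · intro a b hab; simpa using hab
      · rw [Finset.disjoint_left]
        rintro e he he'
        obtain ⟨i, hi, rfl⟩ := Finset.mem_image.mp he'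
        have := mem_prs.mp he
        simp only at this
        omega
  have hev : ∀ i, MvPolynomial.eval (fun _ : ℕ => (1 : ℂ)) (MvPolynomial.X i) = 1 := fun i => by
    simp
  unfold ev1
  rw [hG', map_mul, map_mul, map_prod, MvPolynomial.eval_C]
  congr 1
  · congr 1
    simp only [map_add, map_mul, map_pow, hev]
    rw [Finset.prod_const, hcard]
    norm_num
  · unfold Dt
    rw [RingHom.map_det]
    congr 1
    ext l c
    simp only [RingHom.mapMatrix_apply, Matrix.map_apply, Matrix.of_apply]
    rw [← Polynomial.eval_map_apply, nd_map]
    have e1 : (MvPolynomial.eval (fun _ : ℕ => (1 : ℂ))) ∘ z = fun _ => 1 := by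
      funext r; simp [hz]
    have e2 : (colE n (PP k (2 * n + 1) MvPolynomial.X) c.val).map
        (MvPolynomial.eval (fun _ : ℕ => (1 : ℂ)))
        = colE n ((Polynomial.X - Polynomial.C 1) ^ (2 * n + 1 + k)) c.val := by
      have e3 : (PP k (2 * n + 1) MvPolynomial.X).map (MvPolynomial.eval (fun _ : ℕ => (1 : ℂ)))
          = (Polynomial.X - Polynomial.C 1) ^ (2 * n + 1 + k) := by
        rw [PP_map]
        simp only [PP, Function.comp, hev, Finset.prod_const, Nat.card_Ico, Finset.card_range]
        rw [← pow_mul, ← pow_add]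
        congr 1; omega
      unfold colE
      split_ifs
      · simp
      · rw [map_tri, Polynomial.map_mul, Polynomial.map_pow, Polynomial.map_X, e3]
    rw [e1, e2, hz]
    simp only [hev]
    exact nd_const 1 _ _

end XXZ

namespace XXZ

section Functionals

open Polynomial

/-- The determinant of a sequence of functionals applied to a sequence of polynomials. -/
def dm (m : ℕ) (L : ℕ → ℂ[X] →ₗ[ℂ] ℂ) (P : ℕ → ℂ[X]) : ℂ :=
  (Matrix.of fun i s : Fin m => L i.val (P s.val)).det

lemma dm_scale {m : ℕ} {L L' : ℕ → ℂ[X] →ₗ[ℂ] ℂ} {P P' : ℕ → ℂ[X]} (a b : ℕ → ℂ)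
    (h : ∀ i < m, ∀ s < m, L i (P s) = a i * b s * L' i (P' s)) :
    dm m L P = (∏ i ∈ Finset.range m, a i) * (∏ s ∈ Finset.range m, b s) * dm m L' P' := by
  unfold dm
  have : (Matrix.of fun i s : Fin m => L i.val (P s.val))
      = Matrix.of fun i s : Fin m => b s.val *
        (Matrix.of fun i s : Fin m => a i.val * L' i.val (P' s.val)) i s := by
    ext i s
    simp only [Matrix.of_apply]
    rw [h i i.isLt s s.isLt]; ring
  rw [this, Matrix.det_mul_row]
  have := Matrix.det_mul_column (fun i : Fin m => a i.val)
    (Matrix.of fun i s : Fin m => L' i.val (P' s.val))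
  simp only [Matrix.of_apply] at this
  rw [this, Finset.prod_range, Finset.prod_range]
  ring

lemma dm_eq {m : ℕ} (L : ℕ → ℂ[X] →ₗ[ℂ] ℂ) (P : ℕ → ℂ[X]) (hP : ∀ s < m, (P s).natDegree < m) :
    dm m L P = dm m L (fun t => X ^ t) * dm m (fun t => lcoeff ℂ t) P := by
  unfold dm
  rw [← Matrix.det_mul]
  congr 1
  ext i s
  rw [Matrix.mul_apply]
  simp only [Matrix.of_apply, lcoeff_apply]
  conv_lhs => rw [as_sum_range' (P s) m (hP s s.isLt)]
  rw [map_sum, Finset.sum_range]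
  refine Finset.sum_congr rfl fun t _ => ?_
  rw [← C_mul_X_pow_eq_monomial, ← smul_eq_C_mul, map_smul, smul_eq_mul, mul_comm]

lemma dm_transpose_scale {m : ℕ} {L L' : ℕ → ℂ[X] →ₗ[ℂ] ℂ} {P P' : ℕ → ℂ[X]} (a b : ℕ → ℂ)
    (h : ∀ i < m, ∀ s < m, L i (P s) = a i * b s * L' s (P' i)) :
    dm m L P = (∏ i ∈ Finset.range m, a i) * (∏ s ∈ Finset.range m, b s) * dm m L' P' := by
  unfold dm
  rw [← Matrix.det_transpose]
  have : (Matrix.of fun i s : Fin m => L i.val (P s.val)).transpose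
      = Matrix.of fun i s : Fin m => a s.val *
        (Matrix.of fun i s : Fin m => b i.val * L' i.val (P' s.val)) i s := by
    ext i s
    simp only [Matrix.of_apply, Matrix.transpose_apply]
    rw [h s s.isLt i i.isLt]; ring
  rw [this, Matrix.det_mul_row]
  have := Matrix.det_mul_column (fun i : Fin m => b i.val)
    (Matrix.of fun i s : Fin m => L' i.val (P' s.val))
  simp only [Matrix.of_apply] at this
  rw [this, Finset.prod_range, Finset.prod_range]
  ring

lemma dm_lower {m : ℕ} {L : ℕ → ℂ[X] →ₗ[ℂ] ℂ} {P : ℕ → ℂ[X]}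
    (h : ∀ i s, i < s → s < m → L i (P s) = 0) :
    dm m L P = ∏ s ∈ Finset.range m, L s (P s) := by
  unfold dm
  rw [Matrix.det_of_isLowerTriangular, Finset.prod_range]
  · rfl
  · intro i j hij
    exact h i j hij j.isLt

lemma dm_coeff_upper {m : ℕ} {P : ℕ → ℂ[X]} (hP : ∀ s < m, (P s).natDegree ≤ s) :
    dm m (fun t => lcoeff ℂ t) P = ∏ s ∈ Finset.range m, (P s).coeff s := by
  unfold dm
  rw [Matrix.det_of_isUpperTriangular, Finset.prod_range]
  · rfl
  · intro i j hij
    exact coeff_eq_zero_of_natDegree_lt (lt_of_le_of_lt (hP j j.isLt) hij)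

lemma dm_upper {m : ℕ} (L : ℕ → ℂ[X] →ₗ[ℂ] ℂ) {P : ℕ → ℂ[X]}
    (hP : ∀ s < m, (P s).natDegree ≤ s) :
    dm m L P = dm m L (fun t => X ^ t) * ∏ s ∈ Finset.range m, (P s).coeff s := by
  rw [dm_eq L P fun s hs => lt_of_le_of_lt (hP s hs) hs, dm_coeff_upper hP]

lemma dm_monic {m : ℕ} (L : ℕ → ℂ[X] →ₗ[ℂ] ℂ) {P : ℕ → ℂ[X]}
    (hP : ∀ s < m, (P s).natDegree = s) (hm : ∀ s < m, (P s).Monic) :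
    dm m L P = dm m L (fun t => X ^ t) := by
  rw [dm_upper L fun s hs => (hP s hs).le, Finset.prod_eq_one, mul_one]
  intro s hs
  rw [Finset.mem_range] at hs
  have := hm s hs
  rw [Monic, leadingCoeff, hP s hs] at this
  exact this

lemma dm_pow_nat (m : ℕ) : dm m (fun i => leval (i : ℂ)) (fun t => X ^ t)
    = ∏ s ∈ Finset.range m, (s.factorial : ℂ) := by
  rw [← dm_monic _ (fun s _ => descPochhammer_natDegree ℂ s) (fun s _ => monic_descPochhammer ℂ s),
    dm_lower]
  · simp only [leval_apply, descPochhammer_eval_eq_descFactorial, Nat.descFactorial_self]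
  · intro i s his _
    rw [leval_apply, descPochhammer_eval_eq_descFactorial, Nat.descFactorial_of_lt his,
      Nat.cast_zero]

lemma dm_newton {m : ℕ} {P : ℕ → ℂ[X]} (hP : ∀ s < m, (P s).natDegree < m) (d : ℕ → ℂ)
    (h0 : ∀ i s, i < s → s < m → (P s).eval (i : ℂ) = 0)
    (hd : ∀ s < m, (P s).eval (s : ℂ) = s.factorial * d s) :
    dm m (fun t => lcoeff ℂ t) P = ∏ s ∈ Finset.range m, d s := by
  have h1 := dm_eq (fun i : ℕ => leval (i : ℂ)) P hP
  rw [dm_lower (L := fun i : ℕ => leval (i : ℂ)) h0, dm_pow_nat,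
    Finset.prod_congr rfl fun (s : ℕ) hs =>
      show leval (s : ℂ) (P s) = _ from hd s (Finset.mem_range.mp hs),
    Finset.prod_mul_distrib] at h1
  refine (mul_left_cancel₀ ?_ h1).symm
  exact Finset.prod_ne_zero_iff.mpr fun s _ => Nat.cast_ne_zero.mpr s.factorial_ne_zero

end Functionals

end XXZ

namespace XXZ

section Columns

open Polynomial

/-- The functional pairing the coefficients of `f` with the values at the natural numbers. -/
def fn (f : ℂ[X]) : ℂ[X] →ₗ[ℂ] ℂ := ∑ a ∈ f.support, f.coeff a • leval (a : ℂ)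

lemma fn_apply (f b : ℂ[X]) : fn f b = ∑ a ∈ f.support, f.coeff a * b.eval (a : ℂ) := by
  simp [fn, LinearMap.sum_apply]

lemma fn_eq_range (f b : ℂ[X]) {N : ℕ} (hN : f.natDegree < N) :
    fn f b = ∑ a ∈ Finset.range N, f.coeff a * b.eval (a : ℂ) := by
  rw [fn_apply]
  refine Finset.sum_subset (fun a ha => ?_) fun a _ ha => ?_
  · rw [Finset.mem_range]
    exact lt_of_le_of_lt (le_natDegree_of_mem_supp a ha) hN
  · rw [notMem_support_iff.mp ha, zero_mul]

lemma fn_X_pow (a : ℕ) (b : ℂ[X]) : fn (X ^ a) b = b.eval (a : ℂ) := by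
  rw [fn_eq_range _ _ (Nat.lt_succ_of_le (natDegree_X_pow_le a)), Finset.sum_eq_single a]
  · simp
  · intro c _ hc
    rw [coeff_X_pow, if_neg hc, zero_mul]
  · simp

lemma coeff_taylor_one (f : ℂ[X]) (l : ℕ) :
    (taylor 1 f).coeff l = fn f (C ((l.factorial : ℂ)⁻¹) * descPochhammer ℂ l) := by
  rw [taylor_coeff, hasseDeriv_apply, Polynomial.sum, eval_finsetSum, fn_apply]
  refine Finset.sum_congr rfl fun a _ => ?_
  rw [eval_monomial, one_pow, mul_one, eval_mul, eval_C, descPochhammer_eval_eq_descFactorial,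
    Nat.descFactorial_eq_factorial_mul_choose, Nat.cast_mul, inv_mul_cancel_left₀, mul_comm]
  exact Nat.cast_ne_zero.mpr l.factorial_ne_zero

lemma Dt_eq (n m : ℕ) (P : ℂ[X]) : Dt n m P =
    (∏ l ∈ Finset.range (n + m), (l.factorial : ℂ)⁻¹) *
      dm (n + m) (fun c => fn (colE n P c)) (fun t => X ^ t) := by
  rw [← dm_monic _ (fun s _ => descPochhammer_natDegree ℂ s) (fun s _ => monic_descPochhammer ℂ s)]
  have := dm_scale (m := n + m) (L := fun c => fn (colE n P c)) (L' := fun c => fn (colE n P c))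
    (P := fun l => C ((l.factorial : ℂ)⁻¹) * descPochhammer ℂ l)
    (P' := fun l => descPochhammer ℂ l) (fun _ => 1) (fun l => (l.factorial : ℂ)⁻¹) (by
      intro i _ s _
      rw [← smul_eq_C_mul, map_smul, smul_eq_mul, one_mul])
  rw [Finset.prod_const_one, one_mul] at this
  rw [← this, Dt, dm, ← Matrix.det_transpose]
  congr 1
  ext c l
  simp only [Matrix.transpose_apply, Matrix.of_apply]
  exact coeff_taylor_one _ _

/-- The monic polynomial vanishing at `3 l + 1` for `l < n`. -/
def Ct (n : ℕ) : ℂ[X] := ∏ l ∈ Finset.range n, (X - C (3 * (l : ℂ) + 1))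

/-- The monic polynomial vanishing at `3 l` for `l < i`. -/
def bt (i : ℕ) : ℂ[X] := ∏ l ∈ Finset.range i, (X - C (3 * (l : ℂ)))

lemma Ct_monic (n : ℕ) : (Ct n).Monic := monic_prod_of_monic _ _ fun _ _ => monic_X_sub_C _

lemma bt_monic (n : ℕ) : (bt n).Monic := monic_prod_of_monic _ _ fun _ _ => monic_X_sub_C _

lemma Ct_natDegree (n : ℕ) : (Ct n).natDegree = n := by
  rw [Ct, natDegree_prod_of_monic _ _ fun _ _ => monic_X_sub_C _]
  simp only [natDegree_X_sub_C, Finset.sum_const, Finset.card_range, smul_eq_mul, mul_one]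

lemma bt_natDegree (n : ℕ) : (bt n).natDegree = n := by
  rw [bt, natDegree_prod_of_monic _ _ fun _ _ => monic_X_sub_C _]
  simp only [natDegree_X_sub_C, Finset.sum_const, Finset.card_range, smul_eq_mul, mul_one]

lemma Ct_eval_zero {n c : ℕ} (hc : c < n) : (Ct n).eval (3 * (c : ℂ) + 1) = 0 := by
  rw [Ct, eval_prod]
  exact Finset.prod_eq_zero (Finset.mem_range.mpr hc) (by simp)

lemma bt_eval (i j : ℕ) : (bt i).eval (3 * (j : ℂ)) = 3 ^ i * (j.descFactorial i : ℂ) := by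
  rw [bt, eval_prod, ← descPochhammer_eval_eq_descFactorial, descPochhammer_eval_eq_prod_range]
  rw [← Finset.card_range i, ← Finset.prod_const, Finset.card_range, ← Finset.prod_mul_distrib]
  refine Finset.prod_congr rfl fun l _ => ?_
  rw [eval_sub, eval_X, eval_C]; ring

lemma dm_colE (n m : ℕ) (P : ℂ[X]) :
    dm (n + m) (fun c => fn (colE n P c)) (fun t => X ^ t)
      = dm n (fun c => leval (3 * (c : ℂ) + 1)) (fun t => X ^ t) *
        dm m (fun s => fn (tri (X ^ s * P))) (fun i => Ct n * bt i) := by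
  set g : ℕ → ℂ[X] := fun l => if l < n then X ^ l else Ct n * bt (l - n) with hg
  rw [← dm_monic (P := g)]
  · unfold dm
    rw [← Matrix.det_submatrix_equiv_self (finSumFinEquiv (m := n) (n := m))]
    rw [← Matrix.det_fromBlocks_zero₁₂ _ (Matrix.of fun (s : Fin m) (l : Fin n) =>
      fn (tri (X ^ s.val * P)) (X ^ l.val))]
    congr 1
    ext c l
    rcases c with c | c <;> rcases l with l | l
    · simp [hg, colE, c.isLt, l.isLt, fn_X_pow]
    · simp [hg, colE, c.isLt, fn_X_pow, Ct_eval_zero]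
    · simp [hg, colE]
    · simp [hg, colE]
  · intro s _
    simp only [hg]
    split_ifs with h
    · simp
    · rw [(Ct_monic n).natDegree_mul (bt_monic _), Ct_natDegree, bt_natDegree]; omega
  · intro s _
    simp only [hg]
    split_ifs with h
    · exact monic_X_pow s
    · exact (Ct_monic n).mul (bt_monic _)

lemma fn_tri {n : ℕ} {F : ℂ[X]} (hF : F.natDegree ≤ 3 * n + 1) (b : ℂ[X]) :
    fn (tri F) b = ∑ j ∈ Finset.range (n + 1), F.coeff (3 * j + 1) * b.eval (3 * (j : ℂ)) := by
  have hd : (tri F).natDegree < 3 * n + 1 := by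
    rw [Nat.lt_succ_iff, natDegree_le_iff_coeff_eq_zero]
    intro i hi
    rw [coeff_tri]
    split_ifs with h
    · exact coeff_eq_zero_of_natDegree_lt (by omega)
    · rfl
  rw [fn_eq_range _ _ hd]
  symm
  refine Finset.sum_of_injOn (fun j => 3 * j) (fun a _ b _ h => ?_) (fun j hj => ?_) ?_ ?_
  · exact Nat.eq_of_mul_eq_mul_left (by norm_num) h
  · simp only [Finset.coe_range, Set.mem_Iio] at hj ⊢
    omega
  · intro i hi hni
    rw [coeff_tri, if_neg, zero_mul]
    rintro ⟨j, rfl⟩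
    refine hni ⟨j, ?_, rfl⟩
    simp only [Finset.coe_range, Set.mem_Iio, Finset.mem_range] at hi ⊢
    omega
  · intro j _
    rw [coeff_tri, if_pos (dvd_mul_right 3 j)]
    push_cast
    rfl

end Columns

end XXZ

namespace XXZ

section Entries

open Polynomial

/-- The product `4 · 7 · … · (3 j + 1)`. -/
def Af (j : ℕ) : ℂ := ∏ i ∈ Finset.range j, (3 * (i : ℂ) + 4)

/-- The product `2 · 5 · … · (3 j - 1)`. -/
def Bf (j : ℕ) : ℂ := ∏ i ∈ Finset.range j, (3 * (i : ℂ) + 2)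

/-- The product `1 · 4 · … · (3 d - 2)`. -/
def Af' (d : ℕ) : ℂ := ∏ i ∈ Finset.range d, (3 * (i : ℂ) + 1)

lemma Af_ne_zero (j : ℕ) : Af j ≠ 0 :=
  Finset.prod_ne_zero_iff.mpr fun i _ => by
    have : ((3 * i + 4 : ℕ) : ℂ) ≠ 0 := Nat.cast_ne_zero.mpr (by omega)
    push_cast at this; exact this

lemma Bf_ne_zero (j : ℕ) : Bf j ≠ 0 :=
  Finset.prod_ne_zero_iff.mpr fun i _ => by
    have : ((3 * i + 2 : ℕ) : ℂ) ≠ 0 := Nat.cast_ne_zero.mpr (by omega)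
    push_cast at this; exact this

lemma fac_ne_zero (j : ℕ) : (j.factorial : ℂ) ≠ 0 := Nat.cast_ne_zero.mpr j.factorial_ne_zero

lemma factorial_three_mul_add_one (j : ℕ) :
    ((3 * j + 1).factorial : ℂ) = 3 ^ j * j.factorial * Af j * Bf j := by
  induction j with
  | zero => simp [Af, Bf]
  | succ j ih =>
    rw [show 3 * (j + 1) + 1 = 3 * j + 1 + 1 + 1 + 1 by ring, Nat.factorial_succ, Nat.factorial_succ,
      Nat.factorial_succ, Nat.factorial_succ j, Af, Bf, Finset.prod_range_succ,
      Finset.prod_range_succ, ← Af, ← Bf]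
    push_cast
    rw [ih]
    ring

lemma factorial_three_mul (d : ℕ) :
    ((3 * d).factorial : ℂ) = 3 ^ d * d.factorial * Bf d * Af' d := by
  induction d with
  | zero => simp [Af', Bf]
  | succ d ih =>
    rw [show 3 * (d + 1) = 3 * d + 1 + 1 + 1 by ring, Nat.factorial_succ, Nat.factorial_succ,
      Nat.factorial_succ, Nat.factorial_succ d, Af', Bf, Finset.prod_range_succ,
      Finset.prod_range_succ, ← Af', ← Bf]
    push_cast
    rw [ih]
    ring

lemma Ct_eval (j d : ℕ) : (Ct (j + d)).eval (3 * (j : ℂ)) = (-1) ^ d * Bf j * Af' d := by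
  induction d with
  | zero =>
    rw [add_zero, Ct, eval_prod, ← Finset.prod_range_reflect, Bf, Af', Finset.prod_range_zero,
      pow_zero, one_mul, mul_one]
    refine Finset.prod_congr rfl fun l hl => ?_
    rw [Finset.mem_range] at hl
    rw [eval_sub, eval_X, eval_C, Nat.cast_sub (by omega), Nat.cast_sub (by omega)]
    push_cast; ring
  | succ d ih =>
    rw [← add_assoc, Ct, Finset.prod_range_succ, ← Ct, eval_mul, ih,
      show Af' (d + 1) = Af' d * (3 * (d : ℂ) + 1) from Finset.prod_range_succ _ _, eval_sub, eval_X, eval_C]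
    push_cast; ring

lemma coeff_X_pow_mul_sub_one_pow {j d m s h : ℕ} (hs : s < m) (hh : m + h = 3 * (j + d) + 2) :
    (X ^ s * (X - C 1) ^ h : ℂ[X]).coeff (3 * j + 1) * ((3 * j + 1).factorial * (3 * d).factorial)
      = (-1) ^ (d + (m - 1 - s)) * h.factorial *
        ((3 * j + 1).descFactorial s * (3 * d).descFactorial (m - 1 - s)) := by
  rw [coeff_X_pow_mul', sub_eq_add_neg, ← C_neg]
  split_ifs with h1
  · rw [coeff_X_add_C_pow]
    by_cases h2 : m - 1 - s ≤ 3 * d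
    · have hle : 3 * j + 1 - s ≤ h := by omega
      have hsub : h - (3 * j + 1 - s) = 3 * d - (m - 1 - s) := by omega
      have e1 := Nat.choose_mul_factorial_mul_factorial hle
      have e2 := Nat.factorial_mul_descFactorial h1
      have e3 := Nat.factorial_mul_descFactorial h2
      rw [hsub] at e1 ⊢
      rw [← e1, ← e2, ← e3]
      have e4 : (-1 : ℂ) ^ (3 * d - (m - 1 - s)) = (-1) ^ (d + (m - 1 - s)) := by
        rw [neg_one_pow_eq_pow_mod_two, neg_one_pow_eq_pow_mod_two (n := d + (m - 1 - s))]
        congr 1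
        omega
      rw [e4]
      push_cast
      ring
    · rw [Nat.choose_eq_zero_of_lt (by omega),
        Nat.descFactorial_of_lt (n := 3 * d) (by omega)]
      simp
  · rw [Nat.descFactorial_of_lt (n := 3 * j + 1) (by omega)]
    simp

/-- The discrete functionals whose moments occur in the evaluation of the determinant. -/
def LL (n i : ℕ) : ℂ[X] →ₗ[ℂ] ℂ := ∑ j ∈ Finset.range (n + 1),
  ((j.descFactorial i : ℂ) / (j.factorial * (n - j).factorial * Af j * Bf (n - j))) •
    leval (3 * (j : ℂ) + 1)

lemma LL_apply (n i : ℕ) (f : ℂ[X]) : LL n i f = ∑ j ∈ Finset.range (n + 1),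
    ((j.descFactorial i : ℂ) / (j.factorial * (n - j).factorial * Af j * Bf (n - j))) *
      f.eval (3 * (j : ℂ) + 1) := by
  simp [LL, LinearMap.sum_apply]

/-- A product of two falling factorials of complementary degrees. -/
def ee (n m s : ℕ) : ℂ[X] :=
  descPochhammer ℂ s * (descPochhammer ℂ (m - 1 - s)).comp (C (3 * (n : ℂ) + 1) - X)

lemma ee_eval {n a : ℕ} (m s : ℕ) (ha : a ≤ 3 * n + 1) : (ee n m s).eval (a : ℂ)
    = a.descFactorial s * (3 * n + 1 - a).descFactorial (m - 1 - s) := by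
  rw [ee, eval_mul, eval_comp, eval_sub, eval_C, eval_X]
  rw [show (3 * (n : ℂ) + 1 - a) = ((3 * n + 1 - a : ℕ) : ℂ) by rw [Nat.cast_sub ha]; push_cast; rfl]
  rw [descPochhammer_eval_eq_descFactorial, descPochhammer_eval_eq_descFactorial]

lemma fn_tri_eq {n m s h : ℕ} (i : ℕ) (hs : s < m) (hh : m + h = 3 * n + 2) :
    fn (tri (X ^ s * (X - C 1) ^ h)) (Ct n * bt i)
      = ((-1) ^ (m - 1 - s) * (h.factorial / 3 ^ n)) * 3 ^ i * LL n i (ee n m s) := by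
  have hF : (X ^ s * (X - C 1) ^ h : ℂ[X]).natDegree ≤ 3 * n + 1 := by
    rw [(monic_X_pow s).natDegree_mul ((monic_X_sub_C 1).pow h), natDegree_X_pow,
      (monic_X_sub_C 1).natDegree_pow, natDegree_X_sub_C]
    omega
  rw [fn_tri hF, LL_apply, Finset.mul_sum]
  refine Finset.sum_congr rfl fun j hj => ?_
  rw [Finset.mem_range] at hj
  obtain ⟨d, rfl⟩ : ∃ d, n = j + d := ⟨n - j, by omega⟩
  have e1 := coeff_X_pow_mul_sub_one_pow hs hh
  have e2 := ee_eval (n := j + d) (a := 3 * j + 1) m s (by omega)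
  rw [show 3 * (j + d) + 1 - (3 * j + 1) = 3 * d by omega] at e2
  push_cast at e2
  have hne : (((3 * j + 1).factorial : ℂ) * (3 * d).factorial) ≠ 0 :=
    mul_ne_zero (fac_ne_zero _) (fac_ne_zero _)
  rw [← eq_div_iff hne] at e1
  have hd2 : (-1 : ℂ) ^ d * (-1) ^ d = 1 := by rw [← mul_pow]; norm_num
  have hA : Af' d ≠ 0 := by
    intro h0
    have := factorial_three_mul d
    rw [h0, mul_zero] at this
    exact fac_ne_zero _ this
  rw [e1, eval_mul, Ct_eval, bt_eval, e2, factorial_three_mul_add_one, factorial_three_mul,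
    Nat.add_sub_cancel_left, pow_add, pow_add]
  have := Af_ne_zero j
  have := Bf_ne_zero j
  have := Bf_ne_zero d
  have := fac_ne_zero j
  have := fac_ne_zero d
  field_simp
  linear_combination ((h.factorial : ℂ) * ((3 * j + 1).descFactorial s : ℂ) *
    ((3 * d).descFactorial (m - 1 - s)) * (j.descFactorial i)) * hd2

end Entries

end XXZ

namespace XXZ

section Moments

open Polynomial

lemma natDegree_desc_comp_le (k : ℕ) {f : ℂ[X]} (hf : f.natDegree ≤ 1) :
    ((descPochhammer ℂ k).comp f).natDegree ≤ k :=
  natDegree_comp_le.trans (by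
    rw [descPochhammer_natDegree]
    exact (Nat.mul_le_mul_left k hf).trans (mul_one k).le)

lemma natDegree_desc_mul_desc_comp_lt {m s : ℕ} (hs : s < m) {f : ℂ[X]} (hf : f.natDegree ≤ 1) :
    (descPochhammer ℂ s * (descPochhammer ℂ (m - 1 - s)).comp f).natDegree < m := by
  have h1 := natDegree_mul_le (p := descPochhammer ℂ s)
    (q := (descPochhammer ℂ (m - 1 - s)).comp f)
  have h2 := natDegree_desc_comp_le (m - 1 - s) hf
  rw [descPochhammer_natDegree] at h1
  omega

lemma dm_LL_ee {n m : ℕ} (hm : m ≤ n + 1) : dm m (LL n) (ee n m)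
    = dm m (LL n) (fun t => X ^ t) *
      ∏ s ∈ Finset.range m, ((3 * n + 1 - s).descFactorial (m - 1 - s) : ℂ) := by
  have hdeg : ∀ s < m, (ee n m s).natDegree < m := fun s hs =>
    natDegree_desc_mul_desc_comp_lt hs (natDegree_sub_le_of_le (natDegree_C _).le natDegree_X_le)
  rw [dm_eq (LL n) (ee n m) hdeg, dm_newton hdeg]
  · intro i s his hs
    rw [ee_eval m s (by omega), Nat.descFactorial_of_lt his, Nat.cast_zero, zero_mul]
  · intro s hs
    rw [ee_eval m s (by omega), Nat.descFactorial_self]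

/-- A rescaled and reflected falling factorial. -/
def gp (n s : ℕ) : ℂ[X] :=
  (descPochhammer ℂ s).comp (C (-1 / 3 : ℂ) * X + C ((n : ℂ) + 1 / 3))

lemma gp_eval {n j d : ℕ} (s : ℕ) (h : j + d = n) :
    (gp n s).eval (3 * (j : ℂ) + 1) = d.descFactorial s := by
  subst h
  rw [gp, eval_comp, ← descPochhammer_eval_eq_descFactorial]
  congr 1
  simp only [eval_add, eval_mul, eval_C, eval_X]
  push_cast; ring

lemma gp_coeff (n s : ℕ) : (gp n s).natDegree ≤ s ∧ (gp n s).coeff s = (-1 / 3) ^ s := by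
  have h1 : (C (-1 / 3 : ℂ) * X + C ((n : ℂ) + 1 / 3)).natDegree = 1 :=
    natDegree_linear (by norm_num)
  have h2 : (gp n s).natDegree = s := by
    rw [gp, natDegree_comp, h1, descPochhammer_natDegree, mul_one]
  refine ⟨h2.le, ?_⟩
  have h3 : (gp n s).leadingCoeff = (-1 / 3) ^ s := by
    rw [gp, leadingCoeff_comp (by rw [h1]; norm_num), (monic_descPochhammer ℂ s).leadingCoeff,
      one_mul, descPochhammer_natDegree, leadingCoeff_linear (by norm_num)]
  rw [leadingCoeff, h2] at h3
  exact h3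

lemma desc_add (x y : ℂ) (J : ℕ) : (descPochhammer ℂ J).eval (x + y) =
    ∑ ab ∈ Finset.HasAntidiagonal.antidiagonal J, (J.choose ab.1 : ℂ) *
      ((descPochhammer ℂ ab.1).eval x * (descPochhammer ℂ ab.2).eval y) := by
  have key : ∀ k (z : ℂ), (descPochhammer ℤ k).smeval z = (descPochhammer ℂ k).eval z := by
    intro k z
    rw [← descPochhammer_map (algebraMap ℤ ℂ), eval_map, ← aeval_def, aeval_eq_smeval]
  have := Ring.descPochhammer_smeval_add J (Commute.all x y)
  simpa only [key] using this

lemma Af_add (c b : ℕ) :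
    Af (c + b) = Af c * 3 ^ b * (descPochhammer ℂ b).eval ((c : ℂ) + b + 1 / 3) := by
  rw [Af, Finset.prod_range_add, ← Af, mul_assoc, descPochhammer_eval_eq_prod_range,
    ← Finset.prod_range_reflect, ← Finset.card_range b, ← Finset.prod_const, Finset.card_range,
    ← Finset.prod_mul_distrib]
  congr 1
  refine Finset.prod_congr rfl fun l hl => ?_
  rw [Finset.mem_range] at hl
  rw [Nat.cast_add, Nat.cast_sub (by omega), Nat.cast_sub (by omega)]
  push_cast; ring

lemma Bf_add (c b : ℕ) :
    Bf (c + b) = Bf c * 3 ^ b * (descPochhammer ℂ b).eval ((c : ℂ) + b - 1 / 3) := by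
  rw [Bf, Finset.prod_range_add, ← Bf, mul_assoc, descPochhammer_eval_eq_prod_range,
    ← Finset.prod_range_reflect, ← Finset.card_range b, ← Finset.prod_const, Finset.card_range,
    ← Finset.prod_mul_distrib]
  congr 1
  refine Finset.prod_congr rfl fun l hl => ?_
  rw [Finset.mem_range] at hl
  rw [Nat.cast_add, Nat.cast_sub (by omega), Nat.cast_sub (by omega)]
  push_cast; ring

lemma LL_gp_add (i s J : ℕ) : LL (i + s + J) i (gp (i + s + J) s)
    = 3 ^ J * ((i + s + J + J).factorial : ℂ) /
      ((i + s + J).factorial * J.factorial * Af (i + J) * Bf (s + J)) := by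
  have h1 : LL (i + s + J) i (gp (i + s + J) s) = ∑ ab ∈ Finset.HasAntidiagonal.antidiagonal J,
      (1 : ℂ) / (ab.1.factorial * ab.2.factorial * Af (i + ab.1) * Bf (s + ab.2)) := by
    rw [LL_apply]
    symm
    refine Finset.sum_of_injOn (fun ab => i + ab.1) ?_ ?_ ?_ ?_
    · rintro ⟨a, b⟩ hab ⟨a', b'⟩ hab' h
      simp only [Finset.mem_coe,
        Finset.HasAntidiagonal.mem_antidiagonal] at hab hab' h
      simp only [Prod.mk.injEq]
      omega
    · rintro ⟨a, b⟩ hab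
      simp only [Finset.mem_coe, Finset.HasAntidiagonal.mem_antidiagonal, Finset.mem_range] at hab ⊢
      omega
    · intro j hj hni
      rw [Finset.mem_range] at hj
      rw [gp_eval s (d := i + s + J - j) (by omega)]
      by_cases h1 : j < i
      · rw [Nat.descFactorial_of_lt h1]; simp
      · rw [Nat.descFactorial_of_lt (n := i + s + J - j), Nat.cast_zero, mul_zero]
        by_contra h2
        refine hni ⟨(j - i, i + J - j), ?_, ?_⟩
        · rw [Finset.mem_coe, Finset.HasAntidiagonal.mem_antidiagonal]; omega
        · simp only; omega
    · rintro ⟨a, b⟩ hab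
      rw [Finset.HasAntidiagonal.mem_antidiagonal] at hab
      simp only at hab ⊢
      have hd : i + s + J - (i + a) = s + b := by omega
      rw [gp_eval s (d := s + b) (by omega), hd]
      have e1 := Nat.factorial_mul_descFactorial (Nat.le_add_right i a)
      have e2 := Nat.factorial_mul_descFactorial (Nat.le_add_right s b)
      rw [Nat.add_sub_cancel_left] at e1 e2
      rw [← e1, ← e2]
      have := Af_ne_zero (i + a)
      have := Bf_ne_zero (s + b)
      have := fac_ne_zero a
      have := fac_ne_zero b
      have : ((i + a).descFactorial i : ℂ) ≠ 0 := fun h0 => by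
        have := fac_ne_zero (i + a)
        rw [← e1, Nat.cast_mul, h0, mul_zero] at this; exact this rfl
      have : ((s + b).descFactorial s : ℂ) ≠ 0 := fun h0 => by
        have := fac_ne_zero (s + b)
        rw [← e2, Nat.cast_mul, h0, mul_zero] at this; exact this rfl
      push_cast
      field_simp
  have h2 := desc_add ((s : ℂ) + J - 1 / 3) ((i : ℂ) + J + 1 / 3) J
  rw [show (s : ℂ) + J - 1 / 3 + ((i : ℂ) + J + 1 / 3) = ((i + s + J + J : ℕ) : ℂ) by
    push_cast; ring, descPochhammer_eval_eq_descFactorial] at h2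
  have h3 := Nat.factorial_mul_descFactorial (Nat.le_add_left J (i + s + J))
  rw [Nat.add_sub_cancel] at h3
  rw [h1, ← h3, Nat.cast_mul, h2, Finset.mul_sum, Finset.mul_sum, Finset.sum_div]
  refine Finset.sum_congr rfl ?_
  rintro ⟨a, b⟩ hab
  rw [Finset.HasAntidiagonal.mem_antidiagonal] at hab
  simp only at hab ⊢
  have eA := Af_add (i + a) b
  have eB := Bf_add (s + b) a
  rw [add_assoc, hab] at eA
  rw [add_assoc, add_comm b a, hab] at eB
  have hJ : ((J : ℕ) : ℂ) = a + b := by rw [← hab]; push_cast; rfl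
  rw [show (((i + a : ℕ) : ℂ) + b + 1 / 3) = (i : ℂ) + J + 1 / 3 by rw [hJ]; push_cast; ring] at eA
  rw [show (((s + b : ℕ) : ℂ) + a - 1 / 3) = (s : ℂ) + J - 1 / 3 by rw [hJ]; push_cast; ring] at eB
  have eC := Nat.choose_mul_factorial_mul_factorial (n := J) (k := a) (by omega)
  rw [show J - a = b by omega] at eC
  have hA := Af_ne_zero (i + J)
  have hB := Bf_ne_zero (s + J)
  have := Af_ne_zero (i + a)
  have := Bf_ne_zero (s + b)
  have := fac_ne_zero a
  have := fac_ne_zero b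
  have := fac_ne_zero J
  have := fac_ne_zero (i + s + J)
  rw [div_eq_div_iff
    (by refine mul_ne_zero (mul_ne_zero (mul_ne_zero ?_ ?_) ?_) ?_ <;> assumption)
    (by refine mul_ne_zero (mul_ne_zero (mul_ne_zero ?_ ?_) ?_) ?_ <;> assumption),
    eA, eB, ← eC, ← hab, pow_add]
  push_cast
  ring

end Moments

end XXZ

namespace XXZ

section Hankel

open Polynomial

lemma LL_gp {n i s : ℕ} (hi : i ≤ n) (hs : s ≤ n) : LL n i (gp n s)
    = 3 ^ n / (3 ^ i * n.factorial * Bf (n - i)) * (1 / (3 ^ s * Af (n - s))) *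
      ((2 * n - i - s).descFactorial n : ℂ) := by
  by_cases h : i + s ≤ n
  · obtain ⟨J, rfl⟩ := Nat.exists_eq_add_of_le h
    rw [LL_gp_add]
    have e1 : i + s + J - i = s + J := by omega
    have e2 : i + s + J - s = i + J := by omega
    have e3 : 2 * (i + s + J) - i - s = J + (i + s + J) := by omega
    have e4 := Nat.factorial_mul_descFactorial (Nat.le_add_left (i + s + J) J)
    rw [Nat.add_sub_cancel] at e4
    rw [e1, e2, e3, show i + s + J + J = J + (i + s + J) by ring, ← e4]
    have := Af_ne_zero (i + J)
    have := Bf_ne_zero (s + J)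
    have := fac_ne_zero J
    have := fac_ne_zero (i + s + J)
    push_cast
    field_simp
    ring
  · rw [Nat.descFactorial_of_lt (by omega), Nat.cast_zero, mul_zero, LL_apply]
    refine Finset.sum_eq_zero fun j hj => ?_
    rw [Finset.mem_range] at hj
    rw [gp_eval s (d := n - j) (by omega)]
    by_cases h1 : j < i
    · rw [Nat.descFactorial_of_lt h1]; simp
    · rw [Nat.descFactorial_of_lt (n := n - j) (by omega), Nat.cast_zero, mul_zero]

/-- A product of two falling factorials of complementary degrees. -/
def pp (n m i : ℕ) : ℂ[X] :=
  descPochhammer ℂ i * (descPochhammer ℂ (m - 1 - i)).comp (X + C ((n : ℂ) - i))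

lemma pp_eval {n i : ℕ} (m u : ℕ) (hi : i ≤ n) : (pp n m i).eval (u : ℂ)
    = u.descFactorial i * (u + n - i).descFactorial (m - 1 - i) := by
  rw [pp, eval_mul, eval_comp, eval_add, eval_C, eval_X]
  rw [show ((u : ℂ) + (n - i)) = ((u + n - i : ℕ) : ℂ) by
    rw [Nat.cast_sub (by omega)]; push_cast; ring]
  rw [descPochhammer_eval_eq_descFactorial, descPochhammer_eval_eq_descFactorial]

lemma descFactorial_eq_pp {n m i s : ℕ} (hm : m ≤ n + 1) (hi : i < m) (hs : s < m) :
    ((2 * n - i - s).descFactorial n : ℂ) =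
      ((2 * n + 1 - s - m).factorial : ℂ) / (n - s).factorial *
        (pp n m i).eval ((n - s : ℕ) : ℂ) := by
  rw [pp_eval m (n - s) (by omega)]
  by_cases h : i + s ≤ n
  · have e1 := Nat.factorial_mul_descFactorial (n := 2 * n - i - s) (k := n) (by omega)
    have e2 := Nat.factorial_mul_descFactorial (n := n - s) (k := i) (by omega)
    have e3 := Nat.factorial_mul_descFactorial (n := n - s + n - i) (k := m - 1 - i) (by omega)
    rw [show 2 * n - i - s - n = n - s - i by omega] at e1
    rw [show n - s + n - i - (m - 1 - i) = 2 * n + 1 - s - m by omega,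
      show n - s + n - i = 2 * n - i - s by omega] at e3
    rw [show n - s + n - i = 2 * n - i - s by omega]
    have h1 := fac_ne_zero (n - s)
    have h2 := fac_ne_zero (n - s - i)
    rw [div_mul_eq_mul_div, eq_div_iff h1]
    refine mul_left_cancel₀ h2 ?_
    have e4 : (n - s).factorial * ((n - s - i).factorial * (2 * n - i - s).descFactorial n)
      = (n - s - i).factorial * ((2 * n + 1 - s - m).factorial *
        ((n - s).descFactorial i * (2 * n - i - s).descFactorial (m - 1 - i))) := by
      rw [e1, ← e3, ← e2]; ring
    have e5 := congrArg (Nat.cast : ℕ → ℂ) e4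
    push_cast at e5
    linear_combination e5
  · rw [Nat.descFactorial_of_lt (by omega), Nat.descFactorial_of_lt (n := n - s) (by omega)]
    simp

lemma dm_leval_sub {n m : ℕ} (hm : m ≤ n + 1) :
    dm m (fun s => leval ((n - s : ℕ) : ℂ)) (fun t => X ^ t)
      = ∏ s ∈ Finset.range m, ((-1) ^ s * (s.factorial : ℂ)) := by
  set P : ℕ → ℂ[X] := fun t => ∏ r ∈ Finset.range t, (X - C ((n : ℂ) - r)) with hP
  rw [← dm_monic (P := P), dm_lower]
  · refine Finset.prod_congr rfl fun s hs => ?_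
    rw [Finset.mem_range] at hs
    rw [leval_apply, hP]
    simp only [eval_prod, eval_sub, eval_X, eval_C]
    rw [← Nat.descFactorial_self, ← descPochhammer_eval_eq_descFactorial,
      descPochhammer_eval_eq_prod_range]
    rw [← Finset.card_range s, ← Finset.prod_const, Finset.card_range, ← Finset.prod_mul_distrib]
    refine Finset.prod_congr rfl fun r _ => ?_
    rw [Nat.cast_sub (by omega)]
    ring
  · intro i s his hs
    rw [leval_apply, hP]
    simp only [eval_prod, eval_sub, eval_X, eval_C]
    refine Finset.prod_eq_zero (Finset.mem_range.mpr his) ?_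
    rw [Nat.cast_sub (by omega)]
    ring
  · intro s _
    rw [hP]
    simp only
    rw [natDegree_prod_of_monic _ _ fun _ _ => monic_X_sub_C _]
    simp only [natDegree_X_sub_C, Finset.sum_const, Finset.card_range, smul_eq_mul, mul_one]
  · exact fun s _ => monic_prod_of_monic _ _ fun _ _ => monic_X_sub_C _

lemma dm_pp {n m : ℕ} (hm : m ≤ n + 1) :
    dm m (fun s => leval ((n - s : ℕ) : ℂ)) (pp n m)
      = (∏ s ∈ Finset.range m, ((-1) ^ s * (s.factorial : ℂ))) *
        ∏ s ∈ Finset.range m, (n.descFactorial s : ℂ) := by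
  have hdeg : ∀ s < m, (pp n m s).natDegree < m := fun s hs =>
    natDegree_desc_mul_desc_comp_lt hs (natDegree_add_le_of_le natDegree_X_le (natDegree_C _).le)
  rw [dm_eq _ _ hdeg, dm_leval_sub hm,
    dm_newton hdeg (fun s => (n.descFactorial (m - 1 - s) : ℂ)),
    Finset.prod_range_reflect (fun s => (n.descFactorial s : ℂ))]
  · intro i s his hs
    rw [pp_eval m i (by omega), Nat.descFactorial_of_lt his, Nat.cast_zero, zero_mul]
  · intro s hs
    rw [pp_eval m s (by omega), Nat.descFactorial_self, Nat.add_sub_cancel_left]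

lemma dm_LL_X {n m : ℕ} (hm : m ≤ n + 1) :
    dm m (LL n) (fun t => X ^ t) * ∏ s ∈ Finset.range m, (-1 / 3 : ℂ) ^ s
      = (∏ i ∈ Finset.range m, (3 ^ n / (3 ^ i * n.factorial * Bf (n - i)) : ℂ)) *
        (∏ s ∈ Finset.range m, (1 / (3 ^ s * Af (n - s)) *
          (((2 * n + 1 - s - m).factorial : ℂ) / (n - s).factorial))) *
        ((∏ s ∈ Finset.range m, ((-1) ^ s * (s.factorial : ℂ))) *
          ∏ s ∈ Finset.range m, (n.descFactorial s : ℂ)) := by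
  rw [← dm_pp hm, ← dm_transpose_scale (L := LL n) (P := gp n),
    dm_upper (LL n) fun s _ => (gp_coeff n s).1]
  · congr 1
    exact Finset.prod_congr rfl fun s _ => (gp_coeff n s).2.symm
  · intro i hi s hs
    rw [LL_gp (by omega) (by omega), descFactorial_eq_pp hm hi hs, leval_apply]
    ring

end Hankel

end XXZ

namespace XXZ

section Evaluation

open Polynomial

lemma sg_eq_prod (m : ℕ) : sg m = ∏ s ∈ Finset.range m, (-1 : ℂ) ^ s := by
  induction m with
  | zero => simp [sg]
  | succ m ih => rw [sg_succ, ih, Finset.prod_range_succ, mul_comm]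

/-- The factors of the evaluated determinant. -/
def uf (n s : ℕ) : ℂ := (3 * n + 1 - s).factorial * s.factorial * n.descFactorial s /
  (n.factorial * (n - s).factorial * (Af (n - s) * Bf (n - s)))

/-- The evaluated determinant, up to a power of three. -/
def Fv (n m : ℕ) : ℂ := dm n (fun c => leval (3 * (c : ℂ) + 1)) (fun t => X ^ t) *
  (∏ l ∈ Finset.range (n + m), (l.factorial : ℂ)⁻¹) * (∏ s ∈ Finset.range m, uf n s) *
  ∏ s ∈ Finset.range m, ((2 * n + 1 - s - m).factorial : ℂ)

lemma sg_mul_Dt {n m h : ℕ} (hm : m ≤ n + 1) (hh : m + h = 3 * n + 2) :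
    sg m * Dt n m ((X - C 1) ^ h) = Fv n m := by
  rw [Dt_eq, dm_colE, dm_transpose_scale (L' := LL n) (P' := ee n m)
    (fun s => (-1) ^ (m - 1 - s) * (h.factorial / 3 ^ n)) (fun i => 3 ^ i)
    (fun s hs i _ => fn_tri_eq i hs hh), dm_LL_ee hm]
  have hM : dm m (LL n) (fun t => X ^ t) = (∏ s ∈ Finset.range m, (-3 : ℂ) ^ s) *
      (dm m (LL n) (fun t => X ^ t) * ∏ s ∈ Finset.range m, (-1 / 3 : ℂ) ^ s) := by
    rw [mul_left_comm, ← Finset.prod_mul_distrib, Finset.prod_eq_one, mul_one]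
    intro s _
    rw [← mul_pow]; norm_num
  rw [hM, dm_LL_X hm, sg_eq_prod, Fv, Finset.prod_mul_distrib (f := fun s => (-1 : ℂ) ^ (m - 1 - s)),
    Finset.prod_range_reflect (fun s => (-1 : ℂ) ^ s)]
  have key : (∏ s ∈ Finset.range m, uf n s) *
      ∏ s ∈ Finset.range m, ((2 * n + 1 - s - m).factorial : ℂ)
      = (∏ s ∈ Finset.range m, (-1 : ℂ) ^ s) * ((∏ s ∈ Finset.range m, (-1 : ℂ) ^ s) *
        (∏ _s ∈ Finset.range m, ((h.factorial : ℂ) / 3 ^ n)) * (∏ s ∈ Finset.range m, 3 ^ s) *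
        ((∏ s ∈ Finset.range m, (-3 : ℂ) ^ s) *
        ((∏ i ∈ Finset.range m, (3 ^ n / (3 ^ i * n.factorial * Bf (n - i)) : ℂ)) *
        (∏ s ∈ Finset.range m, (1 / (3 ^ s * Af (n - s)) *
          (((2 * n + 1 - s - m).factorial : ℂ) / (n - s).factorial))) *
        ((∏ s ∈ Finset.range m, ((-1) ^ s * (s.factorial : ℂ))) *
          ∏ s ∈ Finset.range m, (n.descFactorial s : ℂ))) *
        ∏ s ∈ Finset.range m, ((3 * n + 1 - s).descFactorial (m - 1 - s) : ℂ))) := by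
    simp only [← Finset.prod_mul_distrib]
    refine Finset.prod_congr rfl fun s hs => ?_
    rw [Finset.mem_range] at hs
    have e := Nat.factorial_mul_descFactorial (n := 3 * n + 1 - s) (k := m - 1 - s) (by omega)
    rw [show 3 * n + 1 - s - (m - 1 - s) = h by omega] at e
    have h1 : (-3 : ℂ) ^ s = (-1) ^ s * 3 ^ s := by rw [← mul_pow]; norm_num
    have h2 : (-1 : ℂ) ^ s * (-1) ^ s = 1 := by rw [← mul_pow]; norm_num
    have h3 : (-1 : ℂ) ^ s * (-1) ^ s * ((-1) ^ s * (-1) ^ s) = 1 := by rw [h2, mul_one]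
    rw [uf, ← e, h1]
    have := Af_ne_zero (n - s)
    have := Bf_ne_zero (n - s)
    have := fac_ne_zero n
    have := fac_ne_zero (n - s)
    have h4 : (3 : ℂ) ≠ 0 := by norm_num
    push_cast
    calc _ = ((-1 : ℂ) ^ s * (-1) ^ s * ((-1) ^ s * (-1) ^ s)) *
          (((h.factorial : ℂ) * (3 * n + 1 - s).descFactorial (m - 1 - s) * s.factorial *
            n.descFactorial s / (n.factorial * (n - s).factorial * (Af (n - s) * Bf (n - s)))) *
            (2 * n + 1 - s - m).factorial) := by rw [h3, one_mul]
      _ = _ := by field_simp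
  rw [mul_assoc _ (∏ s ∈ Finset.range m, uf n s), key]
  ring

lemma ev1_GG_eq {q p : ℂ} (h : Om q p) {n m k : ℕ} (hm : m + k = n + 1) :
    ev1 (GG q p n k) = 3 ^ (k.choose 2) * Fv n m := by
  rw [ev1_GG h hm, ← sg_mul_Dt (h := 2 * n + 1 + k) (by omega) (by omega)]
  ring

lemma uf_eq (m d : ℕ) : uf (m + d) m * ((3 * d + 1).factorial * d.factorial)
    = (3 * (m + d) + 1 - m).factorial * m.factorial * 3 ^ d := by
  have e := Nat.factorial_mul_descFactorial (Nat.le_add_right m d)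
  rw [Nat.add_sub_cancel_left] at e
  rw [uf, Nat.add_sub_cancel_left, ← e, factorial_three_mul_add_one]
  have := Af_ne_zero d
  have := Bf_ne_zero d
  have := fac_ne_zero d
  have : ((m + d).descFactorial m : ℂ) ≠ 0 := fun h0 => by
    have := fac_ne_zero (m + d)
    rw [← e, Nat.cast_mul, h0, mul_zero] at this; exact this rfl
  push_cast
  field_simp

lemma prod_factorial_succ (m d : ℕ) :
    (∏ s ∈ Finset.range (m + 1), ((2 * (m + d) + 1 - s - (m + 1)).factorial : ℂ)) *
      (m + d + d + 1).factorial
    = (∏ s ∈ Finset.range m, ((2 * (m + d) + 1 - s - m).factorial : ℂ)) *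
      ((2 * d).factorial * (2 * d + 1).factorial) := by
  have h1 := Finset.prod_range_succ' (fun s => ((m + 2 * d + 1 - s).factorial : ℂ)) (m + 1)
  have h2 := Finset.prod_range_succ (fun s => ((m + 2 * d + 1 - s).factorial : ℂ)) (m + 1)
  rw [Finset.prod_range_succ (fun s => ((m + 2 * d + 1 - s).factorial : ℂ)) m, h1] at h2
  have e1 : ∏ s ∈ Finset.range (m + 1), ((2 * (m + d) + 1 - s - (m + 1)).factorial : ℂ)
      = ∏ s ∈ Finset.range (m + 1), ((m + 2 * d + 1 - (s + 1)).factorial : ℂ) :=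
    Finset.prod_congr rfl fun s _ => by
      rw [show 2 * (m + d) + 1 - s - (m + 1) = m + 2 * d + 1 - (s + 1) by omega]
  have e2 : ∏ s ∈ Finset.range m, ((2 * (m + d) + 1 - s - m).factorial : ℂ)
      = ∏ s ∈ Finset.range m, ((m + 2 * d + 1 - s).factorial : ℂ) :=
    Finset.prod_congr rfl fun s _ => by
      rw [show 2 * (m + d) + 1 - s - m = m + 2 * d + 1 - s by omega]
  rw [e1, e2, show m + d + d + 1 = m + 2 * d + 1 - 0 by omega, h2, mul_assoc,
    mul_comm ((2 * d).factorial : ℂ), show m + 2 * d + 1 - m = 2 * d + 1 by omega,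
    show m + 2 * d + 1 - (m + 1) = 2 * d by omega]

lemma ev1_GG_ratio {q p : ℂ} (h : Om q p) {n m d : ℕ} (hm : m + d = n) :
    ev1 (GG q p n d) * ((n + m).factorial * (3 * d + 1).factorial * d.factorial *
        (n + d + 1).factorial)
      = ev1 (GG q p n (d + 1)) * ((3 * n + 1 - m).factorial * m.factorial *
        ((2 * d).factorial * (2 * d + 1).factorial)) := by
  subst hm
  rw [ev1_GG_eq h (m := m + 1) (k := d) (by omega), ev1_GG_eq h (m := m) (k := d + 1) (by omega),
    Fv, Fv, ← add_assoc, Finset.prod_range_succ, Finset.prod_range_succ,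
    Nat.choose_succ_succ' d 1, Nat.choose_one_right, pow_add]
  have e1 := uf_eq m d
  have e2 := prod_factorial_succ m d
  have e3 : ((m + d + m).factorial : ℂ)⁻¹ * (m + d + m).factorial = 1 :=
    inv_mul_cancel₀ (fac_ne_zero _)
  set c := dm (m + d) (fun c => leval (3 * (c : ℂ) + 1)) (fun t => X ^ t)
  set a := ∏ l ∈ Finset.range (m + d + m), (l.factorial : ℂ)⁻¹
  set b := ∏ s ∈ Finset.range m, uf (m + d) s
  calc _ = (3 ^ d.choose 2 * c * a * b) * (((m + d + m).factorial : ℂ)⁻¹ * (m + d + m).factorial) *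
        (uf (m + d) m * ((3 * d + 1).factorial * d.factorial)) *
        ((∏ s ∈ Finset.range (m + 1), ((2 * (m + d) + 1 - s - (m + 1)).factorial : ℂ)) *
          (m + d + d + 1).factorial) := by ring
    _ = _ := by rw [e1, e2, e3]; ring

end Evaluation

end XXZ

namespace XXZ
open MvPolynomial

section Conj

/-- Complex conjugation of the coefficients. -/
abbrev cj : R →+* R := MvPolynomial.map (starRingEnd ℂ)

lemma cj_TT (q p : ℂ) (i : ℕ) (f : R) :
    cj (TT q p i f) = TT (starRingEnd ℂ q) (starRingEnd ℂ p) i (cj f) := by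
  have hne : (X (i + 1) - X i : R) ≠ 0 :=
    sub_ne_zero.mpr fun h => absurd (X_injective h) (by omega)
  refine mul_left_cancel₀ hne ?_
  rw [TT_spec]
  have := congrArg cj (TT_spec q p i f)
  simp only [map_mul, map_sub, map_X, map_C, map_rename] at this
  simp only [cj] at this ⊢
  rw [this]

lemma cj_psiAux (q p : ℂ) (N m : ℕ) (μ : ℕ → Bool) :
    cj (psiAux q p N m μ) = psiAux (starRingEnd ℂ q) (starRingEnd ℂ p) N m μ := by
  have h0 : ∀ μ, cj (P0 q p N μ) = P0 (starRingEnd ℂ q) (starRingEnd ℂ p) N μ := by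
    intro μ
    rw [P0, P0, map_prod]
    refine Finset.prod_congr rfl fun e _ => ?_
    split_ifs
    · simp only [cj, map_sub, map_mul, map_C, map_X]
    · exact map_one _
  induction m generalizing μ with
  | zero => exact h0 μ
  | succ m ih =>
    rw [psiAux, psiAux]
    split_ifs with h
    · rw [cj_TT, ih]
    · exact h0 μ

lemma ev1_cj (f : R) : ev1 (cj f) = starRingEnd ℂ (ev1 f) := by
  have : (MvPolynomial.eval (fun _ : ℕ => (1 : ℂ))).comp cj
      = (starRingEnd ℂ).comp (MvPolynomial.eval fun _ : ℕ => (1 : ℂ)) := by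
    ext <;> simp
  exact congrFun (congrArg DFunLike.coe this) f

lemma vv_conj {q p : ℂ} (hq : starRingEnd ℂ q = p) (hp : starRingEnd ℂ p = q) {N : ℕ} (f : Cfg N) :
    vv p q N f = starRingEnd ℂ (vv q p N f) := by
  rw [vv, vv, ← ev1_cj, psi, psi, cj_psiAux, hq, hp]

end Conj

lemma Sz_mulVec {N : ℕ} (v : Cfg N → ℂ) (f : Cfg N) : (Sz N).mulVec v f
    = (1 / 2) * (2 * ((Finset.univ.filter fun i => f i = true).card : ℂ) - N) * v f := by
  have h1 : ∀ i, (localOp N i sigmaZ).mulVec v f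
      = (2 * (if f i = true then 1 else 0) - 1) * v f := by
    intro i
    rw [localOp_mulVec, Fintype.sum_bool]
    have h2 : ∀ b, f i = b → Function.update f i b = f := fun b hb => by
      rw [← hb, Function.update_eq_self]
    rcases hfi : f i with _ | _
    · simp [sigmaZ, h2 _ hfi]
    · simp [sigmaZ, h2 _ hfi]; ring
  rw [Sz, Matrix.smul_mulVec, Pi.smul_apply, Matrix.sum_mulVec, Finset.sum_apply,
    Finset.sum_congr rfl fun i _ => h1 i, ← Finset.sum_mul, Finset.sum_sub_distrib,
    ← Finset.mul_sum, Finset.sum_boole]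
  simp
  ring

lemma secC_of_Sz {n : ℕ} {Ψ : Cfg (2 * n + 1) → ℂ}
    (hSz : (Sz (2 * n + 1)).mulVec Ψ = ((1 / 2) : ℂ) • Ψ) (f : Cfg (2 * n + 1)) (hf : Ψ f ≠ 0) :
    SecC (2 * n + 1) (n + 1) f := by
  have h := congrFun hSz f
  rw [Sz_mulVec, Pi.smul_apply, smul_eq_mul] at h
  have h2 := mul_right_cancel₀ hf h
  unfold SecC
  have h3 : ((Finset.univ.filter fun i => f i = true).card : ℂ) = ((n + 1 : ℕ) : ℂ) := by
    push_cast at h2 ⊢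
    linear_combination h2
  exact_mod_cast h3

lemma pUp_mulVec {N : ℕ} (i : Fin N) (v : Cfg N → ℂ) (f : Cfg N) :
    (pUp N i).mulVec v f = if f i = true then v f else 0 := by
  rw [pUp, Matrix.smul_mulVec, Pi.smul_apply, Matrix.add_mulVec, Pi.add_apply, Matrix.one_mulVec,
    localOp_mulVec, Fintype.sum_bool]
  have h2 : ∀ b, f i = b → Function.update f i b = f := fun b hb => by
    rw [← hb, Function.update_eq_self]
  rcases hfi : f i with _ | _
  · simp [sigmaZ, h2 _ hfi]
  · simp [sigmaZ, h2 _ hfi]; ring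

lemma list_pUp_mulVec {N : ℕ} (l : List (Fin N)) (v : Cfg N → ℂ) (f : Cfg N) :
    ((l.map (pUp N)).prod).mulVec v f = if ∀ i ∈ l, f i = true then v f else 0 := by
  induction l with
  | nil => simp
  | cons i l ih =>
    rw [List.map_cons, List.prod_cons, ← Matrix.mulVec_mulVec, pUp_mulVec, ih]
    simp only [List.mem_cons, forall_eq_or_imp]
    split_ifs <;> simp_all

lemma projProd_mulVec {N k : ℕ} (v : Cfg N → ℂ) (f : Cfg N) :
    (projProd N k).mulVec v f = if ∀ i : Fin N, i.val < k → f i = true then v f else 0 := by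
  rw [projProd, list_pUp_mulVec]
  simp

lemma hermInner_projProd {N k : ℕ} (v : Cfg N → ℂ) : hermInner v ((projProd N k).mulVec v)
    = ∑ f, if ∀ i : Fin N, i.val < k → f i = true then (Complex.normSq (v f) : ℂ) else 0 := by
  rw [hermInner]
  refine Finset.sum_congr rfl fun f _ => ?_
  rw [projProd_mulVec]
  split_ifs
  · rw [← Complex.normSq_eq_conj_mul_self]
  · rw [mul_zero]

lemma hermInner_projProd_ne_zero {N k a : ℕ} (hka : k ≤ a) {v : Cfg N → ℂ}
    (hv : v (fBase N a) ≠ 0) : hermInner v ((projProd N k).mulVec v) ≠ 0 := by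
  rw [hermInner_projProd]
  have h1 : (∑ f : Cfg N, if ∀ i : Fin N, i.val < k → f i = true then (Complex.normSq (v f) : ℂ)
      else 0) = ((∑ f : Cfg N, if ∀ i : Fin N, i.val < k → f i = true then Complex.normSq (v f)
      else 0 : ℝ) : ℂ) := by
    rw [Complex.ofReal_sum]
    exact Finset.sum_congr rfl fun f _ => by split_ifs <;> simp
  rw [h1, Complex.ofReal_ne_zero]
  refine (Finset.sum_pos' (fun f _ => ?_) ⟨fBase N a, Finset.mem_univ _, ?_⟩).ne'
  · split_ifs
    · exact Complex.normSq_nonneg _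
    · exact le_rfl
  · rw [if_pos]
    · exact Complex.normSq_pos.mpr hv
    · intro i hi
      simp only [fBase, decide_eq_true_eq]
      omega

lemma ev1_GG_hermInner {q p c : ℂ} (hq : starRingEnd ℂ q = p) (hp : starRingEnd ℂ p = q)
    {n k : ℕ} (hk : k ≤ 2 * n + 1) {Ψ : Cfg (2 * n + 1) → ℂ}
    (hsec : ∀ f, Ψ f ≠ 0 → SecC (2 * n + 1) (n + 1) f)
    (hc : ∀ f, SecC (2 * n + 1) (n + 1) f → vv q p (2 * n + 1) f = c * Ψ f) :
    ev1 (GG q p n k) = Complex.normSq c * hermInner Ψ ((projProd (2 * n + 1) k).mulVec Ψ) := by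
  rw [hermInner_projProd, Finset.mul_sum, GG, ev1, map_sum]
  refine Finset.sum_congr rfl fun f _ => ?_
  have hiff : (∀ j < k, extC f j = true) ↔ ∀ i : Fin (2 * n + 1), i.val < k → f i = true := by
    constructor
    · intro h i hi
      rw [← ext_apply f i]
      exact h i.val hi
    · intro h j hj
      have := h ⟨j, by omega⟩ hj
      exact (ext_apply f ⟨j, by omega⟩).trans this
  by_cases h1 : SecC (2 * n + 1) (n + 1) f
  · by_cases h2 : ∀ i : Fin (2 * n + 1), i.val < k → f i = true
    · rw [if_pos ⟨h1, hiff.mpr h2⟩, if_pos h2, gg, map_mul, map_mul, wtZ_eval]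
      have e1 : eval (fun _ : ℕ => (1 : ℂ)) (psi q p (2 * n + 1) (extC f)) = c * Ψ f := hc f h1
      have e2 : eval (fun _ : ℕ => (1 : ℂ)) (psi p q (2 * n + 1) (extC f))
          = starRingEnd ℂ (c * Ψ f) := by
        rw [← hc f h1, ← vv_conj hq hp, vv]
      rw [e1, e2, Finset.prod_eq_one fun j _ => by simp, one_mul, Complex.mul_conj,
        Complex.normSq_mul, Complex.ofReal_mul]
    · rw [if_neg fun h => h2 (hiff.mp h.2), if_neg h2, map_zero, mul_zero]
  · have h0 : Ψ f = 0 := by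
      by_contra h
      exact h1 (hsec f h)
    rw [if_neg fun h => h1 h.1, h0, map_zero]
    simp

/-- The primitive cube root of unity in the upper half plane. -/
def om : ℂ := ⟨-1 / 2, √3 / 2⟩

lemma om_spec : Om om (starRingEnd ℂ om) := by
  have h3 : √3 * √3 = 3 := Real.mul_self_sqrt (by norm_num)
  constructor
  · apply Complex.ext <;> simp [om]
  · apply Complex.ext <;> simp [om] <;> nlinarith

lemma EFP_ratio_succ {n d m : ℕ} (hn : 1 ≤ n) (hm : m + d = n)
    (Ψ : Cfg (2 * n + 1) → ℂ) (hΨ : Ψ ≠ 0) (E₀ : ℝ)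
    (hground : (Hper (2 * n + 1)).mulVec Ψ = (E₀ : ℂ) • Ψ)
    (hmin : ∀ (E : ℂ) (v : Cfg (2 * n + 1) → ℂ), v ≠ 0 →
      (Hper (2 * n + 1)).mulVec v = E • v → E₀ ≤ E.re)
    (hSz : (Sz (2 * n + 1)).mulVec Ψ = ((1 / 2) : ℂ) • Ψ) :
    EFP Ψ d ≠ 0 ∧ EFP Ψ (d + 1) ≠ 0 ∧
      EFP Ψ d / EFP Ψ (d + 1) =
        (((2 * d).factorial : ℂ) * ((2 * d + 1).factorial : ℂ) * ((3 * n + 1 - m).factorial : ℂ) *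
          (m.factorial : ℂ)) /
        ((d.factorial : ℂ) * ((3 * d + 1).factorial : ℂ) * ((n + m).factorial : ℂ) *
          ((n + d + 1).factorial : ℂ)) := by
  have hsec := secC_of_Sz hSz
  obtain ⟨hne, c, hc0, hc⟩ := ground_unique om_spec hn hΨ hground hmin hsec
  have hb := hne _ (fBase_sec (by omega))
  have hp : starRingEnd ℂ (starRingEnd ℂ om) = om := Complex.conj_conj _
  have hn0 : hermInner Ψ Ψ ≠ 0 := by
    have := hermInner_projProd_ne_zero (Nat.zero_le (n + 1)) hb
    have h1 : (projProd (2 * n + 1) 0).mulVec Ψ = Ψ := by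
      funext f
      rw [projProd_mulVec, if_pos]
      intro i hi
      omega
    rwa [h1] at this
  have hd := hermInner_projProd_ne_zero (k := d) (by omega : d ≤ n + 1) hb
  have hd' := hermInner_projProd_ne_zero (k := d + 1) (by omega : d + 1 ≤ n + 1) hb
  refine ⟨div_ne_zero hd hn0, div_ne_zero hd' hn0, ?_⟩
  have hr := ev1_GG_ratio om_spec hm
  rw [ev1_GG_hermInner rfl hp (by omega) hsec hc, ev1_GG_hermInner rfl hp (by omega) hsec hc] at hr
  have hcn : (Complex.normSq c : ℂ) ≠ 0 := by
    rw [Complex.ofReal_ne_zero]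
    exact (Complex.normSq_pos.mpr hc0).ne'
  rw [EFP, EFP, div_div_div_cancel_right₀ hn0, div_eq_div_iff hd' (mul_ne_zero (mul_ne_zero
    (mul_ne_zero (fac_ne_zero _) (fac_ne_zero _)) (fac_ne_zero _)) (fac_ne_zero _))]
  refine mul_left_cancel₀ hcn ?_
  linear_combination hr

end XXZ

theorem EFP_ratio_plus (n k : ℕ) (hn : 1 ≤ n) (hk : 1 ≤ k) (hkn : k ≤ n + 1)
    (Ψ : Cfg (2*n+1) → ℂ) (hΨ : Ψ ≠ 0) (E₀ : ℝ)
    (hground : (Hper (2*n+1)).mulVec Ψ = (E₀ : ℂ) • Ψ)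
    (hmin : ∀ (E : ℂ) (v : Cfg (2*n+1) → ℂ), v ≠ 0 →
      (Hper (2*n+1)).mulVec v = E • v → E₀ ≤ E.re)
    (hSz : (Sz (2*n+1)).mulVec Ψ = ((1/2) : ℂ) • Ψ) :
    EFP Ψ (k-1) ≠ 0 ∧ EFP Ψ k ≠ 0 ∧
      EFP Ψ (k-1) / EFP Ψ k =
        (((2*k-2).factorial : ℂ) * ((2*k-1).factorial : ℂ) * ((2*n+k).factorial : ℂ) *
          ((n-k+1).factorial : ℂ)) /
        (((k-1).factorial : ℂ) * ((3*k-2).factorial : ℂ) * ((2*n-k+1).factorial : ℂ) *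
          ((n+k).factorial : ℂ)) := by
  obtain ⟨d, rfl⟩ : ∃ d, k = d + 1 := ⟨k - 1, by omega⟩
  obtain ⟨m, rfl⟩ : ∃ m, n = m + d := ⟨n - d, by omega⟩
  have h := XXZ.EFP_ratio_succ hn rfl Ψ hΨ E₀ hground hmin hSz
  have hfac : ((m + d - (d + 1) + 1).factorial : ℂ) = m.factorial := by
    rcases m with _ | m
    · simp
    · rw [show m + 1 + d - (d + 1) + 1 = m + 1 by omega]
  have hfac' : (2 * (m + d) - (d + 1) + 1).factorial = (m + d + m).factorial := by
    rw [show 2 * (m + d) - (d + 1) + 1 = m + d + m by omega]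
  rw [hfac, hfac', Nat.add_sub_cancel, show 2 * (d + 1) - 2 = 2 * d by omega,
    show 2 * (d + 1) - 1 = 2 * d + 1 by omega, show 3 * (d + 1) - 2 = 3 * d + 1 by omega,
    show 2 * (m + d) + (d + 1) = 3 * (m + d) + 1 - m by omega,
    show m + d + (d + 1) = m + d + d + 1 by omega]
  exact h
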